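/- For every nonnegative integer n and every k with 0 ≤ k ≤ 6, the number of partitions of 7n+5 whose rank is congruent to k modulo 7 equals p(7n+5)/7; that is, N(k,7,7n+5) = p(7n+5)/7. -/

import Mathlib

/-- The *rank* of a partition: its largest part minus its number of parts. -/
def partitionRank {n : ℕ} (p : Nat.Partition n) : ℤ :=
  (p.parts.sup : ℤ) - (Multiset.card p.parts : ℤ)

open Filter Topology

/-- Dyson's map: delete the first column of the Ferrers diagram and insert a new row whose length
exceeds the old number of rows by `r + 1`. -/
def dysonMap (r : ℤ) (s : Multiset ℕ) : Multiset ℕ :=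
  ((Multiset.card s + r + 1).toNat ::ₘ s.map Nat.pred).filter (· ≠ 0)

/-- The inverse of Dyson's map. -/
def dysonInv (r : ℤ) (t : Multiset ℕ) : Multiset ℕ :=
  (t.erase t.sup).map Nat.succ +
    Multiset.replicate (t.sup - r - 1 - Multiset.card (t.erase t.sup)).toNat 1

/-- The largest part minus the number of parts. -/
def multisetRank (s : Multiset ℕ) : ℤ := s.sup - Multiset.card s

theorem Multiset.sup_mem_of_ne_zero {s : Multiset ℕ} (hs : s ≠ 0) : s.sup ∈ s := by
  induction s using Multiset.induction_on with
  | empty => exact absurd rfl hs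
  | cons a s ih =>
    rw [Multiset.sup_cons]
    rcases eq_or_ne s 0 with rfl | h
    · simp
    · rcases le_total a s.sup with h1 | h1
      · rw [sup_of_le_right h1]; exact Multiset.mem_cons_of_mem (ih h)
      · rw [sup_of_le_left h1]; exact Multiset.mem_cons_self _ _

theorem Multiset.filter_ne_zero_map_pred_map_succ {s : Multiset ℕ} (hs : 0 ∉ s) :
    ((s.map Nat.pred).filter (· ≠ 0)).map Nat.succ = s.filter (· ≠ 1) := by
  rw [Multiset.filter_map, Multiset.map_map]
  have h1 : s.filter ((· ≠ 0) ∘ Nat.pred) = s.filter (· ≠ 1) := by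
    apply Multiset.filter_congr
    intro x hx
    have : x ≠ 0 := fun h => hs (h ▸ hx)
    simp only [Function.comp, Nat.pred_eq_sub_one]
    omega
  rw [h1]
  conv_rhs => rw [← Multiset.map_id (s.filter (· ≠ 1))]
  apply Multiset.map_congr rfl
  intro x hx
  have : x ≠ 0 := fun h => hs (h ▸ (Multiset.mem_filter.1 hx).1)
  simp only [Function.comp, Nat.pred_eq_sub_one, id]
  omega

theorem Multiset.filter_ne_add_replicate (s : Multiset ℕ) (a : ℕ) :
    s.filter (· ≠ a) + Multiset.replicate (Multiset.count a s) a = s := by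
  have h := Multiset.filter_add_not (· = a) s
  rw [Multiset.filter_eq', add_comm] at h
  exact h

theorem Multiset.sum_map_pred {s : Multiset ℕ} (hs : 0 ∉ s) :
    (s.map Nat.pred).sum + Multiset.card s = s.sum := by
  induction s using Multiset.induction_on with
  | empty => simp
  | cons a s ih =>
    have ha : a ≠ 0 := fun h => hs (by simp [h])
    have := ih (fun h => hs (Multiset.mem_cons_of_mem h))
    simp only [Multiset.map_cons, Multiset.sum_cons, Multiset.card_cons, Nat.pred_eq_sub_one]
      at this ⊢
    omega

theorem Multiset.sum_filter_ne_zero (s : Multiset ℕ) : (s.filter (· ≠ 0)).sum = s.sum := by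
  induction s using Multiset.induction_on with
  | empty => simp
  | cons a s ih =>
    rw [Multiset.filter_cons, Multiset.sum_add, ih, Multiset.sum_cons]
    by_cases h : a = 0 <;> simp [h]

section Dyson

variable {r : ℤ} {s t : Multiset ℕ}

theorem zero_notMem_dysonMap : 0 ∉ dysonMap r s := by
  simp [dysonMap]

theorem sup_dysonMap (h1 : (s.sup : ℤ) ≤ Multiset.card s + r + 2)
    (h2 : 0 ≤ Multiset.card s + r + 1) :
    ((dysonMap r s).sup : ℤ) = Multiset.card s + r + 1 := by
  obtain ⟨c, hc⟩ := Int.eq_ofNat_of_zero_le h2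
  rw [dysonMap, hc, Int.toNat_natCast]
  norm_cast
  apply le_antisymm
  · apply Multiset.sup_le.2
    intro b hb
    obtain ⟨hb, -⟩ := Multiset.mem_filter.1 hb
    rcases Multiset.mem_cons.1 hb with rfl | hb
    · exact le_rfl
    · obtain ⟨x, hx, rfl⟩ := Multiset.mem_map.1 hb
      have := Multiset.le_sup hx
      simp only [Nat.pred_eq_sub_one]
      omega
  · rcases eq_or_ne c 0 with rfl | h
    · exact Nat.zero_le _
    · exact Multiset.le_sup (Multiset.mem_filter.2 ⟨Multiset.mem_cons_self _ _, h⟩)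

theorem erase_sup_dysonMap (h1 : (s.sup : ℤ) ≤ Multiset.card s + r + 2)
    (h2 : 0 ≤ Multiset.card s + r + 1) :
    (dysonMap r s).erase (dysonMap r s).sup = (s.map Nat.pred).filter (· ≠ 0) := by
  have h3 := sup_dysonMap h1 h2
  obtain ⟨c, hc⟩ := Int.eq_ofNat_of_zero_le h2
  have h4 : (dysonMap r s).sup = c := by omega
  rw [h4, dysonMap, hc, Int.toNat_natCast]
  rcases eq_or_ne c 0 with rfl | h
  · rw [Multiset.filter_cons_of_neg _ (by simp), Multiset.erase_of_notMem]
    simp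
  · rw [Multiset.filter_cons_of_pos (p := (· ≠ 0)) _ h, Multiset.erase_cons_head]

theorem dysonInv_dysonMap (hs : 0 ∉ s) (h1 : (s.sup : ℤ) ≤ Multiset.card s + r + 2)
    (h2 : 0 ≤ Multiset.card s + r + 1) : dysonInv r (dysonMap r s) = s := by
  rw [dysonInv, erase_sup_dysonMap h1 h2, sup_dysonMap h1 h2,
    Multiset.filter_ne_zero_map_pred_map_succ hs]
  have h3 := congrArg Multiset.card (Multiset.filter_ne_zero_map_pred_map_succ hs)
  rw [Multiset.card_map] at h3
  have h4 := congrArg Multiset.card (Multiset.filter_ne_add_replicate s 1)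
  rw [Multiset.card_add, Multiset.card_replicate] at h4
  have h5 : ((Multiset.card s : ℤ) + r + 1 - r - 1 -
      (Multiset.card ((s.map Nat.pred).filter (· ≠ 0)) : ℤ)).toNat = Multiset.count 1 s := by
    omega
  rw [h5, Multiset.filter_ne_add_replicate]

theorem sum_dysonMap (hs : 0 ∉ s) (h2 : 0 ≤ Multiset.card s + r + 1) :
    ((dysonMap r s).sum : ℤ) = s.sum + r + 1 := by
  rw [dysonMap, Multiset.sum_filter_ne_zero, Multiset.sum_cons]
  have := Multiset.sum_map_pred hs
  rw [Nat.cast_add, Int.toNat_of_nonneg h2]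
  omega

theorem le_multisetRank_dysonMap (h1 : (s.sup : ℤ) ≤ Multiset.card s + r + 2)
    (h2 : 0 ≤ Multiset.card s + r + 1) : r ≤ multisetRank (dysonMap r s) := by
  rw [multisetRank, sup_dysonMap h1 h2]
  have h3 : Multiset.card (dysonMap r s) ≤ Multiset.card s + 1 := by
    refine (Multiset.card_le_card (Multiset.filter_le _ _)).trans ?_
    simp
  omega

theorem card_erase_sup_le (h1 : r ≤ multisetRank t) (h2 : r + 1 ≤ t.sup) :
    (Multiset.card (t.erase t.sup) : ℤ) ≤ t.sup - r - 1 := by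
  rw [multisetRank] at h1
  rcases eq_or_ne t 0 with rfl | h
  · simp at h2 ⊢; omega
  · rw [Multiset.card_erase_of_mem (Multiset.sup_mem_of_ne_zero h)]
    have := Multiset.card_pos.2 h
    rw [Nat.pred_eq_sub_one]
    omega

theorem card_dysonInv (h1 : r ≤ multisetRank t) (h2 : r + 1 ≤ t.sup) :
    (Multiset.card (dysonInv r t) : ℤ) = t.sup - r - 1 := by
  have h3 := card_erase_sup_le h1 h2
  rw [dysonInv, Multiset.card_add, Multiset.card_map, Multiset.card_replicate]
  push_cast
  rw [Int.toNat_of_nonneg (by omega)]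
  ring

theorem zero_notMem_dysonInv : 0 ∉ dysonInv r t := by
  intro h
  rcases Multiset.mem_add.1 h with h | h
  · simp at h
  · exact absurd (Multiset.eq_of_mem_replicate h) (by simp)

theorem sup_dysonInv_le : (dysonInv r t).sup ≤ t.sup + 1 := by
  apply Multiset.sup_le.2
  intro b hb
  rcases Multiset.mem_add.1 hb with h | h
  · obtain ⟨x, hx, rfl⟩ := Multiset.mem_map.1 h
    exact Nat.succ_le_succ (Multiset.le_sup (Multiset.mem_of_mem_erase hx))
  · rw [Multiset.eq_of_mem_replicate h]; omega

theorem dysonMap_dysonInv (ht : 0 ∉ t) (h1 : r ≤ multisetRank t) (h2 : r + 1 ≤ t.sup) :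
    dysonMap r (dysonInv r t) = t := by
  have h3 : ((Multiset.card (dysonInv r t) : ℤ) + r + 1).toNat = t.sup := by
    rw [card_dysonInv h1 h2]; omega
  rw [dysonMap, h3, dysonInv, Multiset.map_add, Multiset.map_map, Multiset.map_replicate,
    ← Multiset.cons_add, Multiset.filter_add]
  have h4 : (Multiset.replicate (t.sup - r - 1 - Multiset.card (t.erase t.sup) : ℤ).toNat
      (Nat.pred 1)).filter (· ≠ 0) = 0 := by
    rw [Multiset.filter_eq_nil]
    intro a ha
    simp [Multiset.eq_of_mem_replicate ha]
  have h5 : (t.erase t.sup).map (Nat.pred ∘ Nat.succ) = t.erase t.sup := by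
    conv_rhs => rw [← Multiset.map_id (t.erase t.sup)]
    rfl
  rw [h4, add_zero, h5]
  rcases eq_or_ne t 0 with rfl | h
  · simp
  · rw [Multiset.cons_erase (Multiset.sup_mem_of_ne_zero h), Multiset.filter_eq_self]
    rintro a ha rfl
    exact ht ha

end Dyson

/-- The number `n (n - 1) / 2`, for an integer `n`. -/
def tri (n : ℤ) : ℤ := n * (n - 1) / 2

theorem two_mul_tri (n : ℤ) : 2 * tri n = n * (n - 1) := by
  rw [tri, Int.mul_ediv_cancel']
  rcases Int.even_or_odd n with h | h
  · exact (h.mul_right _).two_dvd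
  · exact ((h.sub_odd odd_one).mul_left _).two_dvd

theorem tri_add (a b : ℤ) : tri (a + b) = tri a + tri b + a * b := by
  refine mul_left_cancel₀ (two_ne_zero' ℤ) ?_
  linear_combination two_mul_tri (a + b) - two_mul_tri a - two_mul_tri b

theorem tri_neg (n : ℤ) : tri (-n) = tri n + n := by
  refine mul_left_cancel₀ (two_ne_zero' ℤ) ?_
  linear_combination two_mul_tri (-n) - two_mul_tri n

@[simp] theorem tri_zero : tri 0 = 0 := rfl

@[simp] theorem tri_one : tri 1 = 0 := rfl

theorem tri_add_one (n : ℤ) : tri (n + 1) = tri n + n := by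
  rw [tri_add, tri_one]; ring

/-- The theta series `∑ uⁿ⁽ⁿ⁻¹⁾ᐟ² xⁿ` over all integers `n`. -/
noncomputable def thetaSeries (u x : ℂ) : ℂ := ∑' n : ℤ, u ^ tri n * x ^ n

section ThetaSeries

variable {u x : ℂ}

theorem summable_nat_zpow_tri_mul (hu : u ≠ 0) (hu1 : ‖u‖ < 1) (x : ℂ) :
    Summable fun n : ℕ => u ^ tri n * x ^ n := by
  rcases eq_or_ne x 0 with rfl | hx
  · refine summable_of_ne_finset_zero (s := {0}) fun n hn => ?_
    rw [zero_pow (by simpa using hn), mul_zero]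
  refine summable_of_ratio_test_tendsto_lt_one (l := 0) one_pos
    (Eventually.of_forall fun n => mul_ne_zero (zpow_ne_zero _ hu) (pow_ne_zero _ hx)) ?_
  have h : ∀ n : ℕ, ‖u ^ tri (n + 1 : ℕ) * x ^ (n + 1)‖ / ‖u ^ tri n * x ^ n‖ =
      ‖u‖ ^ n * ‖x‖ := by
    intro n
    rw [← norm_div, ← norm_pow, ← norm_mul]
    congr 1
    rw [Nat.cast_add, Nat.cast_one, tri_add_one, zpow_add₀ hu, zpow_natCast, pow_succ]
    field_simp
  simp_rw [h]
  simpa using (tendsto_pow_atTop_nhds_zero_of_lt_one (norm_nonneg u) hu1).mul_const ‖x‖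

theorem summable_thetaSeries (hu : u ≠ 0) (hu1 : ‖u‖ < 1) (hx : x ≠ 0) :
    Summable fun n : ℤ => u ^ tri n * x ^ n := by
  refine Summable.of_nat_of_neg ?_ ?_
  · simpa using summable_nat_zpow_tri_mul hu hu1 x
  · refine (summable_nat_zpow_tri_mul hu hu1 (u / x)).congr fun n => ?_
    rw [tri_neg, zpow_add₀ hu, zpow_neg, div_pow, zpow_natCast, zpow_natCast]
    field_simp

theorem thetaSeries_mul_left (hu : u ≠ 0) (hx : x ≠ 0) :
    thetaSeries u (u * x) = x⁻¹ * thetaSeries u x := by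
  rw [thetaSeries, thetaSeries, ← tsum_mul_left,
    ← (Equiv.addRight (1 : ℤ)).tsum_eq (fun n : ℤ => x⁻¹ * (u ^ tri n * x ^ n))]
  refine tsum_congr fun n => ?_
  rw [Equiv.coe_addRight, tri_add_one, mul_zpow, zpow_add₀ hu, zpow_add_one₀ hx]
  field_simp

theorem thetaSeries_inv (hu : u ≠ 0) (hx : x ≠ 0) :
    thetaSeries u x⁻¹ = x⁻¹ * thetaSeries u x := by
  rw [← thetaSeries_mul_left hu hx, thetaSeries, thetaSeries, ← (Equiv.neg ℤ).tsum_eq]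
  refine tsum_congr fun n => ?_
  rw [Equiv.neg_apply, tri_neg, mul_zpow, zpow_add₀ hu, inv_zpow, zpow_neg, inv_inv]
  ring

end ThetaSeries

/-- Multisets of positive integers, i.e. partitions of arbitrary size. -/
abbrev ZeroFree : Type := {s : Multiset ℕ // 0 ∉ s}

namespace ZeroFree

/-- The rank of a partition of arbitrary size. -/
def rank (s : ZeroFree) : ℤ := multisetRank s.1

/-- Partitions of arbitrary size, sorted by size. -/
def sigmaEquiv : (Σ n, Nat.Partition n) ≃ ZeroFree where
  toFun p := ⟨p.2.parts, fun h => (p.2.parts_pos h).ne rfl⟩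
  invFun s := ⟨s.1.sum, ⟨s.1, fun {i} h => Nat.pos_of_ne_zero fun h0 => s.2 (h0 ▸ h), rfl⟩⟩
  left_inv := by rintro ⟨n, ⟨s, h, rfl⟩⟩; rfl
  right_inv := by rintro ⟨s, h⟩; rfl

theorem sum_sigmaEquiv (p : Σ n, Nat.Partition n) : (sigmaEquiv p).1.sum = p.1 := p.2.parts_sum

end ZeroFree

theorem Nat.Partition.card_le_two_pow (n : ℕ) : Fintype.card (Nat.Partition n) ≤ 2 ^ n := by
  refine (Fintype.card_le_of_surjective _ Nat.Partition.ofComposition_surj).trans ?_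
  rw [composition_card]
  exact Nat.pow_le_pow_right two_pos (Nat.sub_le n 1)

theorem summable_pow_sum_zeroFree {q : ℂ} (hq : ‖q‖ < 1 / 2) :
    Summable fun s : ZeroFree => ‖q ^ s.1.sum‖ := by
  rw [← ZeroFree.sigmaEquiv.summable_iff]
  refine (summable_sigma_of_nonneg fun _ => norm_nonneg _).2 ?_
  refine ⟨fun n => Summable.of_finite, ?_⟩
  simp only [ZeroFree.sum_sigmaEquiv, tsum_fintype, Finset.sum_const, nsmul_eq_mul]
  refine Summable.of_nonneg_of_le (fun n => by positivity) (fun n => ?_)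
    (summable_geometric_of_lt_one (r := 2 * ‖q‖) (by positivity) (by linarith))
  rw [mul_pow, norm_pow, Finset.card_univ]
  gcongr
  exact_mod_cast Nat.Partition.card_le_two_pow n

/-- The generating function by size of a set of partitions. -/
noncomputable def partitionGF (A : Set ZeroFree) (q : ℂ) : ℂ := ∑' s : A, q ^ s.1.1.sum

section GF

variable {q : ℂ} {A B : Set ZeroFree} {f : ZeroFree → ℤ}

theorem norm_partitionGF_le (hq : ‖q‖ < 1 / 2) :
    ‖partitionGF A q‖ ≤ ∑' s : ZeroFree, ‖q ^ s.1.sum‖ :=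
  (norm_tsum_le_tsum_norm ((summable_pow_sum_zeroFree hq).subtype A)).trans
    ((summable_pow_sum_zeroFree hq).tsum_subtype_le _ _ fun _ => norm_nonneg _)

theorem partitionGF_union (hq : ‖q‖ < 1 / 2) (h : Disjoint A B) :
    partitionGF (A ∪ B) q = partitionGF A q + partitionGF B q :=
  Summable.tsum_union_disjoint (f := fun s : ZeroFree => q ^ s.1.sum) h
    ((summable_pow_sum_zeroFree hq).of_norm.subtype A)
    ((summable_pow_sum_zeroFree hq).of_norm.subtype B)

theorem partitionGF_empty_partition : partitionGF {s | s.1 = 0} q = 1 := by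
  have : {s : ZeroFree | s.1 = 0} = {⟨0, by simp⟩} := by
    ext s; simp [Subtype.ext_iff]
  rw [this, partitionGF, tsum_singleton (f := fun s : ZeroFree => q ^ s.1.sum)]
  simp

/-- Dyson's map as a bijection between two sets of partitions. -/
def dysonEquiv (r : ℤ) :
    {s : ZeroFree | (s.1.sup : ℤ) ≤ Multiset.card s.1 + r + 2 ∧ 0 ≤ Multiset.card s.1 + r + 1} ≃
      {t : ZeroFree | r ≤ t.rank ∧ r + 1 ≤ t.1.sup} where
  toFun s := ⟨⟨dysonMap r s.1.1, zero_notMem_dysonMap⟩,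
    le_multisetRank_dysonMap s.2.1 s.2.2, by
      have := sup_dysonMap s.2.1 s.2.2
      simp only [this]
      omega⟩
  invFun t := ⟨⟨dysonInv r t.1.1, zero_notMem_dysonInv⟩, by
    have h1 := card_dysonInv t.2.1 t.2.2
    have h2 := sup_dysonInv_le (r := r) (t := t.1.1)
    simp only [Set.mem_ofPred_eq]
    omega⟩
  left_inv s := Subtype.ext (Subtype.ext (dysonInv_dysonMap s.1.2 s.2.1 s.2.2))
  right_inv t := Subtype.ext (Subtype.ext (dysonMap_dysonInv t.1.2 t.2.1 t.2.2))

theorem sum_dysonEquiv (r : ℤ) (s) :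
    ((dysonEquiv r s).1.1.sum : ℤ) = s.1.1.sum + r + 1 :=
  sum_dysonMap s.1.2 s.2.2

theorem ZeroFree.sup_pos (s : ZeroFree) (h : s.1 ≠ 0) : 0 < s.1.sup :=
  Nat.pos_of_ne_zero fun h0 => by
    have h1 := Multiset.sup_mem_of_ne_zero h
    rw [h0] at h1
    exact s.2 h1

theorem partitionGF_le_rank (hq : ‖q‖ < 1 / 2) (hf : f = ZeroFree.rank ∨ f = -ZeroFree.rank)
    (m : ℕ) : partitionGF {s | s.1 ≠ 0 ∧ (m : ℤ) ≤ f s} q =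
      q ^ (m + 1) * (partitionGF Set.univ q -
        partitionGF {s | s.1 ≠ 0 ∧ ((m + 3 : ℕ) : ℤ) ≤ f s} q) := by
  have h0 : partitionGF Set.univ q -
      partitionGF {s | s.1 ≠ 0 ∧ ((m + 3 : ℕ) : ℤ) ≤ f s} q =
        partitionGF {s | f s ≤ m + 2} q := by
    rw [sub_eq_iff_eq_add, ← partitionGF_union hq]
    · congr 1
      ext s
      simp only [Set.mem_univ, Set.mem_union, Set.mem_ofPred_eq, true_iff]
      by_cases h : s.1 = 0
      · left
        rcases hf with rfl | rfl <;>
          simp only [ZeroFree.rank, multisetRank, h, Pi.neg_apply] <;> simp <;> omega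
      · simp only [ne_eq, h, not_false_eq_true, true_and]; omega
    · rw [Set.disjoint_left]
      intro s hs ht
      simp only [Set.mem_ofPred_eq] at hs ht
      omega
  rw [h0, partitionGF, partitionGF, ← tsum_mul_left]
  rcases hf with rfl | rfl
  · have e1 : {s : ZeroFree | (s.1.sup : ℤ) ≤ Multiset.card s.1 + m + 2 ∧
        (0 : ℤ) ≤ Multiset.card s.1 + m + 1} = {s : ZeroFree | s.rank ≤ (m + 2 : ℤ)} := by
      ext s; simp only [Set.mem_ofPred_eq, ZeroFree.rank, multisetRank]; omega
    have e2 : {t : ZeroFree | (m : ℤ) ≤ t.rank ∧ (m : ℤ) + 1 ≤ t.1.sup} =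
        {s | s.1 ≠ 0 ∧ (m : ℤ) ≤ s.rank} := by
      ext s
      simp only [Set.mem_ofPred_eq, ZeroFree.rank, multisetRank]
      by_cases h : s.1 = 0
      · simp [h]
      · have := Multiset.card_pos.2 h
        simp only [ne_eq, h, not_false_eq_true, true_and]; omega
    rw [← e1, ← e2, ← (dysonEquiv m).tsum_eq]
    refine tsum_congr fun s => ?_
    have := sum_dysonEquiv m s
    rw [← pow_add]
    congr 1
    omega
  · have e1 : {s : ZeroFree | (s.1.sup : ℤ) ≤ Multiset.card s.1 + (-m - 2) + 2 ∧
        (0 : ℤ) ≤ Multiset.card s.1 + (-m - 2) + 1} =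
          {s | s.1 ≠ 0 ∧ (m : ℤ) ≤ (-ZeroFree.rank) s} := by
      ext s
      simp only [Set.mem_ofPred_eq, ZeroFree.rank, multisetRank, Pi.neg_apply]
      by_cases h : s.1 = 0
      · simp [h]
        omega
      · have := s.sup_pos h
        simp only [ne_eq, h, not_false_eq_true, true_and]; omega
    have e2 : {t : ZeroFree | (-m - 2 : ℤ) ≤ t.rank ∧ (-m - 2 : ℤ) + 1 ≤ t.1.sup} =
        {s | (-ZeroFree.rank) s ≤ m + 2} := by
      ext s
      simp only [Set.mem_ofPred_eq, ZeroFree.rank, multisetRank, Pi.neg_apply]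
      omega
    rw [← e1, ← e2, ← (dysonEquiv (-m - 2)).tsum_eq]
    refine tsum_congr fun s => ?_
    have := sum_dysonEquiv (-m - 2) s
    rw [← pow_add]
    congr 1
    omega

/-- The series `∑ (-1)ⁱ⁻¹ q^(i (3 i - 1) / 2 + m i)` over `i ≥ 1`. -/
noncomputable def tailSeries (q : ℂ) (m : ℤ) : ℂ :=
  q ^ (m + 1) * ∑' i : ℕ, (q ^ 3) ^ tri i * (-q ^ (m + 4)) ^ i

theorem norm_pow_lt_one {n : ℕ} (hq : ‖q‖ < 1 / 2) (hn : n ≠ 0) : ‖q ^ n‖ < 1 := by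
  rw [norm_pow]; exact pow_lt_one₀ (norm_nonneg q) (by linarith) hn

theorem tailSeries_eq (hq0 : q ≠ 0) (hq : ‖q‖ < 1 / 2) (m : ℤ) :
    tailSeries q m = q ^ (m + 1) * (1 - tailSeries q (m + 3)) := by
  have h3 := norm_pow_lt_one hq three_ne_zero
  rw [tailSeries, tailSeries, (summable_nat_zpow_tri_mul (pow_ne_zero 3 hq0) h3 _).tsum_eq_zero_add]
  simp only [Nat.cast_zero, tri_zero, zpow_zero, pow_zero, mul_one, sub_eq_add_neg, ← neg_mul]
  rw [← tsum_mul_left]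
  congr 2
  refine tsum_congr fun i => ?_
  rw [Nat.cast_succ, tri_add_one, zpow_add₀ (pow_ne_zero 3 hq0), pow_succ, zpow_natCast,
    show m + 3 + 4 = (m + 4) + 3 by ring, zpow_add₀ hq0 (m + 4) 3, show m + 3 + 1 = m + 4 by ring,
    ← neg_mul, mul_pow]
  norm_cast
  ring

theorem norm_tailSeries_le (hq0 : q ≠ 0) (hq : ‖q‖ < 1 / 2) (m : ℕ) :
    ‖tailSeries q m‖ ≤ ∑' i : ℕ, ‖(q ^ 3) ^ tri i * (1 : ℂ) ^ i‖ := by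
  have h3 := norm_pow_lt_one hq three_ne_zero
  rw [tailSeries, norm_mul]
  refine (mul_le_of_le_one_left (norm_nonneg _) ?_).trans (tsum_of_norm_bounded
    (summable_nat_zpow_tri_mul (pow_ne_zero 3 hq0) h3 1).norm.hasSum fun i => ?_)
  · exact_mod_cast (norm_pow_lt_one hq m.succ_ne_zero).le
  · rw [norm_mul, norm_mul, one_pow, norm_one, norm_pow, norm_neg]
    gcongr
    refine pow_le_one₀ (norm_nonneg _) ?_
    exact_mod_cast (norm_pow_lt_one hq (m + 3).succ_ne_zero).le

theorem partitionGF_le_rank_eq (hq0 : q ≠ 0) (hq : ‖q‖ < 1 / 2)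
    (hf : f = ZeroFree.rank ∨ f = -ZeroFree.rank) (m : ℕ) :
    partitionGF {s | s.1 ≠ 0 ∧ (m : ℤ) ≤ f s} q =
      partitionGF Set.univ q * tailSeries q m := by
  obtain ⟨C, hC⟩ : ∃ C, ∀ m : ℕ, ‖partitionGF {s | s.1 ≠ 0 ∧ (m : ℤ) ≤ f s} q -
      partitionGF Set.univ q * tailSeries q m‖ ≤ C := by
    refine ⟨_, fun m => (norm_sub_le _ _).trans (add_le_add (norm_partitionGF_le hq)
      ((norm_mul _ _).trans_le (mul_le_mul_of_nonneg_left (norm_tailSeries_le hq0 hq m)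
        (norm_nonneg _))))⟩
  have key : ∀ k m : ℕ, ‖partitionGF {s | s.1 ≠ 0 ∧ (m : ℤ) ≤ f s} q -
      partitionGF Set.univ q * tailSeries q m‖ ≤ ‖q‖ ^ k * C := by
    intro k
    induction k with
    | zero => simpa using hC
    | succ k ih =>
      intro m
      have h1 := partitionGF_le_rank hq hf m
      have h2 := tailSeries_eq hq0 hq m
      have h3 := ih (m + 3)
      have h4 : partitionGF {s | s.1 ≠ 0 ∧ (m : ℤ) ≤ f s} q -
          partitionGF Set.univ q * tailSeries q m = -(q ^ m * (q * (partitionGF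
            {s | s.1 ≠ 0 ∧ ((m + 3 : ℕ) : ℤ) ≤ f s} q -
              partitionGF Set.univ q * tailSeries q (m + 3 : ℕ)))) := by
        rw [h1, h2]
        push_cast
        norm_cast
        ring
      rw [h4, norm_neg, norm_mul, norm_mul, pow_succ', mul_assoc]
      refine (mul_le_of_le_one_left (by positivity) ?_).trans (by gcongr)
      rw [norm_pow]
      exact pow_le_one₀ (norm_nonneg _) (by linarith)
  have hlim : Tendsto (fun k : ℕ => ‖q‖ ^ k * C) atTop (𝓝 0) := by
    simpa using (tendsto_pow_atTop_nhds_zero_of_lt_one (norm_nonneg q)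
      (by linarith)).mul_const C
  exact sub_eq_zero.1 (norm_le_zero_iff.1 (ge_of_tendsto' hlim fun k => key k m))

theorem partitionGF_univ_mul (hq0 : q ≠ 0) (hq : ‖q‖ < 1 / 2) :
    partitionGF Set.univ q * (1 - tailSeries q 0 - tailSeries q 1) = 1 := by
  have h : partitionGF Set.univ q = 1 + partitionGF {s | s.1 ≠ 0 ∧ ((0 : ℕ) : ℤ) ≤ s.rank} q +
      partitionGF {s | s.1 ≠ 0 ∧ ((1 : ℕ) : ℤ) ≤ (-ZeroFree.rank) s} q := by
    rw [← partitionGF_empty_partition (q := q), ← partitionGF_union hq, ← partitionGF_union hq]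
    · congr 1
      ext s
      simp only [Set.mem_univ, Set.mem_union, Set.mem_ofPred_eq, true_iff, Pi.neg_apply]
      by_cases h : s.1 = 0
      · simp [h]
      · simp only [h, ne_eq, not_false_eq_true, true_and, false_or]; omega
    · rw [Set.disjoint_left]
      intro s hs ht
      simp only [Set.mem_ofPred_eq, Set.mem_union, Pi.neg_apply] at hs ht
      rcases hs with hs | hs
      · exact ht.1 hs
      · omega
    · rw [Set.disjoint_left]
      exact fun s hs ht => ht.1 hs
  rw [partitionGF_le_rank_eq hq0 hq (Or.inl rfl), partitionGF_le_rank_eq hq0 hq (Or.inr rfl)] at h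
  push_cast at h
  linear_combination h

end GF

section Lambert

variable {q : ℂ} {f : ZeroFree → ℤ}

theorem one_sub_norm_le_norm_one_sub_pow {r : ℂ} (hr : ‖r‖ < 1) {n : ℕ} (hn : n ≠ 0) :
    1 - ‖r‖ ≤ ‖1 - r ^ n‖ := by
  have h1 := norm_sub_norm_le (1 : ℂ) (r ^ n)
  rw [norm_one, norm_pow] at h1
  have h2 : ‖r‖ ^ n ≤ ‖r‖ := pow_le_of_le_one (norm_nonneg _) hr.le hn
  linarith

theorem one_sub_pow_ne_zero {r : ℂ} (hr : ‖r‖ < 1) {n : ℕ} (hn : n ≠ 0) : 1 - r ^ n ≠ 0 :=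
  norm_pos_iff.1 ((sub_pos.2 hr).trans_le (one_sub_norm_le_norm_one_sub_pow hr hn))

theorem norm_div_one_sub_pow_le {r : ℂ} (hr : ‖r‖ < 1) (a : ℂ) {n : ℕ} (hn : n ≠ 0) :
    ‖a / (1 - r ^ n)‖ ≤ ‖a‖ * (1 - ‖r‖)⁻¹ := by
  rw [norm_div, div_eq_mul_inv]
  have := one_sub_norm_le_norm_one_sub_pow hr hn
  have := sub_pos.2 hr
  gcongr

/-- The series `∑ (-1)ⁱ⁻¹ q^(i (3 i - 1) / 2 + j i) / (1 - q^(7 i))` over `i ≥ 1`. -/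
noncomputable def lambertTail (q : ℂ) (j : ℤ) : ℂ :=
  q ^ (j + 1) * ∑' i : ℕ, (q ^ 3) ^ tri i * (-q ^ (j + 4)) ^ i / (1 - (q ^ 7) ^ (i + 1))

theorem summable_lambertTail (hq0 : q ≠ 0) (hq : ‖q‖ < 1 / 2) (x : ℂ) :
    Summable fun i : ℕ => (q ^ 3) ^ tri i * x ^ i / (1 - (q ^ 7) ^ (i + 1)) :=
  Summable.of_norm_bounded ((summable_nat_zpow_tri_mul (pow_ne_zero 3 hq0)
    (norm_pow_lt_one hq three_ne_zero) x).norm.mul_right (1 - ‖q ^ 7‖)⁻¹)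
    fun _ => norm_div_one_sub_pow_le (norm_pow_lt_one hq (by norm_num)) _ (Nat.succ_ne_zero _)

theorem lambertTail_sub (hq0 : q ≠ 0) (hq : ‖q‖ < 1 / 2) (j : ℤ) :
    lambertTail q j - lambertTail q (j + 7) = tailSeries q j := by
  have h1 : lambertTail q (j + 7) = q ^ (j + 1) * ∑' i : ℕ, (q ^ 7) ^ (i + 1) *
      ((q ^ 3) ^ tri i * (-q ^ (j + 4)) ^ i / (1 - (q ^ 7) ^ (i + 1))) := by
    rw [lambertTail, show j + 7 + 1 = j + 1 + 7 by ring, zpow_add₀ hq0, mul_assoc, ← tsum_mul_left]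
    congr 2
    ext i
    rw [show j + 7 + 4 = j + 4 + 7 by ring, zpow_add₀ hq0, ← neg_mul, mul_pow]
    norm_cast
    ring
  rw [h1, lambertTail, tailSeries, ← mul_sub, ← Summable.tsum_sub]
  · congr 2
    ext i
    have := one_sub_pow_ne_zero (norm_pow_lt_one hq (show 7 ≠ 0 by norm_num)) i.succ_ne_zero
    field_simp
  · exact summable_lambertTail hq0 hq _
  · refine Summable.of_norm_bounded (summable_lambertTail hq0 hq (-q ^ (j + 4))).norm fun i => ?_
    rw [norm_mul, norm_pow]
    exact mul_le_of_le_one_left (norm_nonneg _)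
      (pow_le_one₀ (norm_nonneg _) (norm_pow_lt_one hq (by norm_num)).le)

theorem tendsto_lambertTail (hq0 : q ≠ 0) (hq : ‖q‖ < 1 / 2) :
    Tendsto (fun m : ℕ => lambertTail q m) atTop (𝓝 0) := by
  have h7 : ‖q ^ 7‖ < 1 := norm_pow_lt_one hq (by norm_num)
  have hs := (summable_nat_zpow_tri_mul (pow_ne_zero 3 hq0)
    (norm_pow_lt_one hq three_ne_zero) 1).norm.mul_right (1 - ‖q ^ 7‖)⁻¹
  refine squeeze_zero_norm (fun m => (?_ : _ ≤ ‖q‖ ^ m * ∑' i : ℕ,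
    ‖(q ^ 3) ^ tri i * (1 : ℂ) ^ i‖ * (1 - ‖q ^ 7‖)⁻¹)) ?_
  · rw [lambertTail, norm_mul]
    gcongr
    · rw [norm_zpow, zpow_add_one₀ (norm_ne_zero_iff.2 hq0), zpow_natCast]
      exact mul_le_of_le_one_right (by positivity) (by linarith)
    · refine tsum_of_norm_bounded hs.hasSum fun i => ?_
      refine (norm_div_one_sub_pow_le h7 _ (Nat.succ_ne_zero _)).trans ?_
      have := sub_pos.2 h7
      rw [norm_mul, norm_mul, one_pow, norm_one, norm_pow, norm_neg]
      gcongr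
      refine pow_le_one₀ (norm_nonneg _) ?_
      exact_mod_cast (norm_pow_lt_one hq (m + 3).succ_ne_zero).le
  · simpa using (tendsto_pow_atTop_nhds_zero_of_lt_one (norm_nonneg q) (by linarith)).mul_const _

theorem HasSum.congr_terms {ι M : Type*} [AddCommMonoid M] [TopologicalSpace M] {f g : ι → M}
    {a : M} (h : ∀ i, f i = g i) (hf : HasSum f a) :
    HasSum g a := funext h ▸ hf

theorem multisetRank_abs_le (s : ZeroFree) : |s.rank| ≤ s.1.sum := by
  have h1 : Multiset.card s.1 ≤ s.1.sum := by
    have := Multiset.sum_map_pred s.2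
    omega
  have h2 : s.1.sup ≤ s.1.sum := Multiset.sup_le.2 fun b hb => Multiset.single_le_sum (by simp) _ hb
  rw [ZeroFree.rank, multisetRank, abs_le]
  omega

theorem tendsto_partitionGF {A : ℕ → Set ZeroFree} (hq : ‖q‖ < 1 / 2)
    (hA : ∀ m, ∀ s ∈ A m, m ≤ s.1.sum) :
    Tendsto (fun m : ℕ => partitionGF (A m) q) atTop (𝓝 0) := by
  have h : ∀ m, partitionGF (A m) q =
      ∑' s : ZeroFree, (A m).indicator (fun s : ZeroFree => q ^ s.1.sum) s :=
    fun m => tsum_subtype (A m) fun s : ZeroFree => q ^ s.1.sum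
  simp_rw [h]
  rw [← tsum_zero (α := ℂ) (β := ZeroFree)]
  refine tendsto_tsum_of_dominated_convergence (summable_pow_sum_zeroFree hq) (fun s => ?_)
    (Eventually.of_forall fun m s => norm_indicator_le_norm_self _ _)
  refine tendsto_const_nhds.congr' ?_
  filter_upwards [eventually_gt_atTop s.1.sum] with m hm
  rw [Set.indicator_of_notMem]
  exact fun hs => absurd (hA m s hs) (by omega)

theorem partitionGF_le_rank_mod_eq (hq0 : q ≠ 0) (hq : ‖q‖ < 1 / 2)
    (hf : f = ZeroFree.rank ∨ f = -ZeroFree.rank) (m : ℕ) :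
    partitionGF {s | s.1 ≠ 0 ∧ (m : ℤ) ≤ f s ∧ (7 : ℤ) ∣ f s - m} q =
      partitionGF Set.univ q * (lambertTail q m - lambertTail q (m + 1 : ℕ)) := by
  set D : ℕ → ℂ := fun m => partitionGF {s | s.1 ≠ 0 ∧ (m : ℤ) ≤ f s ∧ (7 : ℤ) ∣ f s - m} q -
    partitionGF Set.univ q * (lambertTail q m - lambertTail q (m + 1 : ℕ)) with hD
  have hper : ∀ m, D m = D (m + 7) := by
    intro m
    have h1 : partitionGF {s | s.1 ≠ 0 ∧ (m : ℤ) ≤ f s ∧ (7 : ℤ) ∣ f s - m} q =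
        partitionGF {s | s.1 ≠ 0 ∧ f s = m} q +
        partitionGF {s | s.1 ≠ 0 ∧ ((m + 7 : ℕ) : ℤ) ≤ f s ∧ (7 : ℤ) ∣ f s - (m + 7 : ℕ)} q := by
      rw [← partitionGF_union hq]
      · congr 1
        ext s
        simp only [Set.mem_ofPred_eq, Set.mem_union]
        rw [← and_or_left]
        refine and_congr_right fun _ => ?_
        omega
      · rw [Set.disjoint_left]
        intro s hs ht
        simp only [Set.mem_ofPred_eq] at hs ht
        omega
    have h2 : partitionGF {s | s.1 ≠ 0 ∧ (m : ℤ) ≤ f s} q =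
        partitionGF {s | s.1 ≠ 0 ∧ f s = m} q +
        partitionGF {s | s.1 ≠ 0 ∧ ((m + 1 : ℕ) : ℤ) ≤ f s} q := by
      rw [← partitionGF_union hq]
      · congr 1
        ext s
        simp only [Set.mem_ofPred_eq, Set.mem_union]
        rw [← and_or_left]
        refine and_congr_right fun _ => ?_
        omega
      · rw [Set.disjoint_left]
        intro s hs ht
        simp only [Set.mem_ofPred_eq] at hs ht
        omega
    rw [partitionGF_le_rank_eq hq0 hq hf, partitionGF_le_rank_eq hq0 hq hf,
      ← lambertTail_sub hq0 hq, ← lambertTail_sub hq0 hq] at h2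
    simp only [hD]
    push_cast at h1 h2 ⊢
    rw [add_right_comm (m : ℤ) 7 1]
    linear_combination h1 - h2
  have hper' : ∀ k, D m = D (m + 7 * k) := by
    intro k
    induction k with
    | zero => rfl
    | succ k ih => rw [ih, hper, mul_add_one, add_assoc]
  have hlim : Tendsto D atTop (𝓝 0) := by
    have h1 := tendsto_lambertTail hq0 hq
    have h2 := (h1.sub (h1.comp (tendsto_add_atTop_nat 1))).const_mul (partitionGF Set.univ q)
    have h3 := (tendsto_partitionGF (A := fun m => {s | s.1 ≠ 0 ∧ (m : ℤ) ≤ f s ∧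
      (7 : ℤ) ∣ f s - m}) hq (fun m s hs => ?_)).sub h2
    · simpa [hD] using h3
    · have h4 := abs_le.1 (multisetRank_abs_le s)
      simp only [Set.mem_ofPred_eq] at hs
      rcases hf with rfl | rfl
      · omega
      · simp only [Pi.neg_apply] at hs
        omega
  have hcomp : Tendsto (fun k : ℕ => m + 7 * k) atTop atTop :=
    tendsto_atTop_mono (fun k => (by omega : k ≤ m + 7 * k)) tendsto_id
  have h0 : D m = 0 := by
    refine tendsto_nhds_unique (tendsto_const_nhds (f := (atTop : Filter ℕ))) ?_
    refine (hlim.comp hcomp).congr fun k => ?_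
    exact (hper' k).symm
  exact sub_eq_zero.1 h0

/-- The bilateral series `∑ (-1)ⁿ q^(n (3 n + 1) / 2 + j n) / (1 - q^(7 n))` over `n ≠ 0`. -/
noncomputable def lambertSeries (q : ℂ) (j : ℤ) : ℂ :=
  ∑' n : ℤ, (q ^ 3) ^ tri n * (-q ^ (j + 2)) ^ n / (1 - (q ^ 7) ^ n)

theorem hasSum_lambertSeries (hq0 : q ≠ 0) (hq : ‖q‖ < 1 / 2) (j : ℤ) :
    HasSum (fun n : ℤ => (q ^ 3) ^ tri n * (-q ^ (j + 2)) ^ n / (1 - (q ^ 7) ^ n))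
      (lambertTail q (7 - j) - lambertTail q (j + 1)) := by
  have h3 : q ^ 3 ≠ 0 := pow_ne_zero 3 hq0
  have h7 : ‖q ^ 7‖ < 1 := norm_pow_lt_one hq (by norm_num)
  rw [sub_eq_neg_add]
  have hx : q ^ j ≠ 0 := zpow_ne_zero j hq0
  refine HasSum.of_nat_of_neg_add_one ?_ ?_
  · rw [← hasSum_nat_add_iff' 1, lambertTail, ← neg_mul]
    simp only [Finset.sum_range_one, Nat.cast_zero, zpow_zero, sub_self, div_zero, sub_zero]
    refine HasSum.congr_terms (fun n : ℕ => ?_)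
      ((summable_lambertTail hq0 hq (-q ^ (j + 1 + 4))).hasSum.mul_left (-q ^ (j + 1 + 1)))
    rw [Nat.cast_succ, tri_add_one, zpow_add₀ h3, show j + 1 + 4 = j + 2 + 3 by ring,
      show j + 1 + 1 = j + 2 by ring, zpow_add₀ hq0 (j + 2) 3, ← neg_mul, mul_pow]
    norm_cast
    ring
  · rw [lambertTail]
    refine HasSum.congr_terms (fun n : ℕ => ?_)
      ((summable_lambertTail hq0 hq (-q ^ (7 - j + 4))).hasSum.mul_left (q ^ (7 - j + 1)))
    have hn := one_sub_pow_ne_zero h7 n.succ_ne_zero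
    have h7' : (q ^ 7) ^ (n + 1) ≠ 0 := pow_ne_zero _ (pow_ne_zero 7 hq0)
    have hn' : 1 - (q ^ 7) ^ (-((n : ℤ) + 1)) = -(1 - (q ^ 7) ^ (n + 1)) / (q ^ 7) ^ (n + 1) := by
      rw [zpow_neg]
      norm_cast
      field_simp
      ring
    have e1 : (-q ^ (j + 2)) ^ (-((n : ℤ) + 1)) = (-(q ^ j * q ^ 2)⁻¹) ^ (n + 1) := by
      rw [zpow_neg, ← inv_zpow, inv_neg, zpow_add₀ hq0]
      norm_cast
    rw [hn', tri_neg, tri_add_one, zpow_add₀ h3, zpow_add₀ h3, zpow_add₀ h3, e1,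
      show 7 - j + 4 = 11 - j by ring, show 7 - j + 1 = 8 - j by ring,
      zpow_sub₀ hq0, zpow_sub₀ hq0, neg_pow (_ / _), neg_pow (_⁻¹), inv_pow, div_pow, mul_pow]
    generalize q ^ j = x at *
    generalize (q ^ 3) ^ tri n = y
    simp only [zpow_natCast, zpow_ofNat]
    rw [Nat.succ_eq_add_one] at hn
    field_simp
    ring

end Lambert

section Rank

variable {q : ℂ}

theorem lambertSeries_eq (hq0 : q ≠ 0) (hq : ‖q‖ < 1 / 2) (j : ℤ) :
    lambertSeries q j = lambertTail q (7 - j) - lambertTail q (j + 1) :=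
  (hasSum_lambertSeries hq0 hq j).tsum_eq

theorem lambertSeries_six_sub (hq0 : q ≠ 0) (hq : ‖q‖ < 1 / 2) (j : ℤ) :
    lambertSeries q (6 - j) = -lambertSeries q j := by
  rw [lambertSeries_eq hq0 hq, lambertSeries_eq hq0 hq, show 7 - (6 - j) = j + 1 by ring,
    show 6 - j + 1 = 7 - j by ring, neg_sub]

theorem one_sub_zpow_ne_zero {r : ℂ} (hr : ‖r‖ < 1) {n : ℤ} (hn : n ≠ 0) :
    1 - r ^ n ≠ 0 := by
  intro h
  have h1 : ‖r‖ ^ n = 1 := by rw [← norm_zpow, ← sub_eq_zero.1 h, norm_one]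
  exact hn ((zpow_eq_one_iff_right₀ (norm_nonneg r) hr.ne).1 h1)

theorem lambertSeries_sub (hq0 : q ≠ 0) (hq : ‖q‖ < 1 / 2) (j : ℤ) :
    lambertSeries q j - lambertSeries q (j + 7) = thetaSeries (q ^ 3) (-q ^ (j + 2)) - 1 := by
  have h3 := pow_ne_zero 3 hq0
  have hs := summable_thetaSeries h3 (norm_pow_lt_one hq three_ne_zero)
    (neg_ne_zero.2 (zpow_ne_zero (j + 2) hq0))
  have h1 := hs.hasSum.sub (hasSum_ite_eq (0 : ℤ) (1 : ℂ))
  have h2 := (hasSum_lambertSeries hq0 hq j).sub (hasSum_lambertSeries hq0 hq (j + 7))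
  rw [← lambertSeries_eq hq0 hq, ← lambertSeries_eq hq0 hq] at h2
  refine h2.unique ?_
  refine HasSum.congr_terms (fun n => Eq.symm ?_) h1
  split_ifs with hn
  · simp [hn]
  · have h7 := one_sub_zpow_ne_zero (norm_pow_lt_one hq (show 7 ≠ 0 by norm_num)) hn
    rw [show j + 7 + 2 = j + 2 + 7 by ring, zpow_add₀ hq0 (j + 2) 7, ← neg_mul, mul_zpow,
      sub_zero]
    simp only [zpow_ofNat]
    field_simp

theorem partitionGF_univ_mul_thetaSeries (hq0 : q ≠ 0) (hq : ‖q‖ < 1 / 2) :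
    partitionGF Set.univ q * thetaSeries (q ^ 3) (-q ^ 2) = 1 := by
  have h1 := lambertSeries_sub hq0 hq 0
  rw [lambertSeries_eq hq0 hq, lambertSeries_eq hq0 hq] at h1
  have h2 := lambertTail_sub hq0 hq 0
  have h3 := lambertTail_sub hq0 hq 1
  have h4 := partitionGF_univ_mul hq0 hq
  norm_num at h1 h2 h3
  norm_cast at h1
  rw [← h4]
  congr 1
  linear_combination -h1 - h2 - h3

theorem partitionGF_rank_mod (hq0 : q ≠ 0) (hq : ‖q‖ < 1 / 2) {k : ℕ} (hk1 : 1 ≤ k)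
    (hk6 : k ≤ 6) : partitionGF {s | s.rank % 7 = k} q =
      partitionGF Set.univ q * (lambertSeries q k - lambertSeries q (k - 1)) := by
  have h : partitionGF {s | s.rank % 7 = k} q =
      partitionGF {s | s.1 ≠ 0 ∧ (k : ℤ) ≤ s.rank ∧ (7 : ℤ) ∣ s.rank - k} q +
      partitionGF {s | s.1 ≠ 0 ∧ ((7 - k : ℕ) : ℤ) ≤ (-ZeroFree.rank) s ∧
        (7 : ℤ) ∣ (-ZeroFree.rank) s - (7 - k : ℕ)} q := by
    rw [← partitionGF_union hq]
    · congr 1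
      ext s
      simp only [Set.mem_ofPred_eq, Set.mem_union, Pi.neg_apply]
      by_cases hs : s.1 = 0
      · have : s.rank = 0 := by simp [ZeroFree.rank, multisetRank, hs]
        simp only [hs, this, ne_eq, not_true_eq_false, false_and, or_self, iff_false]
        omega
      · simp only [hs, ne_eq, not_false_eq_true, true_and]
        omega
    · rw [Set.disjoint_left]
      intro s hs ht
      simp only [Set.mem_ofPred_eq, Pi.neg_apply] at hs ht
      omega
  rw [h, partitionGF_le_rank_mod_eq hq0 hq (Or.inl rfl),
    partitionGF_le_rank_mod_eq hq0 hq (Or.inr rfl), lambertSeries_eq hq0 hq,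
    lambertSeries_eq hq0 hq]
  have e1 : ((7 - k : ℕ) : ℤ) = 7 - k := by omega
  have e2 : ((7 - k + 1 : ℕ) : ℤ) = 7 - (k - 1) := by omega
  rw [e1, e2]
  push_cast
  rw [sub_add_cancel]
  ring

theorem hasSum_partitionGF (hq : ‖q‖ < 1 / 2) (A : Set ZeroFree) [DecidablePred (· ∈ A)] :
    HasSum (fun n => ((Finset.univ.filter fun p : Nat.Partition n =>
      ZeroFree.sigmaEquiv ⟨n, p⟩ ∈ A).card : ℂ) * q ^ n) (partitionGF A q) := by
  have h1 : HasSum (A.indicator fun s : ZeroFree => q ^ s.1.sum) (partitionGF A q) := by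
    rw [← hasSum_subtype_iff_indicator]
    exact ((summable_pow_sum_zeroFree hq).of_norm.subtype A).hasSum
  rw [← ZeroFree.sigmaEquiv.hasSum_iff] at h1
  have h2 := h1.sigma fun n => hasSum_fintype _
  refine HasSum.congr_terms (fun n => Eq.symm ?_) h2
  rw [Finset.card_filter, Nat.cast_sum, Finset.sum_mul]
  refine Finset.sum_congr rfl fun p _ => ?_
  by_cases hp : ZeroFree.sigmaEquiv ⟨n, p⟩ ∈ A
  · simp [hp, ZeroFree.sum_sigmaEquiv]
  · simp [hp]

end Rank

theorem eq_zero_of_hasSum_mul_pow {a : ℕ → ℂ} {δ : ℝ} (hδ : 0 < δ)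
    (h : ∀ q : ℂ, ‖q‖ < δ → HasSum (fun n => a n * q ^ n) 0) : a = 0 := by
  have h1 : HasFPowerSeriesAt (0 : ℂ → ℂ) (FormalMultilinearSeries.ofScalars ℂ a) 0 := by
    rw [hasFPowerSeriesAt_iff]
    filter_upwards [Metric.ball_mem_nhds (0 : ℂ) hδ] with q hq
    simpa [FormalMultilinearSeries.coeff_ofScalars, mul_comm] using
      h q (mem_ball_zero_iff.1 hq)
  have h2 := h1.eq_zero
  ext n
  rw [← FormalMultilinearSeries.coeff_ofScalars (p := a) (n := n) (𝕜 := ℂ), h2]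
  simp [FormalMultilinearSeries.coeff]

/-- A fixed primitive seventh root of unity. -/
noncomputable def rootSeven : ℂ := Complex.exp (2 * Real.pi * Complex.I / 7)

theorem isPrimitiveRoot_rootSeven : IsPrimitiveRoot rootSeven 7 := by
  simpa [rootSeven] using Complex.isPrimitiveRoot_exp 7 (by norm_num)

theorem norm_rootSeven : ‖rootSeven‖ = 1 :=
  isPrimitiveRoot_rootSeven.norm'_eq_one (by norm_num)

theorem sum_rootSeven_pow (d : ℕ) :
    ∑ i ∈ Finset.range 7, rootSeven ^ (d * i) = if 7 ∣ d then 7 else 0 := by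
  simp_rw [pow_mul]
  split_ifs with h
  · rw [(isPrimitiveRoot_rootSeven.pow_eq_one_iff_dvd d).2 h]; simp
  · have h1 : rootSeven ^ d ≠ 1 := fun h1 => h
      ((isPrimitiveRoot_rootSeven.pow_eq_one_iff_dvd d).1 h1)
    rw [geom_sum_eq h1, ← pow_mul, mul_comm, pow_mul, isPrimitiveRoot_rootSeven.pow_eq_one]
    simp

/-- The part of `F` made up of the powers `q ^ (7 n + 5)`, up to a factor `7`. -/
noncomputable def fifthPart (F : ℂ → ℂ) (q : ℂ) : ℂ :=
  ∑ i ∈ Finset.range 7, rootSeven ^ (2 * i) * F (rootSeven ^ i * q)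

theorem fifthPart_pow_mul {g : ℂ → ℂ} {d : ℕ} (hd : ¬ 7 ∣ d + 2) (q : ℂ) :
    fifthPart (fun q => q ^ d * g (q ^ 7)) q = 0 := by
  have h : ∀ i, rootSeven ^ (2 * i) * ((rootSeven ^ i * q) ^ d * g ((rootSeven ^ i * q) ^ 7)) =
      rootSeven ^ ((d + 2) * i) * (q ^ d * g (q ^ 7)) := by
    intro i
    rw [mul_pow _ _ 7, ← pow_mul, mul_comm i 7, pow_mul rootSeven 7,
      isPrimitiveRoot_rootSeven.pow_eq_one, one_pow, one_mul]
    ring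
  simp_rw [fifthPart, h]
  rw [← Finset.sum_mul, sum_rootSeven_pow, if_neg hd, zero_mul]

theorem coeff_eq_zero_of_fifthPart {a : ℕ → ℂ} {F : ℂ → ℂ} {δ : ℝ} (hδ : 0 < δ)
    (h : ∀ q : ℂ, ‖q‖ < δ → HasSum (fun n => a n * q ^ n) (F q))
    (hF : ∀ q : ℂ, q ≠ 0 → ‖q‖ < δ → fifthPart F q = 0) (n : ℕ) : a (7 * n + 5) = 0 := by
  have h1 : ∀ q : ℂ, ‖q‖ < δ →
      HasSum (fun n => (if 7 ∣ n + 2 then 7 * a n else 0) * q ^ n) (fifthPart F q) := by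
    intro q hq
    have h2 := hasSum_sum (s := Finset.range 7) fun i _ =>
      (h (rootSeven ^ i * q) (by simpa [norm_rootSeven] using hq)).mul_left (rootSeven ^ (2 * i))
    refine HasSum.congr_terms (fun n => Eq.symm ?_) h2
    have h3 : ∀ i, rootSeven ^ (2 * i) * (a n * (rootSeven ^ i * q) ^ n) =
        rootSeven ^ ((n + 2) * i) * (a n * q ^ n) := by intro i; ring
    simp_rw [h3]
    rw [← Finset.sum_mul, sum_rootSeven_pow]
    split_ifs <;> ring
  have h4 := eq_zero_of_hasSum_mul_pow hδ fun q hq => (by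
    rcases eq_or_ne q 0 with rfl | hq0
    · refine HasSum.congr_terms (fun n => ?_) hasSum_zero
      rcases eq_or_ne n 0 with rfl | hn <;> simp [*]
    · exact hF q hq0 hq ▸ h1 q hq :
        HasSum (fun n => (if 7 ∣ n + 2 then 7 * a n else 0) * q ^ n) 0)
  have h5 := congrFun h4 (7 * n + 5)
  rw [if_pos (by omega)] at h5
  simpa using h5

theorem HasSum.add_isCompl_range {ι κ κ' : Type*} {f : ι → ℂ} {e : κ → ι} {e' : κ' → ι}
    (he : e.Injective) (he' : e'.Injective) (hc : IsCompl (Set.range e) (Set.range e')) {a b : ℂ}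
    (ha : HasSum (fun i => f (e i)) a) (hb : HasSum (fun i => f (e' i)) b) : HasSum f (a + b) :=
  HasSum.add_isCompl hc (he.hasSum_range_iff.2 ha) (he'.hasSum_range_iff.2 hb)

theorem hasSum_int_prod_of_parity {f : ℤ × ℤ → ℂ} {a b : ℂ}
    (ha : HasSum (fun z : ℤ × ℤ => f (z.1 + z.2, z.1 - z.2)) a)
    (hb : HasSum (fun z : ℤ × ℤ => f (z.1 + z.2 + 1, z.1 - z.2)) b) : HasSum f (a + b) := by
  refine HasSum.add_isCompl_range (e := fun z : ℤ × ℤ => (z.1 + z.2, z.1 - z.2))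
    (e' := fun z : ℤ × ℤ => (z.1 + z.2 + 1, z.1 - z.2)) ?_ ?_ ?_ ha hb
  · rintro ⟨a, b⟩ ⟨c, d⟩ h
    simp only [Prod.mk.injEq] at h ⊢
    omega
  · rintro ⟨a, b⟩ ⟨c, d⟩ h
    simp only [Prod.mk.injEq] at h ⊢
    omega
  · rw [isCompl_iff, Set.disjoint_left, codisjoint_iff]
    constructor
    · rintro _ ⟨z, rfl⟩ ⟨w, h⟩
      simp only [Prod.mk.injEq] at h
      omega
    · refine Set.eq_univ_iff_forall.2 ?_
      rintro ⟨m, n⟩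
      rcases Int.even_or_odd' (m + n) with ⟨k, h | h⟩
      · refine Or.inl ⟨(k, k - n), ?_⟩
        simp only [Prod.mk.injEq]
        omega
      · refine Or.inr ⟨(k, k - n), ?_⟩
        simp only [Prod.mk.injEq]
        omega

section Theta

/-- The theta function `∑ (-1)ⁿ p^(n (n - 1) / 2) xⁿ`. -/
noncomputable def theta (p x : ℂ) : ℂ := thetaSeries p (-x)

variable {p x u : ℂ}

theorem theta_mul_left (hp : p ≠ 0) (hx : x ≠ 0) : theta p (p * x) = -x⁻¹ * theta p x := by
  rw [theta, ← mul_neg, thetaSeries_mul_left hp (neg_ne_zero.2 hx), inv_neg]; rfl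

theorem theta_inv (hp : p ≠ 0) (hx : x ≠ 0) : theta p x⁻¹ = -x⁻¹ * theta p x := by
  rw [theta, ← inv_neg, thetaSeries_inv hp (neg_ne_zero.2 hx), inv_neg]; rfl

theorem theta_one (hp : p ≠ 0) : theta p 1 = 0 := by
  have h := theta_inv hp one_ne_zero
  rw [inv_one, neg_one_mul] at h
  exact self_eq_neg.1 h

theorem theta_div (hp : p ≠ 0) (hx : x ≠ 0) : theta p (p / x) = theta p x := by
  rw [div_eq_mul_inv, theta_mul_left hp (inv_ne_zero hx), theta_inv hp hx]
  field_simp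

theorem norm_zpow_le_add {r R : ℝ} (hr : 0 < r) (h1 : r ≤ ‖x‖) (h2 : ‖x‖ ≤ R) (n : ℤ) :
    ‖x ^ n‖ ≤ R ^ n + r ^ n := by
  have hR : 0 < R := hr.trans_le (h1.trans h2)
  rw [norm_zpow]
  rcases le_total 0 n with hn | hn
  · exact (zpow_le_zpow_left₀ hn (norm_nonneg x) h2).trans (le_add_of_nonneg_right (by positivity))
  · have h3 := inv_anti₀ (by positivity) (zpow_le_zpow_left₀ (neg_nonneg.2 hn) hr.le h1)
    rw [zpow_neg, zpow_neg, inv_inv, inv_inv] at h3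
    exact h3.trans (le_add_of_nonneg_left (by positivity))

theorem summable_norm_mul_add {r R : ℝ} (hu : u ≠ 0) (hu1 : ‖u‖ < 1) (hr : 0 < r) (hR : 0 < R) :
    Summable fun n : ℤ => ‖u ^ tri n‖ * (R ^ n + r ^ n) := by
  have h : ∀ {r : ℝ}, 0 < r → Summable fun n : ℤ => ‖u ^ tri n‖ * r ^ n := fun {r} hr => by
    refine (summable_thetaSeries hu hu1 (x := r) (by exact_mod_cast hr.ne')).norm.congr fun n => ?_
    rw [norm_mul, norm_zpow (r : ℂ), Complex.norm_real, Real.norm_of_nonneg hr.le]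
  simpa only [mul_add] using (h hR).add (h hr)

/-- The open annulus used for locally uniform estimates around `x`. -/
theorem exists_annulus (hx : x ≠ 0) : ∃ r R : ℝ, 0 < r ∧ 0 < R ∧
  IsOpen {z : ℂ | r < ‖z‖ ∧ ‖z‖ < R} ∧
    x ∈ {z : ℂ | r < ‖z‖ ∧ ‖z‖ < R} := by
  have h := norm_pos_iff.2 hx
  refine ⟨‖x‖ / 2, 2 * ‖x‖, by positivity, by positivity, ?_, ?_, ?_⟩
  · exact (isOpen_lt continuous_const continuous_norm).inter
      (isOpen_lt continuous_norm continuous_const)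
  · linarith
  · linarith

theorem differentiableAt_thetaSeries (hu : u ≠ 0) (hu1 : ‖u‖ < 1) (hx : x ≠ 0) :
    DifferentiableAt ℂ (thetaSeries u) x := by
  obtain ⟨r, R, hr, hR, ho, hmem⟩ := exists_annulus hx
  refine (Complex.differentiableOn_tsum_of_summable_norm (summable_norm_mul_add hu hu1 hr hR)
    (fun n z hz => ?_) ho fun n z hz => ?_).differentiableAt (ho.mem_nhds hmem)
  · have : z ≠ 0 := norm_pos_iff.1 (hr.trans hz.1)
    exact ((differentiableAt_zpow.2 (Or.inl this)).const_mul _).differentiableWithinAt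
  · rw [norm_mul]
    gcongr
    exact norm_zpow_le_add hr hz.1.le hz.2.le n

theorem differentiableAt_theta (hp : p ≠ 0) (hp1 : ‖p‖ < 1) (hx : x ≠ 0) :
    DifferentiableAt ℂ (theta p) x :=
  (differentiableAt_thetaSeries hp hp1 (neg_ne_zero.2 hx)).comp x differentiableAt_id.neg

theorem hasSum_thetaSeries (hu : u ≠ 0) (hu1 : ‖u‖ < 1) (hx : x ≠ 0) :
    HasSum (fun n : ℤ => u ^ tri n * x ^ n) (thetaSeries u x) :=
  (summable_thetaSeries hu hu1 hx).hasSum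

theorem HasSum.mul_of_complex {ι κ : Type*} {f : ι → ℂ} {g : κ → ℂ} {a b : ℂ} (hf : HasSum f a)
    (hg : HasSum g b) : HasSum (fun z : ι × κ => f z.1 * g z.2) (a * b) := by
  rw [← hf.tsum_eq, ← hg.tsum_eq,
    tsum_mul_tsum_of_summable_norm hf.summable.norm hg.summable.norm]
  exact (summable_mul_of_summable_norm hf.summable.norm hg.summable.norm).hasSum

theorem theta_mul_theta (hp : p ≠ 0) (hp1 : ‖p‖ < 1) (hx : x ≠ 0) (hu : u ≠ 0) :
    theta p (x * u) * theta p (x / u) =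
      thetaSeries (p ^ 2) (x ^ 2) * thetaSeries (p ^ 2) (p * u ^ 2) -
        x * u⁻¹ * thetaSeries (p ^ 2) (p * x ^ 2) * thetaSeries (p ^ 2) (u ^ 2) := by
  have hp2 : ‖p ^ 2‖ < 1 := by rw [norm_pow]; exact pow_lt_one₀ (norm_nonneg _) hp1 two_ne_zero
  have hp0 : p ^ 2 ≠ 0 := pow_ne_zero 2 hp
  have hx0 : x ^ 2 ≠ 0 := pow_ne_zero 2 hx
  have hu0 : u ^ 2 ≠ 0 := pow_ne_zero 2 hu
  have hl := (hasSum_thetaSeries hp hp1 (neg_ne_zero.2 (mul_ne_zero hx hu))).mul_of_complex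
    (hasSum_thetaSeries hp hp1 (neg_ne_zero.2 (div_ne_zero hx hu)))
  refine hl.unique ?_
  have h1 : u⁻¹ * thetaSeries (p ^ 2) (u ^ 2) = u * thetaSeries (p ^ 2) (p ^ 2 * u ^ 2) := by
    rw [thetaSeries_mul_left hp0 hu0]
    field_simp
  rw [mul_assoc, mul_assoc, mul_left_comm u⁻¹, h1, sub_eq_add_neg]
  have e1 := (hasSum_thetaSeries hp0 hp2 hx0).mul_of_complex
    (hasSum_thetaSeries hp0 hp2 (mul_ne_zero hp hu0))
  have e2 := (((hasSum_thetaSeries hp0 hp2 (mul_ne_zero hp hx0)).mul_of_complex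
    ((hasSum_thetaSeries hp0 hp2 (mul_ne_zero hp0 hu0)).mul_left u)).mul_left x).neg
  have hsq : ∀ y : ℂ, ∀ n : ℤ, (y ^ 2) ^ n = y ^ n * y ^ n := fun y n => by
    rw [sq, mul_zpow]
  have hneg : ∀ n : ℤ, (-1 : ℂ) ^ n * (-1) ^ n = 1 := fun n => by
    rw [← mul_zpow]; norm_num
  refine hasSum_int_prod_of_parity (e1.congr_terms fun z => ?_) (e2.congr_terms fun z => ?_)
  · rcases z with ⟨i, j⟩
    have t1 : tri (i - j) = tri i + tri j + j - i * j := by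
      rw [sub_eq_add_neg, tri_add, tri_neg]; ring
    dsimp only
    have hi := hneg i
    have hj := hneg j
    rw [t1, tri_add, ← neg_one_mul (x * u), ← neg_one_mul (x / u)]
    simp only [zpow_add₀ hp, zpow_sub₀ hp, hsq, mul_zpow, div_zpow, zpow_add₀ hx, zpow_sub₀ hx,
      zpow_add₀ hu, zpow_sub₀ hu, zpow_add₀ (neg_ne_zero.2 (one_ne_zero (α := ℂ))),
      zpow_sub₀ (neg_ne_zero.2 (one_ne_zero (α := ℂ)))]
    field_simp
    linear_combination (-1 : ℂ) * hi
  · rcases z with ⟨i, j⟩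
    have t1 : tri (i - j) = tri i + tri j + j - i * j := by
      rw [sub_eq_add_neg, tri_add, tri_neg]; ring
    dsimp only
    have hi := hneg i
    have hj := hneg j
    rw [t1, tri_add_one, tri_add, ← neg_one_mul (x * u), ← neg_one_mul (x / u)]
    simp only [zpow_add₀ hp, zpow_sub₀ hp, hsq, mul_zpow, div_zpow, zpow_add₀ hx, zpow_sub₀ hx,
      zpow_add₀ hu, zpow_sub₀ hu, zpow_add₀ (neg_ne_zero.2 (one_ne_zero (α := ℂ))),
      zpow_sub₀ (neg_ne_zero.2 (one_ne_zero (α := ℂ))), zpow_one]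
    field_simp
    linear_combination hi

end Theta

section ThetaRelations

variable {p x u a b c : ℂ}

/-- One of the two functions whose cross products are products of two values of `theta`. -/
noncomputable def thetaF (p x : ℂ) : ℂ := x⁻¹ * thetaSeries (p ^ 2) (x ^ 2)

/-- The other function whose cross products are products of two values of `theta`. -/
noncomputable def thetaG (p x : ℂ) : ℂ := thetaSeries (p ^ 2) (p * x ^ 2)

theorem theta_cross (hp : p ≠ 0) (hp1 : ‖p‖ < 1) (hx : x ≠ 0) (hu : u ≠ 0) :
    thetaF p x * thetaG p u - thetaG p x * thetaF p u =
      x⁻¹ * (theta p (x * u) * theta p (x / u)) := by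
  rw [theta_mul_theta hp hp1 hx hu, thetaF, thetaF, thetaG, thetaG]
  field_simp

theorem theta_three_term (hp : p ≠ 0) (hp1 : ‖p‖ < 1) (ha : a ≠ 0) (hb : b ≠ 0) (hc : c ≠ 0)
    (hx : x ≠ 0) :
    a⁻¹ * (theta p (a * b) * theta p (a / b)) * (c⁻¹ * (theta p (c * x) * theta p (c / x))) -
      a⁻¹ * (theta p (a * c) * theta p (a / c)) * (b⁻¹ * (theta p (b * x) * theta p (b / x))) +
      a⁻¹ * (theta p (a * x) * theta p (a / x)) * (b⁻¹ * (theta p (b * c) * theta p (b / c))) =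
        0 := by
  rw [← theta_cross hp hp1 ha hb, ← theta_cross hp hp1 ha hc, ← theta_cross hp hp1 ha hx,
    ← theta_cross hp hp1 hb hc, ← theta_cross hp hp1 hb hx, ← theta_cross hp hp1 hc hx]
  ring

theorem norm_sq_lt_one (hp1 : ‖p‖ < 1) : ‖p ^ 2‖ < 1 := by
  rw [norm_pow]; exact pow_lt_one₀ (norm_nonneg _) hp1 two_ne_zero

theorem differentiableAt_thetaF (hp : p ≠ 0) (hp1 : ‖p‖ < 1) (hx : x ≠ 0) :
    DifferentiableAt ℂ (thetaF p) x :=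
  (differentiableAt_inv hx).mul ((differentiableAt_thetaSeries (pow_ne_zero 2 hp)
    (norm_sq_lt_one hp1) (pow_ne_zero 2 hx)).comp x (differentiableAt_pow 2))

theorem differentiableAt_thetaG (hp : p ≠ 0) (hp1 : ‖p‖ < 1) (hx : x ≠ 0) :
    DifferentiableAt ℂ (thetaG p) x :=
  (differentiableAt_thetaSeries (pow_ne_zero 2 hp) (norm_sq_lt_one hp1)
    (mul_ne_zero hp (pow_ne_zero 2 hx))).comp x ((differentiableAt_pow 2).const_mul p)

theorem hasDerivAt_theta (hp : p ≠ 0) (hp1 : ‖p‖ < 1) (hx : x ≠ 0) :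
    HasDerivAt (theta p) (deriv (theta p) x) x :=
  (differentiableAt_theta hp hp1 hx).hasDerivAt

theorem deriv_theta_cross (hp : p ≠ 0) (hp1 : ‖p‖ < 1) (ha : a ≠ 0) (hc : c ≠ 0) :
    thetaF p a * deriv (thetaG p) c - thetaG p a * deriv (thetaF p) c =
      deriv (theta p) (a * c) * theta p (a / c) -
        theta p (a * c) * deriv (theta p) (a / c) / c ^ 2 := by
  have h1 := ((differentiableAt_thetaG hp hp1 hc).hasDerivAt.const_mul (thetaF p a)).sub
    ((differentiableAt_thetaF hp hp1 hc).hasDerivAt.const_mul (thetaG p a))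
  have h2 := (((hasDerivAt_theta hp hp1 (mul_ne_zero ha hc)).comp c
    ((hasDerivAt_id c).const_mul a)).mul ((hasDerivAt_theta hp hp1 (div_ne_zero ha hc)).comp c
    ((hasDerivAt_id c).fun_inv hc |>.const_mul a))).const_mul a⁻¹
  have h3 := h1.congr_of_eventuallyEq (f₁ := fun d => a⁻¹ * (theta p (a * d) * theta p (a / d)))
    (by filter_upwards [isOpen_ne.mem_nhds hc] with d hd using (theta_cross hp hp1 ha hd).symm)
  rw [h3.unique h2]
  simp only [Function.comp, id]
  field_simp
  ring_nf

/-- The logarithmic derivative of the theta function, scaled by the argument. -/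
noncomputable def thetaLog (p x : ℂ) : ℂ := x * deriv (theta p) x / theta p x

theorem thetaLog_mul_left (hp : p ≠ 0) (hp1 : ‖p‖ < 1) (hx : x ≠ 0) (h0 : theta p x ≠ 0) :
    thetaLog p (p * x) = thetaLog p x - 1 := by
  have h1 := (hasDerivAt_theta hp hp1 (mul_ne_zero hp hx)).comp x ((hasDerivAt_id x).const_mul p)
  have h2 := (hasDerivAt_inv hx).neg.mul (hasDerivAt_theta hp hp1 hx)
  have h3 := h2.congr_of_eventuallyEq (f₁ := theta p ∘ fun y => p * id y)
    (by filter_upwards [isOpen_ne.mem_nhds hx] with y hy using theta_mul_left hp hy)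
  have h4 := h1.unique h3
  simp only [mul_one, Pi.neg_apply] at h4
  rw [thetaLog, thetaLog, theta_mul_left hp hx, mul_comm (p * x), ← mul_assoc, h4]
  field_simp
  ring

theorem thetaLog_inv (hp : p ≠ 0) (hp1 : ‖p‖ < 1) (hx : x ≠ 0) (h0 : theta p x ≠ 0) :
    thetaLog p x⁻¹ = 1 - thetaLog p x := by
  have h1 := (hasDerivAt_theta hp hp1 (inv_ne_zero hx)).comp x (hasDerivAt_inv hx)
  have h2 := (hasDerivAt_inv hx).neg.mul (hasDerivAt_theta hp hp1 hx)
  have h3 := h2.congr_of_eventuallyEq (f₁ := theta p ∘ fun y => y⁻¹)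
    (by filter_upwards [isOpen_ne.mem_nhds hx] with y hy using theta_inv hp hy)
  have h4 := h1.unique h3
  have h5 : deriv (theta p) x⁻¹ = x * deriv (theta p) x - theta p x := by
    field_simp at h4
    simp only [Pi.neg_apply] at h4
    field_simp at h4
    rw [inv_eq_one_div]
    linear_combination -h4
  rw [thetaLog, thetaLog, theta_inv hp hx, h5]
  field_simp
  ring

theorem thetaLog_four_term (hp : p ≠ 0) (hp1 : ‖p‖ < 1) (ha : a ≠ 0) (hb : b ≠ 0) (hc : c ≠ 0)
    (h1 : theta p (a * c) ≠ 0) (h2 : theta p (a / c) ≠ 0) (h3 : theta p (b * c) ≠ 0)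
    (h4 : theta p (b / c) ≠ 0) :
    thetaLog p (b * c) - thetaLog p (b / c) - thetaLog p (a * c) + thetaLog p (a / c) =
      -deriv (theta p) 1 * (theta p (a * b) * theta p (a / b) * theta p (c ^ 2)) * b /
        (c * (theta p (a * c) * theta p (a / c) * theta p (b * c) * theta p (b / c))) := by
  have e1 := deriv_theta_cross hp hp1 ha hc
  have e2 := deriv_theta_cross hp hp1 hb hc
  have e3 := deriv_theta_cross hp hp1 hc hc
  rw [div_self hc, theta_one hp, mul_zero, zero_sub, ← sq] at e3
  have e4 := theta_cross hp hp1 ha hb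
  have e5 := theta_cross hp hp1 ha hc
  have e6 := theta_cross hp hp1 hb hc
  have key : a⁻¹ * (theta p (a * b) * theta p (a / b)) *
        -(theta p (c ^ 2) * deriv (theta p) 1 / c ^ 2) -
      a⁻¹ * (theta p (a * c) * theta p (a / c)) * (deriv (theta p) (b * c) * theta p (b / c) -
        theta p (b * c) * deriv (theta p) (b / c) / c ^ 2) +
      (deriv (theta p) (a * c) * theta p (a / c) -
        theta p (a * c) * deriv (theta p) (a / c) / c ^ 2) *
        (b⁻¹ * (theta p (b * c) * theta p (b / c))) = 0 := by
    rw [← e1, ← e2, ← e3, ← e4, ← e5, ← e6]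
    ring
  simp only [thetaLog]
  field_simp at key ⊢
  linear_combination -key

end ThetaRelations

section ThetaSeven

variable {Q : ℂ}

/-- The theta function of nome `Q ^ 7` at the point `Q ^ n`. -/
noncomputable def thetaSeven (Q : ℂ) (n : ℤ) : ℂ := theta (Q ^ 7) (Q ^ n)

theorem theta_pow_seven_zpow (Q : ℂ) (n : ℤ) : theta (Q ^ 7) (Q ^ n) = thetaSeven Q n := rfl

theorem thetaSeven_neg (hQ : Q ≠ 0) (n : ℤ) :
    thetaSeven Q (-n) = -(Q ^ n)⁻¹ * thetaSeven Q n := by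
  rw [thetaSeven, zpow_neg, theta_inv (pow_ne_zero 7 hQ) (zpow_ne_zero n hQ), thetaSeven]

theorem thetaSeven_add_seven (hQ : Q ≠ 0) (n : ℤ) :
    thetaSeven Q (n + 7) = -(Q ^ n)⁻¹ * thetaSeven Q n := by
  rw [thetaSeven, add_comm, zpow_add₀ hQ, zpow_ofNat,
    theta_mul_left (pow_ne_zero 7 hQ) (zpow_ne_zero n hQ), thetaSeven]

theorem thetaSeven_seven_sub (hQ : Q ≠ 0) (n : ℤ) :
    thetaSeven Q (7 - n) = thetaSeven Q n := by
  rw [thetaSeven, zpow_sub₀ hQ, zpow_ofNat,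
    theta_div (pow_ne_zero 7 hQ) (zpow_ne_zero n hQ), thetaSeven]

theorem thetaSeven_four (hQ : Q ≠ 0) : thetaSeven Q 4 = thetaSeven Q 3 :=
  thetaSeven_seven_sub hQ 3

theorem thetaSeven_five (hQ : Q ≠ 0) : thetaSeven Q 5 = thetaSeven Q 2 :=
  thetaSeven_seven_sub hQ 2

theorem thetaSeven_six (hQ : Q ≠ 0) : thetaSeven Q 6 = thetaSeven Q 1 :=
  thetaSeven_seven_sub hQ 1

theorem norm_pow_seven_lt_one (hQ1 : ‖Q‖ < 1) : ‖Q ^ 7‖ < 1 := by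
  rw [norm_pow]; exact pow_lt_one₀ (norm_nonneg _) hQ1 (by norm_num)

theorem natAbs_le_seven_mul_tri_add {c : ℤ} (h1 : 1 ≤ c) (h3 : c ≤ 3) (n : ℤ) :
    (n.natAbs : ℤ) ≤ 7 * tri n + c * n := by
  have h := two_mul_tri n
  rw [Int.natCast_natAbs]
  rcases le_total 0 n with hn | hn
  · rw [abs_of_nonneg hn]
    rcases hn.eq_or_lt with rfl | hn
    · simp
    · nlinarith
  · rw [abs_of_nonpos hn]
    rcases hn.eq_or_lt with rfl | hn
    · simp
    · nlinarith [mul_nonneg (neg_nonneg.2 hn.le) (sub_nonneg.2 h3)]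

theorem hasSum_pow_natAbs {r : ℝ} (hr : 0 ≤ r) (hr1 : r < 1) :
    HasSum (fun n : ℤ => r ^ n.natAbs) ((1 - r)⁻¹ + r * (1 - r)⁻¹) := by
  have h := hasSum_geometric_of_lt_one hr hr1
  refine HasSum.of_nat_of_neg_add_one (by simpa using h) ?_
  refine HasSum.congr_terms (fun n => ?_) (h.mul_left r)
  rw [← pow_succ']
  congr 1

theorem thetaSeven_ne_zero (hQ : Q ≠ 0) (hQ3 : ‖Q‖ < 1 / 3) {c : ℤ} (h1 : 1 ≤ c) (h3 : c ≤ 3) :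
    thetaSeven Q c ≠ 0 := by
  intro h0
  have hp : Q ^ 7 ≠ 0 := pow_ne_zero 7 hQ
  have hp1 : ‖Q ^ 7‖ < 1 := norm_pow_seven_lt_one (by linarith)
  have hr := norm_nonneg Q
  have hs := (hasSum_thetaSeries hp hp1 (neg_ne_zero.2 (zpow_ne_zero c hQ))).sub
    (hasSum_ite_eq (0 : ℤ) (1 : ℂ))
  have hg := hasSum_pow_natAbs hr (by linarith : ‖Q‖ < 1)
  have hg' := hg.sub (hasSum_ite_eq (0 : ℤ) (1 : ℝ))
  have hle := tsum_of_norm_bounded hg' (f := fun n : ℤ => (Q ^ 7) ^ tri n * (-Q ^ c) ^ n -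
    if n = 0 then 1 else 0) fun n => by
      split_ifs with hn
      · simp [hn]
      · rw [sub_zero, sub_zero, norm_mul, norm_zpow, norm_zpow, norm_neg, norm_pow, norm_zpow,
          ← zpow_natCast, ← zpow_natCast, ← zpow_mul, ← zpow_mul,
          ← zpow_add₀ (norm_ne_zero_iff.2 hQ)]
        exact zpow_le_zpow_right_of_le_one₀ (norm_pos_iff.2 hQ) (by linarith)
          (natAbs_le_seven_mul_tri_add h1 h3 n)
  rw [hs.tsum_eq] at hle
  change ‖thetaSeven Q c - 1‖ ≤ _ at hle
  rw [h0, zero_sub, norm_neg, norm_one] at hle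
  have : (1 - ‖Q‖)⁻¹ * (1 - ‖Q‖) = 1 := inv_mul_cancel₀ (by linarith)
  have h5 : 0 < (1 - ‖Q‖)⁻¹ := inv_pos.2 (by linarith)
  nlinarith

/-- A form of the equation of the Klein quartic. -/
theorem thetaSeven_klein (hQ : Q ≠ 0) (hQ1 : ‖Q‖ < 1) :
    thetaSeven Q 3 ^ 3 * thetaSeven Q 1 - thetaSeven Q 2 ^ 3 * thetaSeven Q 3 +
      Q * thetaSeven Q 1 ^ 3 * thetaSeven Q 2 = 0 := by
  have h := theta_three_term (pow_ne_zero 7 hQ) (norm_pow_seven_lt_one hQ1)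
    (zpow_ne_zero 0 hQ) (zpow_ne_zero 1 hQ) (zpow_ne_zero 2 hQ) (zpow_ne_zero 3 hQ)
  simp only [← zpow_add₀ hQ, ← zpow_sub₀ hQ, theta_pow_seven_zpow] at h
  norm_num at h
  rw [thetaSeven_neg hQ, thetaSeven_neg hQ 2, thetaSeven_neg hQ 3, thetaSeven_five hQ,
    thetaSeven_four hQ] at h
  norm_cast at h
  field_simp at h
  norm_num at h
  linear_combination h

/-- The logarithmic derivative of the theta function at `Q ^ n`. -/
noncomputable def thetaSevenLog (Q : ℂ) (n : ℤ) : ℂ := thetaLog (Q ^ 7) (Q ^ n)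

theorem thetaLog_pow_seven_zpow (Q : ℂ) (n : ℤ) :
    thetaLog (Q ^ 7) (Q ^ n) = thetaSevenLog Q n := rfl

theorem thetaSevenLog_neg (hQ : Q ≠ 0) (hQ1 : ‖Q‖ < 1) {n : ℤ} (h : thetaSeven Q n ≠ 0) :
    thetaSevenLog Q (-n) = 1 - thetaSevenLog Q n := by
  rw [thetaSevenLog, zpow_neg, thetaLog_inv (pow_ne_zero 7 hQ) (norm_pow_seven_lt_one hQ1)
    (zpow_ne_zero n hQ) h, thetaSevenLog]

theorem thetaSevenLog_add_seven (hQ : Q ≠ 0) (hQ1 : ‖Q‖ < 1) {n : ℤ} (h : thetaSeven Q n ≠ 0) :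
    thetaSevenLog Q (n + 7) = thetaSevenLog Q n - 1 := by
  rw [thetaSevenLog, add_comm, zpow_add₀ hQ, zpow_ofNat, thetaLog_mul_left (pow_ne_zero 7 hQ)
    (norm_pow_seven_lt_one hQ1) (zpow_ne_zero n hQ) h, thetaSevenLog]

theorem thetaSevenLog_four_term (hQ : Q ≠ 0) (hQ1 : ‖Q‖ < 1) (a c : ℤ)
    (h1 : thetaSeven Q (a + c) ≠ 0) (h2 : thetaSeven Q (a - c) ≠ 0) (h3 : thetaSeven Q c ≠ 0) :
    2 * thetaSevenLog Q c - 1 - thetaSevenLog Q (a + c) + thetaSevenLog Q (a - c) =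
      deriv (theta (Q ^ 7)) 1 * thetaSeven Q a ^ 2 * thetaSeven Q (2 * c) /
        (thetaSeven Q (a + c) * thetaSeven Q (a - c) * thetaSeven Q c ^ 2) := by
  have h4 : thetaSeven Q (0 - c) ≠ 0 := by
    rw [zero_sub, thetaSeven_neg hQ]
    exact mul_ne_zero (neg_ne_zero.2 (inv_ne_zero (zpow_ne_zero _ hQ))) h3
  have h := thetaLog_four_term (pow_ne_zero 7 hQ) (norm_pow_seven_lt_one hQ1) (zpow_ne_zero a hQ)
    (zpow_ne_zero 0 hQ) (zpow_ne_zero c hQ)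
  rw [show (Q ^ c) ^ 2 = Q ^ (2 * c) by rw [two_mul, zpow_add₀ hQ, sq]] at h
  simp only [← zpow_add₀ hQ, ← zpow_sub₀ hQ, theta_pow_seven_zpow, thetaLog_pow_seven_zpow] at h
  specialize h h1 h2 (by rwa [zero_add]) h4
  rw [zero_add, zero_sub, thetaSevenLog_neg hQ hQ1 h3, thetaSeven_neg hQ, add_zero, sub_zero,
    zpow_zero] at h
  rw [show 2 * thetaSevenLog Q c - 1 = thetaSevenLog Q c - (1 - thetaSevenLog Q c) by ring, h]
  have := zpow_ne_zero c hQ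
  field_simp

theorem thetaSevenLog_sum_one (hQ : Q ≠ 0) (hQ3 : ‖Q‖ < 1 / 3) :
    2 * thetaSevenLog Q 1 + thetaSevenLog Q 2 + thetaSevenLog Q 3 - 1 =
      deriv (theta (Q ^ 7)) 1 * thetaSeven Q 3 / thetaSeven Q 1 ^ 2 := by
  have hQ1 : ‖Q‖ < 1 := by linarith
  have h1 := thetaSeven_ne_zero hQ hQ3 (c := 1) (by norm_num) (by norm_num)
  have h2 := thetaSeven_ne_zero hQ hQ3 (c := 2) (by norm_num) (by norm_num)
  have h3 := thetaSeven_ne_zero hQ hQ3 (c := 3) (by norm_num) (by norm_num)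
  have h5 : thetaSevenLog Q 5 = -thetaSevenLog Q 2 := by
    have h5 := thetaSevenLog_add_seven hQ hQ1 (n := -2) (by
      rw [thetaSeven_neg hQ]
      exact mul_ne_zero (neg_ne_zero.2 (inv_ne_zero (zpow_ne_zero _ hQ))) h2)
    rw [thetaSevenLog_neg hQ hQ1 h2] at h5
    norm_num at h5
    exact h5
  have h := thetaSevenLog_four_term hQ hQ1 4 1
  norm_num at h
  rw [thetaSeven_five hQ, thetaSeven_four hQ, h5] at h
  have h' := h h2 h3 h1
  field_simp at h' ⊢
  linear_combination h'

theorem thetaSevenLog_sum_two (hQ : Q ≠ 0) (hQ3 : ‖Q‖ < 1 / 3) :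
    2 * thetaSevenLog Q 2 - thetaSevenLog Q 3 - thetaSevenLog Q 1 =
      -(Q * deriv (theta (Q ^ 7)) 1 * thetaSeven Q 1 / thetaSeven Q 2 ^ 2) := by
  have hQ1 : ‖Q‖ < 1 := by linarith
  have h1 := thetaSeven_ne_zero hQ hQ3 (c := 1) (by norm_num) (by norm_num)
  have h2 := thetaSeven_ne_zero hQ hQ3 (c := 2) (by norm_num) (by norm_num)
  have h3 := thetaSeven_ne_zero hQ hQ3 (c := 3) (by norm_num) (by norm_num)
  have h := thetaSevenLog_four_term hQ hQ1 1 2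
  norm_num at h
  rw [thetaSeven_neg hQ, thetaSeven_four hQ, thetaSevenLog_neg hQ hQ1 h1] at h
  have h' := h h3 (mul_ne_zero (neg_ne_zero.2 (inv_ne_zero (zpow_ne_zero _ hQ))) h1) h2
  rw [zpow_one] at h'
  field_simp at h' ⊢
  linear_combination h'

theorem thetaSevenLog_sum_three (hQ : Q ≠ 0) (hQ3 : ‖Q‖ < 1 / 3) :
    2 * thetaSevenLog Q 3 - thetaSevenLog Q 1 + thetaSevenLog Q 2 =
      -(Q * deriv (theta (Q ^ 7)) 1 * thetaSeven Q 2 / thetaSeven Q 3 ^ 2) := by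
  have hQ1 : ‖Q‖ < 1 := by linarith
  have h1 := thetaSeven_ne_zero hQ hQ3 (c := 1) (by norm_num) (by norm_num)
  have h2 := thetaSeven_ne_zero hQ hQ3 (c := 2) (by norm_num) (by norm_num)
  have h3 := thetaSeven_ne_zero hQ hQ3 (c := 3) (by norm_num) (by norm_num)
  have h8 := thetaSevenLog_add_seven hQ hQ1 h1
  have h8' := thetaSeven_add_seven hQ 1
  have h := thetaSevenLog_four_term hQ hQ1 5 3
  norm_num at h h8 h8'
  rw [h8', thetaSeven_five hQ, thetaSeven_six hQ, h8] at h
  have h' := h (neg_ne_zero.2 (mul_ne_zero (inv_ne_zero hQ) h1)) h2 h3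
  field_simp at h' ⊢
  linear_combination h'

end ThetaSeven

theorem Summable.tsum_eq_add_of_cover {ι κ κ' : Type*} {f : ι → ℂ} (hf : Summable f) {e : κ → ι}
    {e' : κ' → ι} (he : e.Injective) (he' : e'.Injective) (hd : ∀ i j, e i ≠ e' j)
    (hc : ∀ x, (∃ i, e i = x) ∨ ∃ j, e' j = x) :
    ∑' x, f x = ∑' i, f (e i) + ∑' j, f (e' j) := by
  refine (HasSum.add_isCompl_range he he' ?_ (hf.comp_injective he).hasSum
    (hf.comp_injective he').hasSum).tsum_eq
  rw [isCompl_iff, Set.disjoint_left, codisjoint_iff]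
  constructor
  · rintro _ ⟨i, rfl⟩ ⟨j, h⟩
    exact hd i j h.symm
  · exact Set.eq_univ_iff_forall.2 hc

theorem zpow_neg_one_mul_self (n : ℤ) : (-1 : ℂ) ^ n * (-1) ^ n = 1 := by
  rw [← mul_zpow]; norm_num

section Quintuple

variable {p z : ℂ}

/-- The quintuple product identity. -/
theorem theta_quintuple (hp : p ≠ 0) (hp1 : ‖p‖ < 1) (hz : z ≠ 0) :
    (theta (p ^ 3) (p * z ^ 3) + z * theta (p ^ 3) (p * (z ^ 3)⁻¹)) * theta p z =
      theta (p ^ 3) p * theta p (z ^ 2) := by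
  have hp3 : p ^ 3 ≠ 0 := pow_ne_zero 3 hp
  have hp31 : ‖p ^ 3‖ < 1 := by rw [norm_pow]; exact pow_lt_one₀ (norm_nonneg _) hp1 three_ne_zero
  have hz3 : z ^ 3 ≠ 0 := pow_ne_zero 3 hz
  have h0 := hasSum_thetaSeries hp hp1 (neg_ne_zero.2 hz)
  have h1 := (hasSum_thetaSeries hp3 hp31 (neg_ne_zero.2 (mul_ne_zero hp hz3))).mul_of_complex h0
  have h2 := ((hasSum_thetaSeries hp3 hp31
    (neg_ne_zero.2 (mul_ne_zero hp (inv_ne_zero hz3)))).mul_left z).mul_of_complex h0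
  have h3 := (hasSum_thetaSeries hp hp1 (neg_ne_zero.2 (pow_ne_zero 2 hz))).mul_of_complex
    (hasSum_thetaSeries hp3 hp31 (neg_ne_zero.2 hp))
  have s1 := h1.summable.tsum_eq_add_of_cover (e := fun w : ℤ × ℤ => (w.2, 2 * w.1 - 3 * w.2))
    (e' := fun w : ℤ × ℤ => (w.1 + w.2, 2 * w.1 + 1 - 3 * (w.1 + w.2)))
    (by rintro ⟨a, b⟩ ⟨c, d⟩ h; simp only [Prod.mk.injEq] at h ⊢; omega)
    (by rintro ⟨a, b⟩ ⟨c, d⟩ h; simp only [Prod.mk.injEq] at h ⊢; omega)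
    (by rintro ⟨a, b⟩ ⟨c, d⟩ h; simp only [Prod.mk.injEq] at h; omega)
    (by
      rintro ⟨m, n⟩
      rcases Int.even_or_odd' (3 * m + n) with ⟨k, h | h⟩
      · exact Or.inl ⟨(k, m), Prod.ext rfl (by dsimp only; omega)⟩
      · exact Or.inr ⟨(k, m - k), Prod.ext (by dsimp only; omega) (by dsimp only; omega)⟩)
  have s2 := h2.summable.tsum_eq_add_of_cover (e := fun w : ℤ × ℤ => (w.2, 2 * w.1 - 1 + 3 * w.2))
    (e' := fun w : ℤ × ℤ => (w.2, 2 * w.1 + 3 * w.2))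
    (by rintro ⟨a, b⟩ ⟨c, d⟩ h; simp only [Prod.mk.injEq] at h ⊢; omega)
    (by rintro ⟨a, b⟩ ⟨c, d⟩ h; simp only [Prod.mk.injEq] at h ⊢; omega)
    (by rintro ⟨a, b⟩ ⟨c, d⟩ h; simp only [Prod.mk.injEq] at h; omega)
    (by
      rintro ⟨m, n⟩
      rcases Int.even_or_odd' (1 - 3 * m + n) with ⟨k, h | h⟩
      · exact Or.inl ⟨(k, m), Prod.ext rfl (by dsimp only; omega)⟩
      · exact Or.inr ⟨(k, m), Prod.ext rfl (by dsimp only; omega)⟩)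
  have s3 := h3.summable.tsum_eq_add_of_cover (e := fun w : ℤ × ℤ => (w.1, w.1 - 2 * w.2))
    (e' := fun w : ℤ × ℤ => (w.1, 1 - w.1 - 2 * w.2))
    (by rintro ⟨a, b⟩ ⟨c, d⟩ h; simp only [Prod.mk.injEq] at h ⊢; omega)
    (by rintro ⟨a, b⟩ ⟨c, d⟩ h; simp only [Prod.mk.injEq] at h ⊢; omega)
    (by rintro ⟨a, b⟩ ⟨c, d⟩ h; simp only [Prod.mk.injEq] at h; omega)
    (by
      rintro ⟨m, n⟩
      rcases Int.even_or_odd' (m + n) with ⟨k, h | h⟩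
      · exact Or.inl ⟨(m, m - k), Prod.ext rfl (by dsimp only; omega)⟩
      · exact Or.inr ⟨(m, -k), Prod.ext rfl (by dsimp only; omega)⟩)
  have key : ∀ (s t : ℂ) (a b c d : ℤ), s = t → a = b → c = d →
      s * p ^ a * z ^ c = t * p ^ b * z ^ d := by
    rintro s t a b c d rfl rfl rfl; rfl
  have f1 : ∀ m n : ℤ, (p ^ 3) ^ tri m * (-(p * z ^ 3)) ^ m * (p ^ tri n * (-z) ^ n) =
      (-1) ^ (m + n) * p ^ (3 * tri m + m + tri n) * z ^ (3 * m + n) := fun m n => by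
    rw [← neg_one_mul, ← neg_one_mul z]
    simp only [mul_zpow, zpow_add₀ hp, zpow_add₀ hz,
      zpow_add₀ (neg_ne_zero.2 (one_ne_zero (α := ℂ))),
      ← zpow_natCast, ← zpow_mul, Nat.cast_ofNat]
    ring
  have f2 : ∀ m n : ℤ, z * ((p ^ 3) ^ tri m * (-(p * (z ^ 3)⁻¹)) ^ m) * (p ^ tri n * (-z) ^ n) =
      (-1) ^ (m + n) * p ^ (3 * tri m + m + tri n) * z ^ (1 - 3 * m + n) := fun m n => by
    rw [← neg_one_mul, ← neg_one_mul z]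
    simp only [mul_zpow, zpow_add₀ hp, zpow_add₀ hz,
      zpow_add₀ (neg_ne_zero.2 (one_ne_zero (α := ℂ))),
      ← zpow_natCast, ← zpow_mul, Nat.cast_ofNat, ← zpow_neg, sub_eq_add_neg, zpow_one]
    rw [show -3 * m = -(3 * m) by ring]
    ring
  have f3 : ∀ m n : ℤ, p ^ tri m * (-z ^ 2) ^ m * ((p ^ 3) ^ tri n * (-p) ^ n) =
      (-1) ^ (m + n) * p ^ (tri m + 3 * tri n + n) * z ^ (2 * m) := fun m n => by
    rw [← neg_one_mul, ← neg_one_mul p]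
    simp only [mul_zpow, zpow_add₀ hp, zpow_add₀ (neg_ne_zero.2 (one_ne_zero (α := ℂ))),
      ← zpow_natCast, ← zpow_mul, Nat.cast_ofNat]
    ring
  rw [h1.tsum_eq] at s1
  rw [h2.tsum_eq] at s2
  rw [h3.tsum_eq] at s3
  simp only [f1] at s1
  simp only [f2] at s2
  simp only [f3] at s3
  change theta (p ^ 3) (p * z ^ 3) * theta p z = _ at s1
  change z * theta (p ^ 3) (p * (z ^ 3)⁻¹) * theta p z = _ at s2
  change theta p (z ^ 2) * theta (p ^ 3) p = _ at s3
  have sgn : ∀ {a b : ℤ}, Even (a - b) → (-1 : ℂ) ^ a = (-1) ^ b := fun {a b} h => by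
    obtain ⟨k, hk⟩ := h
    rw [show a = k + k + b by omega, zpow_add₀ (by norm_num), zpow_add₀ (by norm_num),
      zpow_neg_one_mul_self, one_mul]
  have sgn' : ∀ {a b : ℤ}, Odd (a - b) → (-1 : ℂ) ^ a = -(-1) ^ b := fun {a b} h => by
    obtain ⟨k, hk⟩ := h
    rw [show a = 2 * k + 1 + b by omega, zpow_add₀ (by norm_num), zpow_add₀ (by norm_num), two_mul,
      zpow_add₀ (by norm_num), zpow_neg_one_mul_self, zpow_one]
    ring
  rw [add_mul, s1, s2, mul_comm, s3]
  have t : ∀ n, 2 * tri n = n * (n - 1) := two_mul_tri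
  rw [tsum_congr (g := fun w : ℤ × ℤ => (-1 : ℂ) ^ (w.1 + (w.1 - 2 * w.2)) *
      p ^ (tri w.1 + 3 * tri (w.1 - 2 * w.2) + (w.1 - 2 * w.2)) * z ^ (2 * w.1)) ?_,
    tsum_congr (f := fun w : ℤ × ℤ => (-1 : ℂ) ^ (w.2 + (2 * w.1 - 1 + 3 * w.2)) * _ * _)
      (g := fun w : ℤ × ℤ => (-1 : ℂ) ^ (w.1 + (1 - w.1 - 2 * w.2)) *
      p ^ (tri w.1 + 3 * tri (1 - w.1 - 2 * w.2) + (1 - w.1 - 2 * w.2)) * z ^ (2 * w.1)) ?_,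
    tsum_congr (f := fun w : ℤ × ℤ => (-1 : ℂ) ^ (w.1 + w.2 + (2 * w.1 + 1 - 3 * (w.1 + w.2))) *
      _ * _)
      (g := fun w : ℤ × ℤ => -((-1 : ℂ) ^ (w.2 + (2 * w.1 + 3 * w.2)) *
      p ^ (3 * tri w.2 + w.2 + tri (2 * w.1 + 3 * w.2)) *
        z ^ (1 - 3 * w.2 + (2 * w.1 + 3 * w.2)))) ?_,
    tsum_neg]
  · ring
  · rintro ⟨a, b⟩
    rw [← neg_mul, ← neg_mul]
    refine key _ _ _ _ _ _ (sgn' ?_) ?_ ?_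
    · dsimp only; exact ⟨-a - 3 * b, by ring⟩
    · refine mul_left_cancel₀ (two_ne_zero (α := ℤ)) ?_
      linear_combination 3 * t (a + b) + t (2 * a + 1 - 3 * (a + b)) - 3 * t b - t (2 * a + 3 * b)
    · dsimp only; ring
  · rintro ⟨a, b⟩
    refine key _ _ _ _ _ _ (sgn ?_) ?_ ?_
    · dsimp only; exact ⟨a - 1 + 3 * b, by ring⟩
    · refine mul_left_cancel₀ (two_ne_zero (α := ℤ)) ?_
      linear_combination 3 * t b + t (2 * a - 1 + 3 * b) - t a - 3 * t (1 - a - 2 * b)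
    · dsimp only; ring
  · rintro ⟨a, b⟩
    refine key _ _ _ _ _ _ (sgn ?_) ?_ ?_
    · dsimp only; exact ⟨0, by ring⟩
    · refine mul_left_cancel₀ (two_ne_zero (α := ℤ)) ?_
      linear_combination 3 * t b + t (2 * a - 3 * b) - t a - 3 * t (a - 2 * b)
    · dsimp only; ring

end Quintuple

section Appell

variable {p u x y z : ℂ}

theorem thetaSeries_zpow_mul (hu : u ≠ 0) (hx : x ≠ 0) (k : ℤ) :
    thetaSeries u (u ^ k * x) = (u ^ tri k)⁻¹ * (x ^ k)⁻¹ * thetaSeries u x := by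
  rw [thetaSeries, thetaSeries, ← tsum_mul_left, ← (Equiv.addRight k).tsum_eq
    (fun n : ℤ => (u ^ tri k)⁻¹ * (x ^ k)⁻¹ * (u ^ tri n * x ^ n))]
  refine tsum_congr fun n => ?_
  rw [Equiv.coe_addRight, tri_add, mul_zpow, ← zpow_mul, zpow_add₀ hu, zpow_add₀ hu,
    zpow_add₀ hx, mul_comm n k]
  field_simp

theorem theta_mul_zpow (hp : p ≠ 0) (hx : x ≠ 0) (k : ℤ) :
    theta p (x * p ^ k) = (p ^ tri k)⁻¹ * ((-x) ^ k)⁻¹ * theta p x := by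
  rw [theta, mul_comm, ← mul_neg, thetaSeries_zpow_mul hp (neg_ne_zero.2 hx), theta]

/-- A majorant of the theta series. -/
noncomputable def thetaBound (u x : ℂ) : ℝ := ∑' n : ℤ, ‖u ^ tri n * x ^ n‖

theorem norm_theta_le_thetaBound (p x : ℂ) (hp : p ≠ 0) (hp1 : ‖p‖ < 1) (hx : x ≠ 0) :
    ‖theta p x‖ ≤ thetaBound p x := by
  refine (norm_tsum_le_tsum_norm (summable_thetaSeries hp hp1 (neg_ne_zero.2 hx)).norm).trans_eq ?_
  refine tsum_congr fun n => ?_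
  simp [norm_zpow]

theorem one_le_thetaBound (hp : p ≠ 0) (hp1 : ‖p‖ < 1) (hx : x ≠ 0) : 1 ≤ thetaBound p x := by
  have h := (summable_thetaSeries hp hp1 hx).norm.le_tsum 0 fun n _ => norm_nonneg _
  simpa [thetaBound] using h

theorem thetaBound_mul_zpow (hp : p ≠ 0) (hx : x ≠ 0) (k : ℤ) :
    ‖p ^ tri k‖ * ‖x ^ k‖ * thetaBound p (x * p ^ k) = thetaBound p x := by
  rw [thetaBound, thetaBound, ← tsum_mul_left, ← (Equiv.addRight k).tsum_eq
    (fun n : ℤ => ‖p ^ tri n * x ^ n‖)]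
  refine tsum_congr fun n => ?_
  rw [← norm_mul, ← norm_mul, Equiv.coe_addRight, tri_add, mul_zpow, ← zpow_mul, zpow_add₀ hp,
    zpow_add₀ hp, zpow_add₀ hx, mul_comm n k]
  congr 1
  ring

/-- The theta function divided by `1 - x`. -/
noncomputable def thetaQuot (p x : ℂ) : ℂ := -dslope (theta p) 1 x

theorem one_sub_mul_thetaQuot (hp : p ≠ 0) (x : ℂ) : (1 - x) * thetaQuot p x = theta p x := by
  have h := sub_smul_dslope (theta p) 1 x
  rw [theta_one hp, sub_zero, smul_eq_mul] at h
  rw [← h, thetaQuot]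
  ring

theorem thetaQuot_one (p : ℂ) : thetaQuot p 1 = -deriv (theta p) 1 := by
  rw [thetaQuot, dslope_same]

theorem differentiableAt_thetaQuot (hp : p ≠ 0) (hp1 : ‖p‖ < 1) (hx : x ≠ 0) :
    DifferentiableAt ℂ (thetaQuot p) x := by
  have ho : IsOpen {z : ℂ | z ≠ 0} := isOpen_ne
  have h : DifferentiableOn ℂ (dslope (theta p) 1) {z : ℂ | z ≠ 0} :=
    (Complex.differentiableOn_dslope (ho.mem_nhds one_ne_zero)).2 fun z hz =>
      (differentiableAt_theta hp hp1 hz).differentiableWithinAt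
  exact (h.differentiableAt (ho.mem_nhds hx)).neg

theorem thetaQuot_inv (hp : p ≠ 0) (hx : x ≠ 0) : thetaQuot p x⁻¹ = thetaQuot p x := by
  rcases eq_or_ne x 1 with rfl | h1
  · rw [inv_one]
  have h2 := one_sub_mul_thetaQuot hp x⁻¹
  rw [theta_inv hp hx, ← one_sub_mul_thetaQuot hp x] at h2
  refine mul_left_cancel₀ (sub_ne_zero.2 h1.symm) ?_
  linear_combination -x * h2 -
    (thetaQuot p x⁻¹ - (1 - x) * thetaQuot p x) * mul_inv_cancel₀ hx

theorem deriv_thetaQuot_one (hp : p ≠ 0) (hp1 : ‖p‖ < 1) : deriv (thetaQuot p) 1 = 0 := by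
  have h := (differentiableAt_thetaQuot hp hp1 one_ne_zero).hasDerivAt
  have h' : HasDerivAt (thetaQuot p) (deriv (thetaQuot p) 1) (1 : ℂ)⁻¹ := by rwa [inv_one]
  have h1 := h'.comp (1 : ℂ) (hasDerivAt_inv one_ne_zero)
  have h2 := h.congr_of_eventuallyEq (f₁ := thetaQuot p ∘ fun y => y⁻¹)
    (by filter_upwards [isOpen_ne.mem_nhds one_ne_zero] with y hy using thetaQuot_inv hp hy)
  have h3 := h1.unique h2
  norm_num at h3
  exact self_eq_neg.1 h3.symm

theorem exists_norm_thetaQuot_le (hp : p ≠ 0) (hp1 : ‖p‖ < 1) :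
    ∃ C : ℝ, 0 ≤ C ∧ ∀ x ≠ 0, ‖thetaQuot p x‖ ≤ C * thetaBound p x := by
  obtain ⟨C, hC⟩ := (isCompact_closedBall (1 : ℂ) (1 / 2)).exists_bound_of_continuousOn
    (f := thetaQuot p) fun x hx => by
      refine (differentiableAt_thetaQuot hp hp1 ?_).continuousAt.continuousWithinAt
      rintro rfl
      norm_num at hx
  refine ⟨max 2 C, le_max_of_le_left zero_le_two, fun x hx => ?_⟩
  have h1 := one_le_thetaBound hp hp1 hx
  by_cases hm : x ∈ Metric.closedBall (1 : ℂ) (1 / 2)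
  · have h2 := le_max_right 2 C
    have h3 : (0 : ℝ) ≤ max 2 C := le_max_of_le_left zero_le_two
    nlinarith [hC x hm]
  · rw [Metric.mem_closedBall, dist_comm, dist_eq_norm, not_le] at hm
    have h2 := norm_theta_le_thetaBound p x hp hp1 hx
    rw [← one_sub_mul_thetaQuot hp, norm_mul] at h2
    have h3 : ‖thetaQuot p x‖ ≤ 2 * thetaBound p x := by nlinarith [norm_nonneg (thetaQuot p x)]
    exact h3.trans (mul_le_mul_of_nonneg_right (le_max_left 2 C) (by linarith))

/-- The theta function divided by `1 - x * p ^ k`. -/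
noncomputable def thetaPart (p : ℂ) (k : ℤ) (x : ℂ) : ℂ :=
  p ^ tri k * (-x) ^ k * thetaQuot p (x * p ^ k)

theorem one_sub_mul_thetaPart (hp : p ≠ 0) (hx : x ≠ 0) (k : ℤ) :
    (1 - x * p ^ k) * thetaPart p k x = theta p x := by
  rw [thetaPart, mul_left_comm, one_sub_mul_thetaQuot hp, theta_mul_zpow hp hx]
  have h1 := zpow_ne_zero (tri k) hp
  have h2 := zpow_ne_zero k (neg_ne_zero.2 hx)
  field_simp

theorem thetaPart_mul_left (hp : p ≠ 0) (hx : x ≠ 0) (k : ℤ) :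
    thetaPart p k (p * x) = -x⁻¹ * thetaPart p (k + 1) x := by
  rw [thetaPart, thetaPart, tri_add_one, zpow_add₀ hp, zpow_add_one₀ hp,
    zpow_add_one₀ (neg_ne_zero.2 hx), ← mul_neg, mul_zpow, mul_assoc p x, mul_comm p, mul_assoc x]
  field_simp

theorem differentiableAt_thetaPart (hp : p ≠ 0) (hp1 : ‖p‖ < 1) (hx : x ≠ 0) (k : ℤ) :
    DifferentiableAt ℂ (thetaPart p k) x := by
  refine DifferentiableAt.mul (DifferentiableAt.const_mul ?_ _) ?_
  · exact (differentiableAt_zpow.2 (Or.inl (neg_ne_zero.2 hx))).comp x differentiableAt_id.neg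
  · exact DifferentiableAt.comp (g := thetaQuot p) (f := fun x => x * p ^ k) x
      (differentiableAt_thetaQuot hp hp1 (mul_ne_zero hx (zpow_ne_zero k hp)))
      (differentiableAt_id.mul_const _)

theorem thetaPart_zero (p x : ℂ) : thetaPart p 0 x = thetaQuot p x := by simp [thetaPart]

theorem thetaPart_one (hp : p ≠ 0) (hp1 : ‖p‖ < 1) {k : ℤ} (hk : k ≠ 0) : thetaPart p k 1 = 0 := by
  have h := one_sub_mul_thetaPart hp one_ne_zero k
  rw [theta_one hp, one_mul] at h
  exact (mul_eq_zero.1 h).resolve_left (one_sub_zpow_ne_zero hp1 hk)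

theorem deriv_thetaPart_one (hp : p ≠ 0) (hp1 : ‖p‖ < 1) (k : ℤ) :
    deriv (thetaPart p k) 1 = deriv (theta p) 1 / (1 - p ^ k) := by
  rcases eq_or_ne k 0 with rfl | hk
  · rw [zpow_zero, sub_self, div_zero, funext (thetaPart_zero p), deriv_thetaQuot_one hp hp1]
  have hd := one_sub_zpow_ne_zero hp1 hk
  have h1 := (((hasDerivAt_id (1 : ℂ)).mul_const (p ^ k)).const_sub 1).mul
    (differentiableAt_thetaPart hp hp1 one_ne_zero k).hasDerivAt
  have h2 := h1.congr_of_eventuallyEq (f₁ := theta p)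
    (by filter_upwards [isOpen_ne.mem_nhds one_ne_zero] with y hy using
      (one_sub_mul_thetaPart hp hy k).symm)
  have h3 := h2.unique (hasDerivAt_theta hp hp1 one_ne_zero)
  rw [thetaPart_one hp hp1 hk, mul_zero, zero_add, id, one_mul] at h3
  rw [← h3, mul_div_cancel_left₀ _ hd]

theorem exists_norm_thetaPart_le (hp : p ≠ 0) (hp1 : ‖p‖ < 1) :
    ∃ C : ℝ, 0 ≤ C ∧ ∀ x ≠ 0, ∀ k, ‖thetaPart p k x‖ ≤ C * thetaBound p x := by
  obtain ⟨C, hC0, hC⟩ := exists_norm_thetaQuot_le hp hp1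
  refine ⟨C, hC0, fun x hx k => ?_⟩
  have h := hC (x * p ^ k) (mul_ne_zero hx (zpow_ne_zero k hp))
  rw [← thetaBound_mul_zpow hp hx k, thetaPart, norm_mul, norm_mul, norm_zpow (-x), norm_neg,
    ← norm_zpow x, mul_left_comm]
  gcongr

theorem thetaBound_le {r R : ℝ} (hp : p ≠ 0) (hp1 : ‖p‖ < 1) (hr : 0 < r) (hR : 0 < R)
    (h1 : r ≤ ‖x‖) (h2 : ‖x‖ ≤ R) :
    thetaBound p x ≤ ∑' n : ℤ, ‖p ^ tri n‖ * (R ^ n + r ^ n) := by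
  have hx : x ≠ 0 := norm_pos_iff.1 (hr.trans_le h1)
  refine Summable.tsum_le_tsum (fun n => ?_) (summable_thetaSeries hp hp1 hx).norm
    (summable_norm_mul_add hp hp1 hr hR)
  rw [norm_mul]
  gcongr
  exact norm_zpow_le_add hr h1 h2 n

/-- The coefficients of the Appell function. -/
noncomputable def appellCoeff (p y : ℂ) (k : ℤ) : ℂ := p ^ (3 * tri (k + 1)) * (-y) ^ k

theorem hasSum_appellCoeff_mul (hp : p ≠ 0) (hp1 : ‖p‖ < 1) (hx : x ≠ 0) (hy : y ≠ 0) :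
    HasSum (fun k => appellCoeff p y k * x ^ k) (theta (p ^ 3) (p ^ 3 * (y * x))) := by
  have hp31 : ‖p ^ 3‖ < 1 := by rw [norm_pow]; exact pow_lt_one₀ (norm_nonneg _) hp1 three_ne_zero
  refine HasSum.congr_terms (fun k => ?_) (hasSum_thetaSeries (pow_ne_zero 3 hp) hp31
    (neg_ne_zero.2 (mul_ne_zero (pow_ne_zero 3 hp) (mul_ne_zero hy hx))))
  rw [appellCoeff, tri_add_one, mul_add, zpow_add₀ hp, ← mul_neg, mul_zpow, ← neg_mul y,
    mul_zpow (-y),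
    zpow_mul, zpow_mul]
  simp only [zpow_ofNat]
  ring

theorem summable_norm_appellCoeff (hp : p ≠ 0) (hp1 : ‖p‖ < 1) (hy : y ≠ 0) :
    Summable fun k => ‖appellCoeff p y k‖ := by
  simpa using (hasSum_appellCoeff_mul hp hp1 one_ne_zero hy).summable.norm

/-- The product of the theta function and the Appell function. -/
noncomputable def appellNum (p y x : ℂ) : ℂ := ∑' k, appellCoeff p y k * thetaPart p k x

theorem hasSum_appellNum (hp : p ≠ 0) (hp1 : ‖p‖ < 1) (hx : x ≠ 0) (hy : y ≠ 0) :
    HasSum (fun k => appellCoeff p y k * thetaPart p k x) (appellNum p y x) := by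
  obtain ⟨C, hC0, hC⟩ := exists_norm_thetaPart_le hp hp1
  refine (Summable.of_norm_bounded ((summable_norm_appellCoeff hp hp1 hy).mul_right
    (C * thetaBound p x)) fun k => ?_).hasSum
  rw [norm_mul]
  gcongr
  exact hC x hx k

theorem appellNum_aux (hp : p ≠ 0) (hp1 : ‖p‖ < 1) (hx : x ≠ 0) (hy : y ≠ 0) :
    DifferentiableAt ℂ (appellNum p y) x ∧
      HasSum (fun k => appellCoeff p y k * deriv (thetaPart p k) x) (deriv (appellNum p y) x) := by
  obtain ⟨C, hC0, hC⟩ := exists_norm_thetaPart_le hp hp1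
  obtain ⟨r, R, hr, hR, ho, hmem⟩ := exists_annulus hx
  have hs := (summable_norm_appellCoeff hp hp1 hy).mul_right
    (C * ∑' n : ℤ, ‖p ^ tri n‖ * (R ^ n + r ^ n))
  have hd : ∀ k : ℤ, DifferentiableOn ℂ (fun z => appellCoeff p y k * thetaPart p k z)
      {z : ℂ | r < ‖z‖ ∧ ‖z‖ < R} := fun k z hz =>
    ((differentiableAt_thetaPart hp hp1 (norm_pos_iff.1 (hr.trans hz.1)) k).const_mul
      _).differentiableWithinAt
  have hb : ∀ (k : ℤ) (z : ℂ), z ∈ {z : ℂ | r < ‖z‖ ∧ ‖z‖ < R} →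
      ‖appellCoeff p y k * thetaPart p k z‖ ≤
        ‖appellCoeff p y k‖ * (C * ∑' n : ℤ, ‖p ^ tri n‖ * (R ^ n + r ^ n)) := fun k z hz => by
    rw [norm_mul]
    gcongr
    refine (hC z (norm_pos_iff.1 (hr.trans hz.1)) k).trans ?_
    gcongr
    exact thetaBound_le hp hp1 hr hR hz.1.le hz.2.le
  constructor
  · exact (Complex.differentiableOn_tsum_of_summable_norm hs hd ho hb).differentiableAt
      (ho.mem_nhds hmem)
  · refine HasSum.congr_terms (fun k => ?_)
      (Complex.hasSum_deriv_of_summable_norm hs hd ho hb hmem)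
    exact deriv_const_mul _ (differentiableAt_thetaPart hp hp1 hx k)

theorem appellNum_one (hp : p ≠ 0) (hp1 : ‖p‖ < 1) (y : ℂ) :
    appellNum p y 1 = -deriv (theta p) 1 := by
  rw [appellNum, tsum_eq_single 0 fun k hk => by rw [thetaPart_one hp hp1 hk, mul_zero],
    thetaPart_zero, thetaQuot_one]
  simp [appellCoeff]

theorem appellNum_mul_left (hp : p ≠ 0) (hp1 : ‖p‖ < 1) (hx : x ≠ 0) (hy : y ≠ 0) :
    appellNum p y (p * x) = x⁻¹ * y⁻¹ * (x ^ 3 * appellNum p y x + theta p x *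
      (theta (p ^ 3) y + x * theta (p ^ 3) (p * y) + x ^ 2 * theta (p ^ 3) (p ^ 2 * y))) := by
  have h0 : p ^ 3 ≠ 0 := pow_ne_zero 3 hp
  have h1 := hasSum_appellNum hp hp1 (mul_ne_zero hp hx) hy
  refine h1.unique ?_
  have e0 := hasSum_appellCoeff_mul hp hp1 (inv_ne_zero h0) hy
  have e1 := hasSum_appellCoeff_mul hp hp1 (inv_ne_zero (pow_ne_zero 2 hp)) hy
  have e2 := hasSum_appellCoeff_mul hp hp1 (inv_ne_zero hp) hy
  have h2 := ((((hasSum_appellNum hp hp1 hx hy).mul_left (x ^ 3)).add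
    ((((e0.add (e1.mul_left x)).add (e2.mul_left (x ^ 2)))).mul_left (theta p x))).mul_left
      (x⁻¹ * y⁻¹))
  rw [show p ^ 3 * (y * (p ^ 3)⁻¹) = y by field_simp,
    show p ^ 3 * (y * (p ^ 2)⁻¹) = p * y by field_simp,
    show p ^ 3 * (y * p⁻¹) = p ^ 2 * y by field_simp] at h2
  have h3 := (Equiv.addRight (1 : ℤ)).hasSum_iff.2 h2
  refine HasSum.congr_terms (fun k => ?_) h3
  rw [Function.comp_apply, Equiv.coe_addRight, thetaPart_mul_left hp hx,
    ← one_sub_mul_thetaPart hp hx (k + 1)]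
  have c1 : appellCoeff p y (k + 1) = -y * (p ^ 3) ^ (k + 1) * appellCoeff p y k := by
    rw [appellCoeff, appellCoeff, tri_add_one (k + 1), mul_add, zpow_add₀ hp,
      zpow_add_one₀ (neg_ne_zero.2 hy), zpow_mul p 3 (k + 1), zpow_ofNat]
    ring
  rw [c1, inv_zpow, inv_zpow, inv_zpow]
  have hw := zpow_ne_zero (k + 1) hp
  have t2 : (p ^ 2) ^ (k + 1) = (p ^ (k + 1)) ^ 2 := by
    rw [← zpow_natCast, ← zpow_natCast, ← zpow_mul, ← zpow_mul, mul_comm]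
  have t3 : (p ^ 3) ^ (k + 1) = (p ^ (k + 1)) ^ 3 := by
    rw [← zpow_natCast, ← zpow_natCast, ← zpow_mul, ← zpow_mul, mul_comm]
  rw [t2, t3]
  generalize p ^ (k + 1) = w at hw ⊢
  field_simp
  ring

/-- The Appell function, where a term with a vanishing denominator is left out. -/
noncomputable def appell (p y x : ℂ) : ℂ := ∑' k, appellCoeff p y k / (1 - x * p ^ k)

theorem hasSum_appell (hp : p ≠ 0) (hp1 : ‖p‖ < 1) (hx : theta p x ≠ 0) (hx0 : x ≠ 0) (hy : y ≠ 0) :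
    HasSum (fun k => appellCoeff p y k / (1 - x * p ^ k)) (appellNum p y x / theta p x) := by
  refine HasSum.congr_terms (fun k => ?_) ((hasSum_appellNum hp hp1 hx0 hy).div_const (theta p x))
  have h := one_sub_mul_thetaPart hp hx0 k
  have h1 : 1 - x * p ^ k ≠ 0 := fun h0 => hx (by rw [← h, h0, zero_mul])
  have h2 : thetaPart p k x ≠ 0 := fun h0 => hx (by rw [← h, h0, mul_zero])
  rw [← h]
  field_simp

theorem appellNum_eq (hp : p ≠ 0) (hp1 : ‖p‖ < 1) (hx : theta p x ≠ 0) (hx0 : x ≠ 0) (hy : y ≠ 0) :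
    appellNum p y x = theta p x * appell p y x := by
  rw [appell, (hasSum_appell hp hp1 hx hx0 hy).tsum_eq, mul_div_cancel₀ _ hx]

theorem hasSum_appell_one (hp : p ≠ 0) (hp1 : ‖p‖ < 1) (hy : y ≠ 0) (h0 : deriv (theta p) 1 ≠ 0) :
    HasSum (fun k => appellCoeff p y k / (1 - 1 * p ^ k))
      (deriv (appellNum p y) 1 / deriv (theta p) 1) := by
  refine HasSum.congr_terms (fun k => ?_)
    ((appellNum_aux hp hp1 one_ne_zero hy).2.div_const (deriv (theta p) 1))
  rw [deriv_thetaPart_one hp hp1, one_mul]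
  field_simp

theorem deriv_appellNum_one (hp : p ≠ 0) (hp1 : ‖p‖ < 1) (hy : y ≠ 0)
    (h0 : deriv (theta p) 1 ≠ 0) :
    deriv (appellNum p y) 1 = deriv (theta p) 1 * appell p y 1 := by
  rw [appell, (hasSum_appell_one hp hp1 hy h0).tsum_eq, mul_div_cancel₀ _ h0]

end Appell

section Elliptic

variable {p u x y z : ℂ}

/-- A function that is holomorphic on the punctured plane and invariant under multiplication
by `p` is constant. -/
theorem eq_of_mul_left_invariant {g : ℂ → ℂ} (hp : p ≠ 0) (hp1 : ‖p‖ < 1)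
    (hd : ∀ x ≠ 0, DifferentiableAt ℂ g x) (hg : ∀ x ≠ 0, g (p * x) = g x) (hx : x ≠ 0)
    (hy : y ≠ 0) : g x = g y := by
  have hzp : ∀ (x : ℂ) (_ : x ≠ 0) (k : ℤ), g (p ^ k * x) = g x := fun x hx k => by
    induction k with
    | zero => simp
    | succ k ih => rw [add_comm, zpow_add₀ hp, zpow_one, mul_assoc,
        hg _ (mul_ne_zero (zpow_ne_zero _ hp) hx), ih]
    | pred k ih => rw [← hg _ (mul_ne_zero (zpow_ne_zero _ hp) hx), ← mul_assoc,
        ← zpow_one_add₀ hp, add_sub_cancel, ih]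
  have hpn := norm_pos_iff.2 hp
  set K : Set ℂ := Metric.closedBall 0 1 \ Metric.ball 0 ‖p‖ with hK
  have hKc : IsCompact K := (isCompact_closedBall 0 1).diff Metric.isOpen_ball
  obtain ⟨C, hC⟩ := hKc.exists_bound_of_continuousOn (f := g) fun x hx => by
    refine (hd x ?_).continuousAt.continuousWithinAt
    rintro rfl
    exact hx.2 (Metric.mem_ball_self hpn)
  have hb : Bornology.IsBounded (Set.range fun s => g (Complex.exp s)) := by
    refine isBounded_iff_forall_norm_le.2 ⟨C, ?_⟩
    rintro _ ⟨s, rfl⟩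
    obtain ⟨n, hn1, hn2⟩ := exists_mem_Ioc_zpow (norm_pos_iff.2 (Complex.exp_ne_zero s))
      (one_lt_inv_iff₀.2 ⟨hpn, hp1⟩)
    dsimp only
    rw [← hzp _ (Complex.exp_ne_zero s) (n + 1)]
    refine hC _ ⟨?_, ?_⟩
    · rw [mem_closedBall_zero_iff, norm_mul, norm_zpow]
      rw [inv_zpow] at hn2
      exact (mul_le_mul_of_nonneg_left hn2 (by positivity)).trans_eq
        (mul_inv_cancel₀ (zpow_ne_zero _ hpn.ne'))
    · rw [mem_ball_zero_iff, norm_mul, norm_zpow, not_lt]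
      rw [inv_zpow] at hn1
      have h := mul_le_mul_of_nonneg_left hn1.le (zpow_nonneg hpn.le (n + 1))
      refine le_trans (le_of_eq ?_) h
      rw [zpow_add_one₀ hpn.ne']
      field_simp
  have h := Differentiable.apply_eq_apply_of_bounded (f := fun s => g (Complex.exp s))
    (fun s => (hd _ (Complex.exp_ne_zero s)).comp s Complex.differentiable_exp.differentiableAt) hb
    (Complex.log x) (Complex.log y)
  rwa [Complex.exp_log hx, Complex.exp_log hy] at h

/-- The ratio of theta functions in the quintuple product identity. -/
noncomputable def thetaRatio (p u : ℂ) : ℂ := u * theta p (u ^ 2) / theta p u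

theorem theta_quintuple_div (hp : p ≠ 0) (hp1 : ‖p‖ < 1) (hu : u ≠ 0) (h0 : theta p u ≠ 0) :
    u * theta (p ^ 3) (p * u ^ 3) + u ^ 2 * theta (p ^ 3) (p * (u ^ 3)⁻¹) =
      thetaRatio p u * theta (p ^ 3) p := by
  have h := theta_quintuple hp hp1 hu
  rw [thetaRatio]
  generalize theta (p ^ 3) (p * u ^ 3) = a, theta (p ^ 3) (p * (u ^ 3)⁻¹) = b at *
  field_simp
  linear_combination h

theorem theta_cube_mul_sq (hp : p ≠ 0) (hy : y ≠ 0) :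
    theta (p ^ 3) (p ^ 2 * y) = theta (p ^ 3) (p * y⁻¹) := by
  rw [← theta_div (pow_ne_zero 3 hp) (mul_ne_zero hp (inv_ne_zero hy))]
  congr 1
  field_simp

theorem theta_quintuple_div_sq (hp : p ≠ 0) (hp1 : ‖p‖ < 1) (hu : u ≠ 0) (h0 : theta p u ≠ 0) :
    u ^ 2 * theta (p ^ 3) (p ^ 2 * u ^ 3) + u * theta (p ^ 3) (p ^ 2 * (u ^ 3)⁻¹) =
      thetaRatio p u * theta (p ^ 3) p := by
  rw [theta_cube_mul_sq hp (pow_ne_zero 3 hu),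
    theta_cube_mul_sq hp (inv_ne_zero (pow_ne_zero 3 hu)),
    inv_inv, ← theta_quintuple_div hp hp1 hu h0]
  ring

/-- The combination of three Appell functions that turns out to be elliptic. -/
noncomputable def appellComb (p u z : ℂ) : ℂ :=
  u ^ 3 * appellNum p (u ^ 3) (z * u) * (theta p z * theta p (z / u)) +
    appellNum p (u ^ 3)⁻¹ (z / u) * (theta p z * theta p (z * u)) -
    thetaRatio p u * appellNum p 1 z * (theta p (z * u) * theta p (z / u))

theorem appellComb_mul_left (hp : p ≠ 0) (hp1 : ‖p‖ < 1) (hu : u ≠ 0) (h0 : theta p u ≠ 0)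
    (hz : z ≠ 0) : appellComb p u (p * z) = appellComb p u z := by
  have hu3 := pow_ne_zero 3 hu
  have hzu := mul_ne_zero hz hu
  have hzu' := div_ne_zero hz hu
  have e1 := theta_quintuple_div hp hp1 hu h0
  have e2 := theta_quintuple_div_sq hp hp1 hu h0
  have e3 := theta_inv (pow_ne_zero 3 hp) hu3
  have e4 := theta_cube_mul_sq hp (one_ne_zero (α := ℂ))
  rw [appellComb, appellComb, mul_assoc p z u, mul_div_assoc p z u,
    appellNum_mul_left hp hp1 hzu hu3,
    appellNum_mul_left hp hp1 hzu' (inv_ne_zero hu3), appellNum_mul_left hp hp1 hz one_ne_zero,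
    theta_mul_left hp hz, theta_mul_left hp hzu, theta_mul_left hp hzu', e3,
    theta_one (pow_ne_zero 3 hp), e4]
  simp only [inv_one, mul_one]
  generalize theta p z = t1, theta p (z * u) = t2, theta p (z / u) = t3 at *
  generalize theta (p ^ 3) (u ^ 3) = t4, theta (p ^ 3) (p * u ^ 3) = t5,
    theta (p ^ 3) (p ^ 2 * u ^ 3) = t6, theta (p ^ 3) (p * (u ^ 3)⁻¹) = t7,
    theta (p ^ 3) (p ^ 2 * (u ^ 3)⁻¹) = t8, theta (p ^ 3) p = t9, thetaRatio p u = r at *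
  generalize appellNum p (u ^ 3) (z * u) = a1, appellNum p (u ^ 3)⁻¹ (z / u) = a2,
    appellNum p 1 z = a3
  field_simp
  linear_combination (t1 * t2 * t3 * z) * e1 + (t1 * t2 * t3 * z ^ 2) * e2

theorem differentiableAt_appellComb (hp : p ≠ 0) (hp1 : ‖p‖ < 1) (hu : u ≠ 0) (hz : z ≠ 0) :
    DifferentiableAt ℂ (appellComb p u) z := by
  have hu3 := pow_ne_zero 3 hu
  have hm : DifferentiableAt ℂ (fun z => z * u) z := differentiableAt_id.mul_const u
  have hd : DifferentiableAt ℂ (fun z => z / u) z := differentiableAt_id.div_const u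
  have a1 := DifferentiableAt.comp (g := appellNum p (u ^ 3)) (f := fun z => z * u) z
    (appellNum_aux hp hp1 (mul_ne_zero hz hu) hu3).1 hm
  have a2 := DifferentiableAt.comp (g := appellNum p (u ^ 3)⁻¹) (f := fun z => z / u) z
    (appellNum_aux hp hp1 (div_ne_zero hz hu) (inv_ne_zero hu3)).1 hd
  have a3 := (appellNum_aux hp hp1 hz one_ne_zero).1
  have t1 := differentiableAt_theta hp hp1 hz
  have t2 := DifferentiableAt.comp (g := theta p) (f := fun z => z * u) z
    (differentiableAt_theta hp hp1 (mul_ne_zero hz hu)) hm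
  have t3 := DifferentiableAt.comp (g := theta p) (f := fun z => z / u) z
    (differentiableAt_theta hp hp1 (div_ne_zero hz hu)) hd
  exact (((a1.const_mul _).mul (t1.mul t3)).add (a2.mul (t1.mul t2))).sub
    ((a3.const_mul _).mul (t2.mul t3))

theorem appellComb_eq (hp : p ≠ 0) (hp1 : ‖p‖ < 1) (hu : u ≠ 0) (h0 : theta p u ≠ 0)
    (hz : z ≠ 0) : appellComb p u z = -deriv (theta p) 1 * (theta p u * theta p (u ^ 2)) := by
  rw [eq_of_mul_left_invariant hp hp1 (fun x hx => differentiableAt_appellComb hp hp1 hu hx)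
    (fun x hx => appellComb_mul_left hp hp1 hu h0 hx) hz hu, appellComb, div_self hu,
    theta_one hp, appellNum_one hp hp1, sq]
  ring

/-- The combination of three Appell functions for a generic argument. -/
theorem appell_three_term (hp : p ≠ 0) (hp1 : ‖p‖ < 1) (hu : u ≠ 0) (h0 : theta p u ≠ 0)
    (hz : z ≠ 0) (h1 : theta p z ≠ 0) (h2 : theta p (z * u) ≠ 0) (h3 : theta p (z / u) ≠ 0) :
    u ^ 3 * appell p (u ^ 3) (z * u) + appell p (u ^ 3)⁻¹ (z / u) -
        thetaRatio p u * appell p 1 z =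
      -deriv (theta p) 1 * (theta p u * theta p (u ^ 2)) /
        (theta p z * theta p (z * u) * theta p (z / u)) := by
  have hu3 := pow_ne_zero 3 hu
  rw [← appellComb_eq hp hp1 hu h0 hz, appellComb,
    appellNum_eq hp hp1 h2 (mul_ne_zero hz hu) hu3,
    appellNum_eq hp hp1 h3 (div_ne_zero hz hu) (inv_ne_zero hu3),
    appellNum_eq hp hp1 h1 hz one_ne_zero]
  generalize theta p z = a, theta p (z * u) = b, theta p (z / u) = c at *
  field_simp

/-- The combination of three Appell functions when one of them has a pole. -/
theorem appell_three_term_self (hp : p ≠ 0) (hp1 : ‖p‖ < 1) (hu : u ≠ 0) (h0 : theta p u ≠ 0)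
    (h1 : theta p (u ^ 2) ≠ 0) (h2 : deriv (theta p) 1 ≠ 0) :
    u ^ 3 * appell p (u ^ 3) (u ^ 2) + appell p (u ^ 3)⁻¹ 1 - thetaRatio p u * appell p 1 u =
      thetaLog p u + thetaLog p (u ^ 2) := by
  have hu3 := pow_ne_zero 3 hu
  have huu := mul_ne_zero hu hu
  have hm : HasDerivAt (fun z => z * u) (1 * u) u := (hasDerivAt_id u).mul_const u
  have hd : HasDerivAt (fun z => z / u) (1 / u) u := (hasDerivAt_id u).div_const u
  have a1 := HasDerivAt.comp (h₂ := appellNum p (u ^ 3)) (h := fun z => z * u) u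
    (appellNum_aux hp hp1 huu hu3).1.hasDerivAt hm
  have a2 := HasDerivAt.comp (h₂ := appellNum p (u ^ 3)⁻¹) (h := fun z => z / u) u
    (appellNum_aux hp hp1 (div_ne_zero hu hu) (inv_ne_zero hu3)).1.hasDerivAt hd
  have a3 := (appellNum_aux hp hp1 hu one_ne_zero).1.hasDerivAt
  have t1 := hasDerivAt_theta hp hp1 hu
  have t2 := HasDerivAt.comp (h₂ := theta p) (h := fun z => z * u) u
    (hasDerivAt_theta hp hp1 huu) hm
  have t3 := HasDerivAt.comp (h₂ := theta p) (h := fun z => z / u) u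
    (hasDerivAt_theta hp hp1 (div_ne_zero hu hu)) hd
  have hG := (((a1.const_mul (u ^ 3)).mul (t1.mul t3)).add (a2.mul (t1.mul t2))).sub
    ((a3.const_mul (thetaRatio p u)).mul (t2.mul t3))
  have hc := (hasDerivAt_const u (-deriv (theta p) 1 *
    (theta p u * theta p (u ^ 2)))).congr_of_eventuallyEq
    (f₁ := appellComb p u)
    (by filter_upwards [isOpen_ne.mem_nhds hu] with w hw using appellComb_eq hp hp1 hu h0 hw)
  have h := HasDerivAt.unique hG hc
  simp only [Function.comp_apply, Pi.mul_apply, div_self hu, theta_one hp, appellNum_one hp hp1,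
    deriv_appellNum_one hp hp1 (inv_ne_zero hu3) h2, ← sq,
    appellNum_eq hp hp1 h1 (pow_ne_zero 2 hu) hu3, appellNum_eq hp hp1 h0 hu one_ne_zero] at h
  rw [thetaLog, thetaLog]
  have h2' := h2
  generalize deriv (theta p) 1 = K at *
  field_simp at h ⊢
  refine mul_left_cancel₀ h2' ?_
  linear_combination h

theorem hasSum_deriv_thetaSeries (hp : p ≠ 0) (hp1 : ‖p‖ < 1) (hx : x ≠ 0) :
    HasSum (fun n : ℤ => p ^ tri n * (n * x ^ (n - 1))) (deriv (thetaSeries p) x) := by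
  obtain ⟨r, R, hr, hR, ho, hmem⟩ := exists_annulus hx
  refine HasSum.congr_terms (fun n => ?_) (Complex.hasSum_deriv_of_summable_norm
    (F := fun n z => p ^ tri n * z ^ n) (summable_norm_mul_add hp hp1 hr hR)
    (fun n z hz => ?_) ho (fun n z hz => ?_) hmem)
  · rw [deriv_const_mul _ (differentiableAt_zpow.2 (Or.inl hx)), deriv_zpow]
  · have : z ≠ 0 := norm_pos_iff.1 (hr.trans hz.1)
    exact ((differentiableAt_zpow.2 (Or.inl this)).const_mul _).differentiableWithinAt
  · rw [norm_mul]
    gcongr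
    exact norm_zpow_le_add hr hz.1.le hz.2.le n

theorem two_mul_natAbs_le_seven_mul_tri {n : ℤ} (h : n ≠ 1) : 2 * (n.natAbs : ℤ) ≤ 7 * tri n := by
  have h := two_mul_tri n
  rw [Int.natCast_natAbs]
  rcases le_or_gt n 0 with hn | hn
  · rw [abs_of_nonpos hn]
    nlinarith
  · rw [abs_of_pos hn]
    have : 2 ≤ n := by omega
    nlinarith

theorem deriv_theta_pow_seven_ne_zero {Q : ℂ} (hQ : Q ≠ 0) (hQ3 : ‖Q‖ < 1 / 3) :
    deriv (theta (Q ^ 7)) 1 ≠ 0 := by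
  have hp : Q ^ 7 ≠ 0 := pow_ne_zero 7 hQ
  have hp1 : ‖Q ^ 7‖ < 1 := norm_pow_seven_lt_one (by linarith)
  have hr := norm_pos_iff.2 hQ
  have h1 : deriv (theta (Q ^ 7)) 1 = -deriv (thetaSeries (Q ^ 7)) (-1) := by
    change deriv (fun x => thetaSeries (Q ^ 7) (-x)) 1 = _
    exact deriv_comp_neg (thetaSeries (Q ^ 7)) 1
  rw [h1, neg_ne_zero]
  intro h0
  have hs := (hasSum_deriv_thetaSeries hp hp1 (neg_ne_zero.2 (one_ne_zero (α := ℂ)))).sub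
    (hasSum_ite_eq (1 : ℤ) (1 : ℂ))
  have hg := (hasSum_pow_natAbs hr.le (by linarith : ‖Q‖ < 1)).sub (hasSum_ite_eq (0 : ℤ) (1 : ℝ))
  have hle := tsum_of_norm_bounded hg (f := fun n : ℤ => (Q ^ 7) ^ tri n * (n * (-1) ^ (n - 1)) -
    if n = 1 then 1 else 0) fun n => by
      rcases eq_or_ne n 1 with rfl | hn
      · simp
      rcases eq_or_ne n 0 with rfl | hn0
      · simp
      rw [if_neg hn, if_neg hn0, sub_zero, sub_zero, norm_mul, norm_mul, norm_zpow, norm_zpow,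
        norm_neg, norm_one, one_zpow, mul_one, norm_pow, Complex.norm_intCast, ← Int.cast_abs,
        Int.abs_eq_natAbs, Int.cast_natCast]
      have e1 : (n.natAbs : ℝ) * ‖Q‖ ^ n.natAbs ≤ 1 := by
        have h3 : (n.natAbs : ℝ) ≤ 3 ^ n.natAbs := by
          exact_mod_cast (Nat.lt_pow_self (by norm_num : 1 < 3)).le
        calc (n.natAbs : ℝ) * ‖Q‖ ^ n.natAbs ≤ 3 ^ n.natAbs * (1 / 3) ^ n.natAbs := by gcongr
          _ = 1 := by rw [← mul_pow]; norm_num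
      have e2 : (‖Q‖ ^ 7) ^ tri n ≤ ‖Q‖ ^ n.natAbs * ‖Q‖ ^ n.natAbs := by
        rw [← pow_add, ← two_mul, ← zpow_natCast, ← zpow_natCast, ← zpow_mul]
        refine zpow_le_zpow_right_of_le_one₀ hr (by linarith) ?_
        have := two_mul_natAbs_le_seven_mul_tri hn
        simpa using this
      have e3 : 0 ≤ ‖Q‖ ^ n.natAbs := by positivity
      have e4 : (0 : ℝ) ≤ n.natAbs := by positivity
      nlinarith
  rw [hs.tsum_eq, h0, zero_sub, norm_neg, norm_one] at hle
  have : (1 - ‖Q‖)⁻¹ * (1 - ‖Q‖) = 1 := inv_mul_cancel₀ (by linarith)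
  have h5 : 0 < (1 - ‖Q‖)⁻¹ := inv_pos.2 (by linarith)
  nlinarith

end Elliptic

theorem hasSum_int_of_residue {f : ℤ → ℂ} {s : ℤ → ℂ}
    (h : ∀ c, -3 ≤ c → c ≤ 3 → HasSum (fun m : ℤ => f (7 * m + c)) (s c)) :
    HasSum f (s 0 + (s 1 + s (-1)) + (s 2 + s (-2)) + (s 3 + s (-3))) := by
  have h1 : ∀ c ∈ Finset.Icc (-3 : ℤ) 3,
      HasSum (fun n => if (n - c) % 7 = 0 then f n else 0) (s c) := fun c hc => by
    rw [Finset.mem_Icc] at hc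
    have hi : Function.Injective fun m : ℤ => 7 * m + c := fun a b h => by
      dsimp only at h; omega
    refine (hi.hasSum_iff fun n hn => if_neg fun h0 => hn ⟨(n - c) / 7, ?_⟩).1
      (HasSum.congr_terms (fun m => ?_) (h c hc.1 hc.2))
    · dsimp only; omega
    · rw [Function.comp_apply, if_pos (by omega)]
  have h2 := hasSum_sum h1
  rw [show Finset.Icc (-3 : ℤ) 3 = {0, 1, -1, 2, -2, 3, -3} from by decide] at h2
  simp only [Finset.sum_insert, Finset.sum_singleton, Finset.mem_insert, Finset.mem_singleton,
    Int.reduceNeg, Int.reduceEq, or_self, not_false_eq_true, reduceCtorEq, zero_ne_one,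
    OfNat.zero_ne_ofNat] at h2
  refine HasSum.congr_terms (fun n => ?_) (f := fun n => (if (n - 0) % 7 = 0 then f n else 0) +
    ((if (n - 1) % 7 = 0 then f n else 0) + ((if (n - -1) % 7 = 0 then f n else 0) +
    ((if (n - 2) % 7 = 0 then f n else 0) + ((if (n - -2) % 7 = 0 then f n else 0) +
    ((if (n - 3) % 7 = 0 then f n else 0) + (if (n - -3) % 7 = 0 then f n else 0)))))))
    (by convert h2 using 1; ring)
  have h7 : n % 7 = 0 ∨ n % 7 = 1 ∨ n % 7 = 2 ∨ n % 7 = 3 ∨ n % 7 = 4 ∨ n % 7 = 5 ∨ n % 7 = 6 := by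
    omega
  rcases h7 with h | h | h | h | h | h | h <;> simp [Int.sub_emod, Int.add_emod, h]

theorem theta_cube_pow_seven {q : ℂ} (hq : q ≠ 0) (m c : ℤ) :
    (q ^ 3) ^ tri (7 * m + c) * (-q ^ 5) ^ (7 * m + c) = ((q ^ 3) ^ tri c * (-q ^ 5) ^ c) *
      (appellCoeff ((q ^ 7) ^ 7) ((q ^ 7) ^ (3 * c)) m * (((q ^ 7) ^ 7) ^ m)⁻¹) := by
  have h1 : ((-1 : ℂ)) ^ (7 * m + c) = (-1) ^ c * (-1) ^ m := by
    rw [zpow_add₀ (by norm_num), zpow_mul, mul_comm]; norm_num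
  have h2 := two_mul_tri (7 * m + c)
  have h3 := two_mul_tri c
  have h4 := two_mul_tri (m + 1)
  have h5 : 3 * tri (7 * m + c) + 5 * (7 * m + c) =
      3 * tri c + 5 * c + 49 * (3 * tri (m + 1)) + 7 * (3 * c * m) + -(49 * m) := by
    linarith
  have h6 : q ^ (3 * tri (7 * m + c)) * q ^ (5 * (7 * m + c)) = q ^ (3 * tri c) * q ^ (5 * c) *
      (q ^ (49 * (3 * tri (m + 1)))) * (q ^ (7 * (3 * c * m))) * (q ^ (49 * m))⁻¹ := by
    rw [← zpow_neg, ← zpow_add₀ hq, h5, zpow_add₀ hq, zpow_add₀ hq, zpow_add₀ hq, zpow_add₀ hq]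
  have e3 : ∀ n : ℤ, (q ^ 3) ^ n = q ^ (3 * n) := fun n => by rw [zpow_mul]; norm_cast
  have e5 : ∀ n : ℤ, (-q ^ 5) ^ n = (-1) ^ n * q ^ (5 * n) := fun n => by
    rw [neg_eq_neg_one_mul, mul_zpow, zpow_mul]; norm_cast
  have e7 : ∀ n : ℤ, (q ^ 7) ^ n = q ^ (7 * n) := fun n => by rw [zpow_mul]; norm_cast
  have e49 : ∀ n : ℤ, ((q ^ 7) ^ 7) ^ n = q ^ (49 * n) := fun n => by
    rw [← pow_mul, zpow_mul]; norm_cast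
  rw [appellCoeff, e3, e3, e5, e5, e49, e49, e7, h1, neg_eq_neg_one_mul (q ^ (7 * (3 * c))),
    mul_zpow,
    ← zpow_mul, mul_assoc 7 (3 * c) m]
  linear_combination ((-1) ^ c * (-1) ^ m) * h6

section

variable {p x y : ℂ}

theorem hasSum_appellCoeff_inv (hp : p ≠ 0) (hp1 : ‖p‖ < 1) (hy : y ≠ 0) :
    HasSum (fun m => appellCoeff p y m * (p ^ m)⁻¹) (theta (p ^ 3) (p ^ 2 * y)) := by
  have h := hasSum_appellCoeff_mul hp hp1 (inv_ne_zero hp) hy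
  rw [show p ^ 3 * (y * p⁻¹) = p ^ 2 * y by field_simp] at h
  exact HasSum.congr_terms (fun m => by rw [inv_zpow]) h

/-- Shifting the exponents of the Appell function, with a correction if a pole is present. -/
theorem hasSum_appellCoeff_inv_div (hp : p ≠ 0) (hp1 : ‖p‖ < 1) (hy : y ≠ 0)
    (hk : ∀ k : ℤ, k ≠ 0 → 1 - x * p ^ k ≠ 0)
    (hs : Summable fun k => appellCoeff p y k / (1 - x * p ^ k)) :
    HasSum (fun m => appellCoeff p y m * (p ^ m)⁻¹ / (1 - x * p ^ m))
      (x * appell p y x + theta (p ^ 3) (p ^ 2 * y) - if x = 1 then 1 else 0) := by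
  have h1 := ((hs.hasSum.mul_left x).add (hasSum_appellCoeff_inv hp hp1 hy)).sub
    (hasSum_ite_eq (0 : ℤ) (if x = 1 then (1 : ℂ) else 0))
  refine HasSum.congr_terms (fun m => ?_) h1
  have hpm := zpow_ne_zero m hp
  by_cases h : 1 - x * p ^ m = 0
  · obtain rfl : m = 0 := by by_contra hm; exact hk m hm h
    have hx : x = 1 := by rw [zpow_zero, mul_one] at h; exact (sub_eq_zero.1 h).symm
    subst hx
    simp [appellCoeff, show tri 1 = 0 from rfl]
  · have h0 : (if m = 0 then if x = 1 then (1 : ℂ) else 0 else 0) = 0 := by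
      split_ifs with hm hx
      · rw [hm, hx] at h; simp at h
      · rfl
      · rfl
    rw [h0]
    field_simp
    ring

end

/-- The dissection of the pentagonal number series modulo seven. -/
theorem thetaSeries_dissection {q : ℂ} {s : ℤ → ℂ} (hq : q ≠ 0) (hq1 : ‖q‖ < 1)
    (hs : ∀ c, s c = (q ^ 3) ^ tri c * (-q ^ 5) ^ c *
      theta (((q ^ 7) ^ 7) ^ 3) (((q ^ 7) ^ 7) ^ 2 * (q ^ 7) ^ (3 * c))) :
    thetaSeries (q ^ 3) (-q ^ 2) =
      -q ^ 2 * (s 0 + (s 1 + s (-1)) + (s 2 + s (-2)) + (s 3 + s (-3))) := by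
  have hQ := pow_ne_zero 7 hq
  have h1 := hasSum_int_of_residue (f := fun n => (q ^ 3) ^ tri n * (-q ^ 5) ^ n) (s := s)
    fun c _ _ => by
      rw [hs]
      exact HasSum.congr_terms (fun m => (theta_cube_pow_seven hq m c).symm)
        ((hasSum_appellCoeff_inv (pow_ne_zero 7 hQ) (norm_pow_seven_lt_one
          (norm_pow_seven_lt_one hq1)) (zpow_ne_zero _ hQ)).mul_left _)
  rw [← h1.tsum_eq, ← tsum_mul_left, thetaSeries, ← (Equiv.addRight (1 : ℤ)).tsum_eq]
  refine tsum_congr fun n => ?_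
  have hn := neg_ne_zero.2 (pow_ne_zero 2 hq)
  rw [Equiv.coe_addRight, tri_add_one, zpow_add₀ (pow_ne_zero 3 hq), zpow_add_one₀ hn,
    show -q ^ 5 = q ^ 3 * -q ^ 2 by ring, mul_zpow (q ^ 3)]
  ring

/-- The dissection of a Lambert series modulo seven. -/
theorem lambertSeries_dissection {q : ℂ} {s : ℤ → ℂ} (hq : q ≠ 0) (hq1 : ‖q‖ < 1) {a : ℤ}
    (ha1 : 1 ≤ a) (ha3 : a ≤ 3)
    (hsum : ∀ c : ℤ, -3 ≤ c → c ≤ 3 → Summable fun k =>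
      appellCoeff ((q ^ 7) ^ 7) ((q ^ 7) ^ (3 * c)) k / (1 - (q ^ 7) ^ (a + c) * ((q ^ 7) ^ 7) ^ k))
    (hs : ∀ c, s c = (q ^ 3) ^ tri c * (-q ^ 5) ^ c * ((q ^ 7) ^ (a + c) *
        appell ((q ^ 7) ^ 7) ((q ^ 7) ^ (3 * c)) ((q ^ 7) ^ (a + c)) +
      theta (((q ^ 7) ^ 7) ^ 3) (((q ^ 7) ^ 7) ^ 2 * (q ^ 7) ^ (3 * c)))) :
    lambertSeries q (3 - 3 * a) + 1 = (-1) ^ a * q ^ (2 * a - 3 * tri a) *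
      (s 0 + (s 1 + s (-1)) + (s 2 + s (-2)) + (s 3 + s (-3))) := by
  have hQ := pow_ne_zero 7 hq
  have hQ1 := norm_pow_seven_lt_one hq1
  have hp := pow_ne_zero 7 hQ
  have hp1 := norm_pow_seven_lt_one hQ1
  have h1 := hasSum_int_of_residue
    (f := fun n => (q ^ 3) ^ tri n * (-q ^ 5) ^ n / (1 - (q ^ 7) ^ (n + a)))
    (s := fun c => s c - if c = -a then (q ^ 3) ^ tri c * (-q ^ 5) ^ c else 0)
    fun c hc1 hc3 => by
      have hx : ∀ k : ℤ, k ≠ 0 → 1 - (q ^ 7) ^ (a + c) * ((q ^ 7) ^ 7) ^ k ≠ 0 := fun k hk => by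
        rw [← zpow_natCast (q ^ 7) 7, ← zpow_mul, ← zpow_add₀ hQ]
        exact one_sub_zpow_ne_zero hQ1 (by push_cast; omega)
      have hi : (if (q ^ 7) ^ (a + c) = 1 then (1 : ℂ) else 0) = if c = -a then 1 else 0 := by
        refine if_congr ⟨fun h => ?_, fun h => by rw [h, add_neg_cancel, zpow_zero]⟩ rfl rfl
        by_contra hne
        exact one_sub_zpow_ne_zero hQ1 (n := a + c) (by omega) (by rw [h, sub_self])
      have h2 := (hasSum_appellCoeff_inv_div hp hp1 (zpow_ne_zero (3 * c) hQ) hx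
        (hsum c hc1 hc3)).mul_left ((q ^ 3) ^ tri c * (-q ^ 5) ^ c)
      rw [hi, mul_sub, mul_ite, mul_one, mul_zero, ← hs] at h2
      refine HasSum.congr_terms (fun m => ?_) h2
      rw [theta_cube_pow_seven hq, add_comm a c, show 7 * m + c + a = c + a + 7 * m by ring,
        zpow_add₀ hQ (c + a), zpow_mul (q ^ 7) 7 m]
      norm_cast
      ring
  have e3 : ∀ n : ℤ, (q ^ 3) ^ n = q ^ (3 * n) := fun n => by rw [zpow_mul]; norm_cast
  have e5 : ∀ n : ℤ, (-q ^ 5) ^ n = (-1) ^ n * q ^ (5 * n) := fun n => by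
    rw [neg_eq_neg_one_mul, mul_zpow, zpow_mul]; norm_cast
  have h3 : lambertSeries q (3 - 3 * a) = (-1) ^ a * q ^ (2 * a - 3 * tri a) *
      ∑' n : ℤ, (q ^ 3) ^ tri n * (-q ^ 5) ^ n / (1 - (q ^ 7) ^ (n + a)) := by
    rw [lambertSeries, ← tsum_mul_left, ← (Equiv.addRight a).tsum_eq]
    refine tsum_congr fun n => ?_
    have h2 := two_mul_tri (n + a)
    have h4 := two_mul_tri n
    have h5 := two_mul_tri a
    have h6 : q ^ (3 * tri (n + a)) * q ^ ((3 - 3 * a + 2) * (n + a)) =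
        q ^ (2 * a - 3 * tri a) * (q ^ (3 * tri n) * q ^ (5 * n)) := by
      rw [← zpow_add₀ hq, ← zpow_add₀ hq, ← zpow_add₀ hq]
      congr 1
      linarith
    rw [Equiv.coe_addRight, e3, e3, e5, neg_eq_neg_one_mul (q ^ (3 - 3 * a + 2)), mul_zpow,
      ← zpow_mul, zpow_add₀ (by norm_num : (-1 : ℂ) ≠ 0)]
    linear_combination ((-1) ^ n * (-1) ^ a / (1 - (q ^ 7) ^ (n + a))) * h6
  have h4 : (-1) ^ a * q ^ (2 * a - 3 * tri a) * ((q ^ 3) ^ tri (-a) * (-q ^ 5) ^ (-a)) = 1 := by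
    have h5 : 2 * a - 3 * tri a + 3 * tri (-a) + 5 * -a = 0 := by
      have h2 := two_mul_tri a
      have h4 := two_mul_tri (-a)
      linarith
    calc _ = ((-1) ^ a * (-1) ^ (-a)) * (q ^ (2 * a - 3 * tri a) * q ^ (3 * tri (-a)) *
          q ^ (5 * -a)) := by rw [e3, e5]; ring
      _ = 1 := by rw [← zpow_add₀ hq, ← zpow_add₀ hq, h5, ← zpow_add₀ (by norm_num)]; simp
  rw [h3, h1.tsum_eq]
  have h5 : a = 1 ∨ a = 2 ∨ a = 3 := by omega
  rcases h5 with rfl | rfl | rfl <;> norm_num at h4 ⊢ <;> linear_combination -h4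

theorem thetaSeven_ne_zero_of_lt {Q : ℂ} (hQ : Q ≠ 0) (hQ3 : ‖Q‖ < 1 / 3) {n : ℤ} (h0 : n ≠ 0)
    (h1 : -7 < n) (h2 : n < 7) : thetaSeven Q n ≠ 0 := by
  have hpos : ∀ m : ℤ, 0 < m → m < 7 → thetaSeven Q m ≠ 0 := fun m hm hm7 => by
    rcases le_or_gt m 3 with h | h
    · exact thetaSeven_ne_zero hQ hQ3 hm h
    · rw [← thetaSeven_seven_sub hQ]
      exact thetaSeven_ne_zero hQ hQ3 (by omega) (by omega)
  rcases lt_or_gt_of_ne h0 with h | h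
  · rw [← neg_neg n, thetaSeven_neg hQ]
    exact mul_ne_zero (neg_ne_zero.2 (inv_ne_zero (zpow_ne_zero _ hQ)))
      (hpos _ (by omega) (by omega))
  · exact hpos n h h2

/-- The combination of Appell functions which is evaluated by `appell_three_term`. -/
noncomputable def appellDefect (Q : ℂ) (a c : ℤ) : ℂ :=
  Q ^ (3 * c) * appell (Q ^ 7) (Q ^ (3 * c)) (Q ^ (a + c)) +
    appell (Q ^ 7) (Q ^ (3 * -c)) (Q ^ (a + -c)) -
      thetaRatio (Q ^ 7) (Q ^ c) * appell (Q ^ 7) 1 (Q ^ a)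

theorem thetaRatio_pow_seven (Q : ℂ) (c : ℤ) :
    thetaRatio (Q ^ 7) (Q ^ c) = Q ^ c * thetaSeven Q (2 * c) / thetaSeven Q c := by
  rw [thetaRatio, ← zpow_natCast (Q ^ c) 2, ← zpow_mul, mul_comm c, thetaSeven, thetaSeven]
  rfl

theorem appellDefect_of_ne {Q : ℂ} (hQ : Q ≠ 0) (hQ3 : ‖Q‖ < 1 / 3) {a c : ℤ} (hac : a ≠ c)
    (ha1 : 1 ≤ a) (ha3 : a ≤ 3) (hc1 : 1 ≤ c) (hc3 : c ≤ 3) :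
    appellDefect Q a c = -deriv (theta (Q ^ 7)) 1 * (thetaSeven Q c * thetaSeven Q (2 * c)) /
      (thetaSeven Q a * thetaSeven Q (a + c) * thetaSeven Q (a - c)) := by
  have hn := fun {n : ℤ} => thetaSeven_ne_zero_of_lt (n := n) hQ hQ3
  have e2 : (Q ^ c) ^ 2 = Q ^ (2 * c) := by rw [mul_comm, zpow_mul]; norm_cast
  have e3 : (Q ^ c) ^ 3 = Q ^ (3 * c) := by rw [mul_comm, zpow_mul]; norm_cast
  have h := appell_three_term (z := Q ^ a) (pow_ne_zero 7 hQ) (norm_pow_seven_lt_one (by linarith))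
    (zpow_ne_zero c hQ) (hn (n := c) (by omega) (by omega) (by omega)) (zpow_ne_zero a hQ)
    (hn (n := a) (by omega) (by omega) (by omega))
    (by rw [← zpow_add₀ hQ]; exact hn (n := a + c) (by omega) (by omega) (by omega))
    (by rw [← zpow_sub₀ hQ]; exact hn (n := a - c) (by omega) (by omega) (by omega))
  rw [e2, e3, ← zpow_add₀ hQ, ← zpow_sub₀ hQ, ← zpow_neg, ← mul_neg] at h
  exact h

theorem appellDefect_self {Q : ℂ} (hQ : Q ≠ 0) (hQ3 : ‖Q‖ < 1 / 3) {a : ℤ}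
    (ha1 : 1 ≤ a) (ha3 : a ≤ 3) :
    appellDefect Q a a = thetaSevenLog Q a + thetaSevenLog Q (2 * a) := by
  have hn := fun {n : ℤ} => thetaSeven_ne_zero_of_lt (n := n) hQ hQ3
  have e2 : (Q ^ a) ^ 2 = Q ^ (2 * a) := by rw [mul_comm, zpow_mul]; norm_cast
  have e3 : (Q ^ a) ^ 3 = Q ^ (3 * a) := by rw [mul_comm, zpow_mul]; norm_cast
  have h := appell_three_term_self (pow_ne_zero 7 hQ) (norm_pow_seven_lt_one (by linarith))
    (zpow_ne_zero a hQ) (hn (n := a) (by omega) (by omega) (by omega))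
    (by rw [e2]; exact hn (n := 2 * a) (by omega) (by omega) (by omega))
    (deriv_theta_pow_seven_ne_zero hQ hQ3)
  rw [e2, e3, ← zpow_neg, ← mul_neg] at h
  rw [appellDefect, add_neg_cancel, zpow_zero, ← two_mul]
  exact h

theorem cube_zpow_tri_mul_neg {q : ℂ} (hq : q ≠ 0) (c : ℤ) :
    (q ^ 3) ^ tri c * (-q ^ 5) ^ c =
      ((q ^ 3) ^ tri (-c) * (-q ^ 5) ^ (-c)) * (q ^ 7) ^ c := by
  have h2 := two_mul_tri c
  have h3 := two_mul_tri (-c)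
  have h4 : tri c = tri (-c) - c := by linarith
  have h5 : (-q ^ 5) ^ c = (-q ^ 5) ^ (-c) * ((-q ^ 5) ^ 2) ^ c := by
    rw [← zpow_natCast (-q ^ 5) 2, ← zpow_mul, ← zpow_add₀ (neg_ne_zero.2 (pow_ne_zero 5 hq))]
    congr 1; push_cast; ring
  have h6 : (q ^ 7) ^ c = ((-q ^ 5) ^ 2) ^ c * ((q ^ 3) ^ c)⁻¹ := by
    rw [← inv_zpow, ← mul_zpow]; congr 1; field_simp
  rw [h4, h5, h6, zpow_sub₀ (pow_ne_zero 3 hq)]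
  ring

theorem theta_pair {Q : ℂ} (hQ : Q ≠ 0) (hQ3 : ‖Q‖ < 1 / 3) {c : ℤ} (hc1 : 1 ≤ c) (hc3 : c ≤ 3) :
    Q ^ c * theta ((Q ^ 7) ^ 3) ((Q ^ 7) ^ 2 * Q ^ (3 * c)) +
      theta ((Q ^ 7) ^ 3) ((Q ^ 7) ^ 2 * Q ^ (3 * -c)) =
    (Q ^ c)⁻¹ * thetaRatio (Q ^ 7) (Q ^ c) * theta ((Q ^ 7) ^ 3) (Q ^ 7) := by
  have e3 : (Q ^ c) ^ 3 = Q ^ (3 * c) := by rw [mul_comm, zpow_mul]; norm_cast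
  have h := theta_quintuple_div_sq (pow_ne_zero 7 hQ) (norm_pow_seven_lt_one (by linarith))
    (zpow_ne_zero c hQ) (thetaSeven_ne_zero hQ hQ3 hc1 hc3)
  rw [e3, ← zpow_neg, ← mul_neg] at h
  rw [mul_assoc _ _ (theta _ _), ← h]
  have := zpow_ne_zero c hQ
  generalize theta ((Q ^ 7) ^ 3) ((Q ^ 7) ^ 2 * Q ^ (3 * c)) = A,
    theta ((Q ^ 7) ^ 3) ((Q ^ 7) ^ 2 * Q ^ (3 * -c)) = B
  field_simp

theorem appell_pair {Q : ℂ} (hQ : Q ≠ 0) (a c : ℤ) :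
    Q ^ c * (Q ^ (a + c) * appell (Q ^ 7) (Q ^ (3 * c)) (Q ^ (a + c))) +
      Q ^ (a + -c) * appell (Q ^ 7) (Q ^ (3 * -c)) (Q ^ (a + -c)) =
    (Q ^ c)⁻¹ * Q ^ a * (appellDefect Q a c +
      thetaRatio (Q ^ 7) (Q ^ c) * appell (Q ^ 7) 1 (Q ^ a)) := by
  have e3 : (Q ^ c) ^ 3 = Q ^ (3 * c) := by rw [mul_comm, zpow_mul]; norm_cast
  have e1 : Q ^ (a + c) = Q ^ a * Q ^ c := zpow_add₀ hQ a c
  have e2 : Q ^ (a + -c) = Q ^ a * (Q ^ c)⁻¹ := by rw [zpow_add₀ hQ, zpow_neg]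
  rw [appellDefect]
  generalize appell (Q ^ 7) (Q ^ (3 * c)) (Q ^ (a + c)) = A,
    appell (Q ^ 7) (Q ^ (3 * -c)) (Q ^ (a + -c)) = B
  rw [← e3, e1, e2]
  have := zpow_ne_zero c hQ
  have := zpow_ne_zero a hQ
  generalize thetaRatio (Q ^ 7) (Q ^ c) * appell (Q ^ 7) 1 (Q ^ a) = C
  field_simp
  ring

theorem summable_appell_seven {Q : ℂ} (hQ : Q ≠ 0) (hQ3 : ‖Q‖ < 1 / 3) {a c : ℤ}
    (ha1 : 1 ≤ a) (ha3 : a ≤ 3) (hc1 : -3 ≤ c) (hc3 : c ≤ 3) :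
    Summable fun k => appellCoeff (Q ^ 7) (Q ^ (3 * c)) k / (1 - Q ^ (a + c) * (Q ^ 7) ^ k) := by
  have hp := pow_ne_zero 7 hQ
  have hp1 := norm_pow_seven_lt_one (Q := Q) (by linarith)
  rcases eq_or_ne (a + c) 0 with h | h
  · rw [h, zpow_zero]
    exact (hasSum_appell_one hp hp1 (zpow_ne_zero _ hQ)
      (deriv_theta_pow_seven_ne_zero hQ hQ3)).summable
  · exact (hasSum_appell hp hp1 (thetaSeven_ne_zero_of_lt hQ hQ3 h (by omega) (by omega))
      (zpow_ne_zero _ hQ) (zpow_ne_zero _ hQ)).summable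

/-- The three phases `V c = (-1) ^ c * q ^ (3 * tri c - 9 * c)`, `c = 1, 2, 3`, summed up. -/
noncomputable def phaseSum (q a b c : ℂ) : ℂ :=
  -(q ^ 9)⁻¹ * a + (q ^ 15)⁻¹ * b - (q ^ 18)⁻¹ * c

theorem phase_values {q : ℂ} (hq : q ≠ 0) :
    (q ^ 3) ^ tri 0 * (-q ^ 5) ^ (0 : ℤ) = 1 ∧
    (q ^ 3) ^ tri (-1) * (-q ^ 5) ^ (-1 : ℤ) * ((q ^ 7) ^ (1 : ℤ))⁻¹ = -(q ^ 9)⁻¹ ∧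
    (q ^ 3) ^ tri (-2) * (-q ^ 5) ^ (-2 : ℤ) * ((q ^ 7) ^ (2 : ℤ))⁻¹ = (q ^ 15)⁻¹ ∧
    (q ^ 3) ^ tri (-3) * (-q ^ 5) ^ (-3 : ℤ) * ((q ^ 7) ^ (3 : ℤ))⁻¹ = -(q ^ 18)⁻¹ := by
  rw [show tri 0 = 0 from rfl, show tri (-1) = 1 from rfl, show tri (-2) = 3 from rfl,
    show tri (-3) = 6 from rfl]
  simp only [zpow_neg, zpow_ofNat]
  refine ⟨by simp, ?_, ?_, ?_⟩ <;> field_simp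

theorem thetaSeries_phaseSum {q : ℂ} (hq : q ≠ 0) (hQ3 : ‖q ^ 7‖ < 1 / 3) (hq1 : ‖q‖ < 1) :
    thetaSeries (q ^ 3) (-q ^ 2) = -q ^ 2 * theta (((q ^ 7) ^ 7) ^ 3) ((q ^ 7) ^ 7) *
      (1 + phaseSum q (thetaRatio ((q ^ 7) ^ 7) ((q ^ 7) ^ (1 : ℤ)))
        (thetaRatio ((q ^ 7) ^ 7) ((q ^ 7) ^ (2 : ℤ)))
        (thetaRatio ((q ^ 7) ^ 7) ((q ^ 7) ^ (3 : ℤ)))) := by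
  have hQ := pow_ne_zero 7 hq
  have hp := pow_ne_zero 7 hQ
  obtain ⟨v0, v1, v2, v3⟩ := phase_values hq
  have t0 := theta_cube_mul_sq hp one_ne_zero
  rw [inv_one, mul_one, mul_one] at t0
  have t1 := theta_pair hQ hQ3 (c := 1) (by norm_num) (by norm_num)
  have t2 := theta_pair hQ hQ3 (c := 2) (by norm_num) (by norm_num)
  have t3 := theta_pair hQ hQ3 (c := 3) (by norm_num) (by norm_num)
  rw [thetaSeries_dissection hq hq1 fun c => rfl, cube_zpow_tri_mul_neg hq 1,
    cube_zpow_tri_mul_neg hq 2, cube_zpow_tri_mul_neg hq 3, v0, phaseSum, ← v1, ← v2]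
  simp only [mul_zero, zpow_zero, mul_one] at t1 ⊢
  rw [t0]
  linear_combination -q ^ 2 * (((q ^ 3) ^ tri (-1) * (-q ^ 5) ^ (-1 : ℤ)) * t1 +
    ((q ^ 3) ^ tri (-2) * (-q ^ 5) ^ (-2 : ℤ)) * t2 +
    ((q ^ 3) ^ tri (-3) * (-q ^ 5) ^ (-3 : ℤ)) * t3 +
    thetaRatio ((q ^ 7) ^ 7) ((q ^ 7) ^ (3 : ℤ)) * theta (((q ^ 7) ^ 7) ^ 3) ((q ^ 7) ^ 7) * v3)

theorem lambertSeries_phaseSum {q : ℂ} (hq : q ≠ 0) (hQ3 : ‖q ^ 7‖ < 1 / 3) (hq1 : ‖q‖ < 1) {a : ℤ}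
    (ha1 : 1 ≤ a) (ha3 : a ≤ 3) :
    lambertSeries q (3 - 3 * a) + 1 = (-1) ^ a * q ^ (2 * a - 3 * tri a) *
      (((q ^ 7) ^ a * appell ((q ^ 7) ^ 7) 1 ((q ^ 7) ^ a) +
          theta (((q ^ 7) ^ 7) ^ 3) ((q ^ 7) ^ 7)) *
        (1 + phaseSum q (thetaRatio ((q ^ 7) ^ 7) ((q ^ 7) ^ (1 : ℤ)))
          (thetaRatio ((q ^ 7) ^ 7) ((q ^ 7) ^ (2 : ℤ)))
          (thetaRatio ((q ^ 7) ^ 7) ((q ^ 7) ^ (3 : ℤ)))) +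
        (q ^ 7) ^ a * phaseSum q (appellDefect (q ^ 7) a 1) (appellDefect (q ^ 7) a 2)
          (appellDefect (q ^ 7) a 3)) := by
  have hQ := pow_ne_zero 7 hq
  have hp := pow_ne_zero 7 hQ
  obtain ⟨v0, v1, v2, v3⟩ := phase_values hq
  have t0 := theta_cube_mul_sq hp one_ne_zero
  rw [inv_one, mul_one, mul_one] at t0
  have t1 := theta_pair hQ hQ3 (c := 1) (by norm_num) (by norm_num)
  have t2 := theta_pair hQ hQ3 (c := 2) (by norm_num) (by norm_num)
  have t3 := theta_pair hQ hQ3 (c := 3) (by norm_num) (by norm_num)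
  have a1 := appell_pair hQ a 1
  have a2 := appell_pair hQ a 2
  have a3 := appell_pair hQ a 3
  rw [lambertSeries_dissection hq hq1 ha1 ha3
    (fun c hc1 hc3 => summable_appell_seven hQ hQ3 ha1 ha3 hc1 hc3) fun c => rfl,
    cube_zpow_tri_mul_neg hq 1,
    cube_zpow_tri_mul_neg hq 2, cube_zpow_tri_mul_neg hq 3, v0, phaseSum, phaseSum, ← v1, ← v2]
  simp only [mul_zero, zpow_zero, mul_one, add_zero, one_mul] at t1 a1 ⊢
  rw [t0]
  linear_combination (-1) ^ a * q ^ (2 * a - 3 * tri a) *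
    (((q ^ 3) ^ tri (-1) * (-q ^ 5) ^ (-1 : ℤ)) * (t1 + a1) +
    ((q ^ 3) ^ tri (-2) * (-q ^ 5) ^ (-2 : ℤ)) * (t2 + a2) +
    ((q ^ 3) ^ tri (-3) * (-q ^ 5) ^ (-3 : ℤ)) * (t3 + a3) +
    (thetaRatio ((q ^ 7) ^ 7) ((q ^ 7) ^ (3 : ℤ)) * theta (((q ^ 7) ^ 7) ^ 3) ((q ^ 7) ^ 7) +
      (q ^ 7) ^ a * (appellDefect (q ^ 7) a 3 + thetaRatio ((q ^ 7) ^ 7) ((q ^ 7) ^ (3 : ℤ)) *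
        appell ((q ^ 7) ^ 7) 1 ((q ^ 7) ^ a))) * v3)

section

variable {q X Y Z D L M N : ℂ}

theorem thetaLogs_add_eq (hX : X ≠ 0) (hY : Y ≠ 0) (hZ : Z ≠ 0)
    (hk : Z ^ 3 * X - Y ^ 3 * Z + q ^ 7 * X ^ 3 * Y = 0)
    (h1 : 2 * L + M + N - 1 = D * Z / X ^ 2) (h2 : 2 * M - N - L = -(q ^ 7 * D * X / Y ^ 2))
    (h3 : 2 * N - L + M = -(q ^ 7 * D * Y / Z ^ 2)) :
    L + M - 4 / 7 - D * (q * Y / X ^ 2 - q ^ 5 / Y) =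
      -D / 7 * (Y / X - q * Z / Y - q ^ 2 + q ^ 5 * X / Z) * (-4 * (Z / (X * Y)) + 3 * (q / X) -
        q ^ 2 * Y / (X * Z) + 2 * (q ^ 3 / Y) + q ^ 4 / Z - 2 * (q ^ 6 * X / (Y * Z))) := by
  have e : L + M - 4 / 7 = (4 * (D * Z / X ^ 2) + 2 * -(q ^ 7 * D * X / Y ^ 2) -
      -(q ^ 7 * D * Y / Z ^ 2)) / 7 := by linear_combination (4 * h1 + 2 * h2 - h3) / 7
  rw [e, ← sub_eq_zero]
  trans -D * (Z ^ 3 * X - Y ^ 3 * Z + q ^ 7 * X ^ 3 * Y) *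
    (-4 * q * Z + 2 * q ^ 4 * X - q ^ 2 * Y) / (7 * X ^ 2 * Y ^ 2 * Z ^ 2)
  · field_simp
    ring
  · rw [hk]; simp

theorem thetaLogs_sub_eq (hX : X ≠ 0) (hY : Y ≠ 0) (hZ : Z ≠ 0)
    (hk : Z ^ 3 * X - Y ^ 3 * Z + q ^ 7 * X ^ 3 * Y = 0)
    (h1 : 2 * L + M + N - 1 = D * Z / X ^ 2) (h2 : 2 * M - N - L = -(q ^ 7 * D * X / Y ^ 2))
    (h3 : 2 * N - L + M = -(q ^ 7 * D * Y / Z ^ 2)) :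
    M - N - 1 / 7 - D * (-q ^ 6 / Z + q ^ 4 * Z / Y ^ 2) =
      -D / 7 * (Y / X - q * Z / Y - q ^ 2 + q ^ 5 * X / Z) * (-(Z / (X * Y)) - q / X -
        2 * (q ^ 2 * Y / (X * Z)) - 3 * (q ^ 3 / Y) + 2 * (q ^ 4 / Z) -
          4 * (q ^ 6 * X / (Y * Z))) := by
  have e : M - N - 1 / 7 = (D * Z / X ^ 2 + 4 * -(q ^ 7 * D * X / Y ^ 2) -
      2 * -(q ^ 7 * D * Y / Z ^ 2)) / 7 := by linear_combination (h1 + 4 * h2 - 2 * h3) / 7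
  rw [e, ← sub_eq_zero]
  trans -D * (Z ^ 3 * X - Y ^ 3 * Z + q ^ 7 * X ^ 3 * Y) *
    (-q * Z + 4 * q ^ 4 * X - 2 * q ^ 2 * Y) / (7 * X ^ 2 * Y ^ 2 * Z ^ 2)
  · field_simp
    ring
  · rw [hk]; simp

theorem thetaLogs_sub_eq' (hX : X ≠ 0) (hY : Y ≠ 0) (hZ : Z ≠ 0)
    (hk : Z ^ 3 * X - Y ^ 3 * Z + q ^ 7 * X ^ 3 * Y = 0)
    (h1 : 2 * L + M + N - 1 = D * Z / X ^ 2) (h2 : 2 * M - N - L = -(q ^ 7 * D * X / Y ^ 2))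
    (h3 : 2 * N - L + M = -(q ^ 7 * D * Y / Z ^ 2)) :
    N - L + 2 / 7 - D * (q ^ 9 * X / Z ^ 2 - q ^ 3 / X) =
      -D / 7 * (Y / X - q * Z / Y - q ^ 2 + q ^ 5 * X / Z) * (2 * (Z / (X * Y)) + 2 * (q / X) +
        4 * (q ^ 2 * Y / (X * Z)) - q ^ 3 / Y + 3 * (q ^ 4 / Z) + q ^ 6 * X / (Y * Z)) := by
  have e : N - L + 2 / 7 = (-2 * (D * Z / X ^ 2) - -(q ^ 7 * D * X / Y ^ 2) +
      4 * -(q ^ 7 * D * Y / Z ^ 2)) / 7 := by linear_combination (-2 * h1 - h2 + 4 * h3) / 7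
  rw [e, ← sub_eq_zero]
  trans -D * (Z ^ 3 * X - Y ^ 3 * Z + q ^ 7 * X ^ 3 * Y) *
    (2 * q * Z - q ^ 4 * X + 4 * q ^ 2 * Y) / (7 * X ^ 2 * Y ^ 2 * Z ^ 2)
  · field_simp
    ring
  · rw [hk]; simp

end

theorem appellDefect_values {Q : ℂ} (hQ : Q ≠ 0) (hQ3 : ‖Q‖ < 1 / 3) :
    appellDefect Q 1 1 = thetaSevenLog Q 1 + thetaSevenLog Q 2 ∧
    appellDefect Q 1 2 = deriv (theta (Q ^ 7)) 1 * (Q * thetaSeven Q 2 / thetaSeven Q 1 ^ 2) ∧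
    appellDefect Q 1 3 = deriv (theta (Q ^ 7)) 1 * (Q ^ 2 / thetaSeven Q 2) ∧
    appellDefect Q 2 1 = -deriv (theta (Q ^ 7)) 1 / thetaSeven Q 3 ∧
    appellDefect Q 2 2 = thetaSevenLog Q 2 - thetaSevenLog Q 3 ∧
    appellDefect Q 2 3 = deriv (theta (Q ^ 7)) 1 * (Q * thetaSeven Q 3 / thetaSeven Q 2 ^ 2) ∧
    appellDefect Q 3 1 = -deriv (theta (Q ^ 7)) 1 * thetaSeven Q 1 / thetaSeven Q 3 ^ 2 ∧
    appellDefect Q 3 2 = -deriv (theta (Q ^ 7)) 1 / thetaSeven Q 1 ∧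
    appellDefect Q 3 3 = thetaSevenLog Q 3 - thetaSevenLog Q 1 := by
  have hQ1 : ‖Q‖ < 1 := by linarith
  have hX := thetaSeven_ne_zero hQ hQ3 (c := 1) (by norm_num) (by norm_num)
  have hY := thetaSeven_ne_zero hQ hQ3 (c := 2) (by norm_num) (by norm_num)
  have hZ := thetaSeven_ne_zero hQ hQ3 (c := 3) (by norm_num) (by norm_num)
  have m1 : thetaSeven Q (-1) = -Q⁻¹ * thetaSeven Q 1 := by simpa using thetaSeven_neg hQ 1
  have m2 : thetaSeven Q (-2) = -(Q ^ 2)⁻¹ * thetaSeven Q 2 := by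
    rw [thetaSeven_neg hQ 2]; norm_cast
  have l4 : thetaSevenLog Q 4 = -thetaSevenLog Q 3 := by
    have h := thetaSevenLog_add_seven hQ hQ1 (n := -3)
      (thetaSeven_ne_zero_of_lt hQ hQ3 (by norm_num) (by norm_num) (by norm_num))
    rw [thetaSevenLog_neg hQ hQ1 hZ] at h
    norm_num at h
    exact h
  have l6 : thetaSevenLog Q 6 = -thetaSevenLog Q 1 := by
    have h := thetaSevenLog_add_seven hQ hQ1 (n := -1)
      (thetaSeven_ne_zero_of_lt hQ hQ3 (by norm_num) (by norm_num) (by norm_num))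
    rw [thetaSevenLog_neg hQ hQ1 hX] at h
    norm_num at h
    exact h
  have hne := fun a c h => @appellDefect_of_ne Q hQ hQ3 a c h
  refine ⟨?_, ?_, ?_, ?_, ?_, ?_, ?_, ?_, ?_⟩
  · exact appellDefect_self hQ hQ3 (by norm_num) (by norm_num)
  · rw [hne 1 2 (by norm_num) (by norm_num) (by norm_num) (by norm_num) (by norm_num)]
    norm_num [m1, thetaSeven_four hQ]
    field_simp
  · rw [hne 1 3 (by norm_num) (by norm_num) (by norm_num) (by norm_num) (by norm_num)]
    norm_num [m2, thetaSeven_four hQ, thetaSeven_six hQ]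
    field_simp
  · rw [hne 2 1 (by norm_num) (by norm_num) (by norm_num) (by norm_num) (by norm_num)]
    norm_num
    field_simp
  · rw [appellDefect_self hQ hQ3 (by norm_num) (by norm_num), show (2 * 2 : ℤ) = 4 from rfl, l4,
      sub_eq_add_neg]
  · rw [hne 2 3 (by norm_num) (by norm_num) (by norm_num) (by norm_num) (by norm_num)]
    norm_num [m1, thetaSeven_five hQ, thetaSeven_six hQ]
    field_simp
  · rw [hne 3 1 (by norm_num) (by norm_num) (by norm_num) (by norm_num) (by norm_num)]
    norm_num [thetaSeven_four hQ]
    field_simp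
  · rw [hne 3 2 (by norm_num) (by norm_num) (by norm_num) (by norm_num) (by norm_num)]
    norm_num [thetaSeven_four hQ, thetaSeven_five hQ]
    field_simp
  · rw [appellDefect_self hQ hQ3 (by norm_num) (by norm_num), show (2 * 3 : ℤ) = 6 from rfl, l6,
      sub_eq_add_neg]

theorem thetaRatio_values {Q : ℂ} (hQ : Q ≠ 0) :
    thetaRatio (Q ^ 7) (Q ^ (1 : ℤ)) = Q * thetaSeven Q 2 / thetaSeven Q 1 ∧
    thetaRatio (Q ^ 7) (Q ^ (2 : ℤ)) = Q ^ 2 * thetaSeven Q 3 / thetaSeven Q 2 ∧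
    thetaRatio (Q ^ 7) (Q ^ (3 : ℤ)) = Q ^ 3 * thetaSeven Q 1 / thetaSeven Q 3 := by
  refine ⟨?_, ?_, ?_⟩
  · rw [thetaRatio_pow_seven, zpow_one]; norm_num
  · rw [thetaRatio_pow_seven, ← thetaSeven_four hQ]; norm_cast
  · rw [thetaRatio_pow_seven, ← thetaSeven_six hQ]; norm_cast

/-- The seven-dissection of the pentagonal number series, divided by the theta constant. -/
noncomputable def thetaFactor (q : ℂ) : ℂ :=
  thetaSeven (q ^ 7) 2 / thetaSeven (q ^ 7) 1 - q * thetaSeven (q ^ 7) 3 / thetaSeven (q ^ 7) 2 -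
    q ^ 2 + q ^ 5 * thetaSeven (q ^ 7) 1 / thetaSeven (q ^ 7) 3

theorem one_add_phaseSum_thetaRatio {q : ℂ} (hq : q ≠ 0) (hQ3 : ‖q ^ 7‖ < 1 / 3) :
    1 + phaseSum q (thetaRatio ((q ^ 7) ^ 7) ((q ^ 7) ^ (1 : ℤ)))
        (thetaRatio ((q ^ 7) ^ 7) ((q ^ 7) ^ (2 : ℤ)))
        (thetaRatio ((q ^ 7) ^ 7) ((q ^ 7) ^ (3 : ℤ))) = -(q ^ 2)⁻¹ * thetaFactor q := by
  have hQ := pow_ne_zero 7 hq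
  obtain ⟨r1, r2, r3⟩ := thetaRatio_values hQ
  have hX := thetaSeven_ne_zero hQ hQ3 (c := 1) (by norm_num) (by norm_num)
  have hY := thetaSeven_ne_zero hQ hQ3 (c := 2) (by norm_num) (by norm_num)
  have hZ := thetaSeven_ne_zero hQ hQ3 (c := 3) (by norm_num) (by norm_num)
  rw [r1, r2, r3, phaseSum, thetaFactor]
  generalize thetaSeven (q ^ 7) 1 = X, thetaSeven (q ^ 7) 2 = Y, thetaSeven (q ^ 7) 3 = Z at *
  field_simp
  ring

theorem thetaSeries_eq_thetaFactor {q : ℂ} (hq : q ≠ 0) (hQ3 : ‖q ^ 7‖ < 1 / 3) (hq1 : ‖q‖ < 1) :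
    thetaSeries (q ^ 3) (-q ^ 2) =
      theta (((q ^ 7) ^ 7) ^ 3) ((q ^ 7) ^ 7) * thetaFactor q := by
  rw [thetaSeries_phaseSum hq hQ3 hq1, one_add_phaseSum_thetaRatio hq hQ3]
  field_simp

/-- The generating function of the number of partitions with given rank modulo seven is, up to
a multiple of the partition generating function, a difference of two of these functions. -/
noncomputable def rankSeries (q : ℂ) (j : ℤ) : ℂ :=
  (lambertSeries q j + (3 - j) / 7) / thetaSeries (q ^ 3) (-q ^ 2)

theorem thetaSeries_cube_ne_zero {q : ℂ} (hq0 : q ≠ 0) (hq : ‖q‖ < 1 / 2) :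
    thetaSeries (q ^ 3) (-q ^ 2) ≠ 0 :=
  right_ne_zero_of_mul (partitionGF_univ_mul_thetaSeries hq0 hq ▸ one_ne_zero)

theorem rankSeries_six_sub {q : ℂ} (hq0 : q ≠ 0) (hq : ‖q‖ < 1 / 2) (j : ℤ) :
    rankSeries q (6 - j) = -rankSeries q j := by
  rw [rankSeries, rankSeries, lambertSeries_six_sub hq0 hq]
  push_cast
  ring

theorem lambertSeries_four {q : ℂ} (hq0 : q ≠ 0) (hq : ‖q‖ < 1 / 2) :
    lambertSeries q 4 = lambertSeries q (-3) + 1 + q⁻¹ * thetaSeries (q ^ 3) (-q ^ 2) := by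
  have h := lambertSeries_sub hq0 hq (-3)
  have h1 := thetaSeries_mul_left (pow_ne_zero 3 hq0)
    (neg_ne_zero.2 (zpow_ne_zero (-3 + 2 : ℤ) hq0))
  rw [show q ^ 3 * -q ^ (-3 + 2 : ℤ) = -q ^ 2 by
    rw [show (-3 + 2 : ℤ) = -1 by norm_num, zpow_neg_one]; field_simp] at h1
  rw [show (-3 + 7 : ℤ) = 4 by norm_num] at h
  rw [h1]
  rw [show (-3 + 2 : ℤ) = -1 by norm_num, zpow_neg_one] at *
  generalize thetaSeries (q ^ 3) (-q⁻¹) = t at *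
  field_simp
  linear_combination -h

theorem lambertSeries_one {q : ℂ} (hq0 : q ≠ 0) (hq : ‖q‖ < 1 / 2) :
    lambertSeries q 1 = lambertSeries q (-6) + 1 -
      (q ^ 5)⁻¹ * thetaSeries (q ^ 3) (-q ^ 2) := by
  have h := lambertSeries_sub hq0 hq (-6)
  have h1 := thetaSeries_mul_left (pow_ne_zero 3 hq0) (neg_ne_zero.2 (inv_ne_zero hq0))
  have h2 := thetaSeries_mul_left (pow_ne_zero 3 hq0)
    (neg_ne_zero.2 (inv_ne_zero (pow_ne_zero 4 hq0)))
  rw [show q ^ 3 * -q⁻¹ = -q ^ 2 by field_simp] at h1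
  rw [show q ^ 3 * -(q ^ 4)⁻¹ = -q⁻¹ by field_simp] at h2
  rw [show (-6 + 7 : ℤ) = 1 by norm_num, show q ^ (-6 + 2 : ℤ) = (q ^ 4)⁻¹ by
    rw [show (-6 + 2 : ℤ) = -4 by norm_num, zpow_neg]; norm_cast] at h
  rw [h1, h2]
  generalize thetaSeries (q ^ 3) (-(q ^ 4)⁻¹) = t at *
  field_simp
  linear_combination -h

/-- A function of the form `∑ q ^ d * g d (q ^ 7)` over all `d ≢ 5` modulo seven. -/
def HasNoFifthPart (F : ℂ → ℂ) : Prop :=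
  ∃ g : ℕ → ℂ → ℂ, ∀ q : ℂ, q ≠ 0 → ‖q‖ < 1 / 3 →
    F q = ∑ d ∈ {0, 1, 2, 3, 4, 6}, q ^ d * g d (q ^ 7)

theorem norm_pow_seven_lt {q : ℂ} (hq : ‖q‖ < 1 / 3) : ‖q ^ 7‖ < 1 / 3 := by
  rw [norm_pow]
  exact (pow_le_of_le_one (norm_nonneg q) (by linarith) (by norm_num)).trans_lt hq

theorem hasNoFifthPart_of_eq {F g κ X Y Z : ℂ → ℂ} {e : ℕ}
    (he : e ∈ ({0, 1, 2, 3, 4, 6} : Finset ℕ)) {c₀ c₁ c₂ c₃ c₄ c₆ : ℂ}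
    (h : ∀ q : ℂ, q ≠ 0 → ‖q‖ < 1 / 3 → F q = q ^ e * g (q ^ 7) + κ (q ^ 7) *
      (c₀ * (Z (q ^ 7) / (X (q ^ 7) * Y (q ^ 7))) + c₁ * (q / X (q ^ 7)) +
        c₂ * (q ^ 2 * Y (q ^ 7) / (X (q ^ 7) * Z (q ^ 7))) + c₃ * (q ^ 3 / Y (q ^ 7)) +
        c₄ * (q ^ 4 / Z (q ^ 7)) + c₆ * (q ^ 6 * X (q ^ 7) / (Y (q ^ 7) * Z (q ^ 7))))) :
    HasNoFifthPart F := by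
  refine ⟨fun d Q => (if d = e then g Q else 0) + κ Q *
    ((if d = 0 then c₀ * (Z Q / (X Q * Y Q)) else 0) + (if d = 1 then c₁ / X Q else 0) +
      (if d = 2 then c₂ * Y Q / (X Q * Z Q) else 0) + (if d = 3 then c₃ / Y Q else 0) +
      (if d = 4 then c₄ / Z Q else 0) + (if d = 6 then c₆ * X Q / (Y Q * Z Q) else 0)),
    fun q hq0 hq => ?_⟩
  simp_rw [h q hq0 hq, mul_add, Finset.sum_add_distrib, mul_ite, mul_zero, Finset.sum_ite_eq']
  rw [if_pos he]
  simp
  ring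

theorem HasNoFifthPart.sub {F G : ℂ → ℂ} (hF : HasNoFifthPart F) (hG : HasNoFifthPart G) :
    HasNoFifthPart fun q => F q - G q := by
  obtain ⟨g, hg⟩ := hF
  obtain ⟨k, hk⟩ := hG
  refine ⟨fun d Q => g d Q - k d Q, fun q hq0 hq => ?_⟩
  simp_rw [hg q hq0 hq, hk q hq0 hq, ← Finset.sum_sub_distrib, mul_sub]

theorem HasNoFifthPart.fifthPart_eq_zero {F : ℂ → ℂ} (hF : HasNoFifthPart F) {q : ℂ} (hq0 : q ≠ 0)
    (hq : ‖q‖ < 1 / 3) : fifthPart F q = 0 := by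
  obtain ⟨g, hg⟩ := hF
  have h1 : fifthPart F q =
      ∑ d ∈ {0, 1, 2, 3, 4, 6}, fifthPart (fun q => q ^ d * g d (q ^ 7)) q := by
    simp_rw [fifthPart]
    rw [Finset.sum_comm]
    refine Finset.sum_congr rfl fun i _ => ?_
    have hr := isPrimitiveRoot_rootSeven.ne_zero (by norm_num)
    rw [← Finset.mul_sum, hg _ (mul_ne_zero (pow_ne_zero i hr) hq0)
      (by rwa [norm_mul, norm_pow, norm_rootSeven, one_pow, one_mul])]
  rw [h1]
  refine Finset.sum_eq_zero fun d hd => fifthPart_pow_mul ?_ q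
  fin_cases hd <;> norm_num

theorem hasNoFifthPart_rankSeries_zero : HasNoFifthPart fun q => rankSeries q 0 := by
  refine hasNoFifthPart_of_eq (e := 0) (by decide)
    (g := fun Q => Q * appell (Q ^ 7) 1 Q / theta ((Q ^ 7) ^ 3) (Q ^ 7) + 1)
    (κ := fun Q => -deriv (theta (Q ^ 7)) 1 / (7 * theta ((Q ^ 7) ^ 3) (Q ^ 7)))
    (X := fun Q => thetaSeven Q 1) (Y := fun Q => thetaSeven Q 2) (Z := fun Q => thetaSeven Q 3)
    (c₀ := -4) (c₁ := 3) (c₂ := -1) (c₃ := 2) (c₄ := 1) (c₆ := -2) fun q hq0 hq => ?_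
  have hQ := pow_ne_zero 7 hq0
  have hQ3 := norm_pow_seven_lt hq
  have hE := thetaSeries_cube_ne_zero hq0 (by linarith)
  have hX := thetaSeven_ne_zero hQ hQ3 (c := 1) (by norm_num) (by norm_num)
  have hY := thetaSeven_ne_zero hQ hQ3 (c := 2) (by norm_num) (by norm_num)
  have hZ := thetaSeven_ne_zero hQ hQ3 (c := 3) (by norm_num) (by norm_num)
  have hS := lambertSeries_phaseSum hq0 hQ3 (by linarith) (a := 1) (by norm_num) (by norm_num)
  obtain ⟨v1, v2, v3, -⟩ := appellDefect_values hQ hQ3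
  have hlog := thetaLogs_add_eq hX hY hZ (thetaSeven_klein hQ (by linarith))
    (thetaSevenLog_sum_one hQ hQ3) (thetaSevenLog_sum_two hQ hQ3) (thetaSevenLog_sum_three hQ hQ3)
  rw [one_add_phaseSum_thetaRatio hq0 hQ3, v1, v2, v3, phaseSum, show tri 1 = 0 from rfl] at hS
  rw [thetaSeries_eq_thetaFactor hq0 hQ3 (by linarith)] at hE
  have hE7 := left_ne_zero_of_mul hE
  rw [rankSeries, thetaSeries_eq_thetaFactor hq0 hQ3 (by linarith), div_eq_iff hE]
  norm_num at hS ⊢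
  rw [← thetaFactor] at hlog
  generalize thetaFactor q = e, theta (((q ^ 7) ^ 7) ^ 3) ((q ^ 7) ^ 7) = E₇,
    appell ((q ^ 7) ^ 7) 1 (q ^ 7) = A, lambertSeries q 0 = S, deriv (theta ((q ^ 7) ^ 7)) 1 = D,
    thetaSeven (q ^ 7) 1 = X, thetaSeven (q ^ 7) 2 = Y, thetaSeven (q ^ 7) 3 = Z,
    thetaSevenLog (q ^ 7) 1 = L, thetaSevenLog (q ^ 7) 2 = M at *
  trans (q ^ 7 * A + E₇) * e + (L + M - 4 / 7 - D * (q * Y / X ^ 2 - q ^ 5 / Y))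
  · rw [eq_sub_of_add_eq hS]
    field_simp
    ring
  · rw [hlog]
    field_simp
    ring

theorem hasNoFifthPart_rankSeries_four : HasNoFifthPart fun q => rankSeries q 4 := by
  refine hasNoFifthPart_of_eq (e := 6) (by decide)
    (g := fun Q => -(Q * appell (Q ^ 7) 1 (Q ^ 2) / theta ((Q ^ 7) ^ 3) (Q ^ 7)))
    (κ := fun Q => -deriv (theta (Q ^ 7)) 1 / (7 * theta ((Q ^ 7) ^ 3) (Q ^ 7)))
    (X := fun Q => thetaSeven Q 1) (Y := fun Q => thetaSeven Q 2) (Z := fun Q => thetaSeven Q 3)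
    (c₀ := -1) (c₁ := -1) (c₂ := -2) (c₃ := -3) (c₄ := 2) (c₆ := -4) fun q hq0 hq => ?_
  have hQ := pow_ne_zero 7 hq0
  have hQ3 := norm_pow_seven_lt hq
  have hE := thetaSeries_cube_ne_zero hq0 (by linarith)
  have hX := thetaSeven_ne_zero hQ hQ3 (c := 1) (by norm_num) (by norm_num)
  have hY := thetaSeven_ne_zero hQ hQ3 (c := 2) (by norm_num) (by norm_num)
  have hZ := thetaSeven_ne_zero hQ hQ3 (c := 3) (by norm_num) (by norm_num)
  have hS := lambertSeries_phaseSum hq0 hQ3 (by linarith) (a := 2) (by norm_num) (by norm_num)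
  obtain ⟨-, -, -, v1, v2, v3, -⟩ := appellDefect_values hQ hQ3
  have hlog := thetaLogs_sub_eq hX hY hZ (thetaSeven_klein hQ (by linarith))
    (thetaSevenLog_sum_one hQ hQ3) (thetaSevenLog_sum_two hQ hQ3) (thetaSevenLog_sum_three hQ hQ3)
  rw [one_add_phaseSum_thetaRatio hq0 hQ3, v1, v2, v3, phaseSum, show tri 2 = 1 from rfl] at hS
  rw [thetaSeries_eq_thetaFactor hq0 hQ3 (by linarith)] at hE
  have hE7 := left_ne_zero_of_mul hE
  rw [rankSeries, lambertSeries_four hq0 (by linarith),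
    thetaSeries_eq_thetaFactor hq0 hQ3 (by linarith), div_eq_iff hE]
  norm_num at hS ⊢
  rw [← thetaFactor] at hlog
  generalize thetaFactor q = e, theta (((q ^ 7) ^ 7) ^ 3) ((q ^ 7) ^ 7) = E₇,
    appell ((q ^ 7) ^ 7) 1 ((q ^ 7) ^ 2) = A, lambertSeries q (-3) = S,
      deriv (theta ((q ^ 7) ^ 7)) 1 = D,
    thetaSeven (q ^ 7) 1 = X, thetaSeven (q ^ 7) 2 = Y, thetaSeven (q ^ 7) 3 = Z,
    thetaSevenLog (q ^ 7) 1 = L, thetaSevenLog (q ^ 7) 2 = M, thetaSevenLog (q ^ 7) 3 = N at *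
  trans -(q ^ 13 * A * e) + (M - N - 1 / 7 - D * (-q ^ 6 / Z + q ^ 4 * Z / Y ^ 2))
  · rw [eq_sub_of_add_eq hS]
    field_simp
    ring
  · rw [hlog]
    field_simp
    ring

theorem hasNoFifthPart_rankSeries_one : HasNoFifthPart fun q => rankSeries q 1 := by
  refine hasNoFifthPart_of_eq (e := 2) (by decide)
    (g := fun Q => Q ^ 2 * appell (Q ^ 7) 1 (Q ^ 3) / theta ((Q ^ 7) ^ 3) (Q ^ 7))
    (κ := fun Q => -deriv (theta (Q ^ 7)) 1 / (7 * theta ((Q ^ 7) ^ 3) (Q ^ 7)))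
    (X := fun Q => thetaSeven Q 1) (Y := fun Q => thetaSeven Q 2) (Z := fun Q => thetaSeven Q 3)
    (c₀ := 2) (c₁ := 2) (c₂ := 4) (c₃ := -1) (c₄ := 3) (c₆ := 1) fun q hq0 hq => ?_
  have hQ := pow_ne_zero 7 hq0
  have hQ3 := norm_pow_seven_lt hq
  have hE := thetaSeries_cube_ne_zero hq0 (by linarith)
  have hX := thetaSeven_ne_zero hQ hQ3 (c := 1) (by norm_num) (by norm_num)
  have hY := thetaSeven_ne_zero hQ hQ3 (c := 2) (by norm_num) (by norm_num)
  have hZ := thetaSeven_ne_zero hQ hQ3 (c := 3) (by norm_num) (by norm_num)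
  have hS := lambertSeries_phaseSum hq0 hQ3 (by linarith) (a := 3) (by norm_num) (by norm_num)
  obtain ⟨-, -, -, -, -, -, v1, v2, v3⟩ := appellDefect_values hQ hQ3
  have hlog := thetaLogs_sub_eq' hX hY hZ (thetaSeven_klein hQ (by linarith))
    (thetaSevenLog_sum_one hQ hQ3) (thetaSevenLog_sum_two hQ hQ3) (thetaSevenLog_sum_three hQ hQ3)
  rw [one_add_phaseSum_thetaRatio hq0 hQ3, v1, v2, v3, phaseSum, show tri 3 = 3 from rfl] at hS
  rw [thetaSeries_eq_thetaFactor hq0 hQ3 (by linarith)] at hE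
  have hE7 := left_ne_zero_of_mul hE
  rw [rankSeries, lambertSeries_one hq0 (by linarith),
    thetaSeries_eq_thetaFactor hq0 hQ3 (by linarith), div_eq_iff hE]
  norm_num at hS ⊢
  rw [← thetaFactor] at hlog
  generalize thetaFactor q = e, theta (((q ^ 7) ^ 7) ^ 3) ((q ^ 7) ^ 7) = E₇,
    appell ((q ^ 7) ^ 7) 1 ((q ^ 7) ^ 3) = A, lambertSeries q (-6) = S,
      deriv (theta ((q ^ 7) ^ 7)) 1 = D,
    thetaSeven (q ^ 7) 1 = X, thetaSeven (q ^ 7) 2 = Y, thetaSeven (q ^ 7) 3 = Z,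
    thetaSevenLog (q ^ 7) 1 = L, thetaSevenLog (q ^ 7) 2 = M, thetaSevenLog (q ^ 7) 3 = N at *
  trans q ^ 16 * A * e + (N - L + 2 / 7 - D * (q ^ 9 * X / Z ^ 2 - q ^ 3 / X))
  · rw [eq_sub_of_add_eq hS]
    field_simp
    ring
  · rw [hlog]
    field_simp
    ring

theorem hasNoFifthPart_rankSeries {j : ℤ} (h0 : 0 ≤ j) (h6 : j ≤ 6) :
    HasNoFifthPart fun q => rankSeries q j := by
  have hneg : ∀ (i l : ℤ), 6 - i = l → HasNoFifthPart (fun q => rankSeries q i) →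
      HasNoFifthPart fun q => rankSeries q l := by
    rintro i _ rfl ⟨g, hg⟩
    exact ⟨fun d Q => -g d Q, fun q hq0 hq => by
      simp only [rankSeries_six_sub hq0 (by linarith : ‖q‖ < 1 / 2), hg q hq0 hq, mul_neg,
        Finset.sum_neg_distrib]⟩
  have h3 : HasNoFifthPart fun q => rankSeries q 3 := by
    refine ⟨fun _ _ => 0, fun q hq0 hq => ?_⟩
    have h := rankSeries_six_sub hq0 (by linarith : ‖q‖ < 1 / 2) 3
    rw [show (6 - 3 : ℤ) = 3 by norm_num] at h
    simpa using self_eq_neg.1 h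
  interval_cases j
  · exact hasNoFifthPart_rankSeries_zero
  · exact hasNoFifthPart_rankSeries_one
  · exact hneg 4 2 (by norm_num) hasNoFifthPart_rankSeries_four
  · exact h3
  · exact hasNoFifthPart_rankSeries_four
  · exact hneg 1 5 (by norm_num) hasNoFifthPart_rankSeries_one
  · exact hneg 0 6 (by norm_num) hasNoFifthPart_rankSeries_zero

theorem partitionGF_rank_sub {q : ℂ} (hq0 : q ≠ 0) (hq : ‖q‖ < 1 / 2) {k : ℕ} (hk1 : 1 ≤ k)
    (hk6 : k ≤ 6) : partitionGF {s | s.rank % 7 = k} q - partitionGF Set.univ q / 7 =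
      rankSeries q k - rankSeries q (k - 1) := by
  rw [partitionGF_rank_mod hq0 hq hk1 hk6, rankSeries, rankSeries,
    eq_div_of_mul_eq (thetaSeries_cube_ne_zero hq0 hq) (partitionGF_univ_mul_thetaSeries hq0 hq)]
  push_cast
  ring

theorem card_rank_of_pos (n : ℕ) {k : ℕ} (hk1 : 1 ≤ k) (hk6 : k ≤ 6) :
    ((Finset.univ.filter fun p : Nat.Partition (7 * n + 5) => partitionRank p % 7 = k).card : ℚ) =
      (Fintype.card (Nat.Partition (7 * n + 5)) : ℚ) / 7 := by
  classical
  have hs : ∀ q : ℂ, ‖q‖ < 1 / 3 → HasSum (fun m =>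
      (((Finset.univ.filter fun p : Nat.Partition m => partitionRank p % 7 = k).card : ℂ) -
        (Fintype.card (Nat.Partition m) : ℂ) / 7) * q ^ m)
      (partitionGF {s | s.rank % 7 = k} q - partitionGF Set.univ q / 7) := fun q hq => by
    refine HasSum.congr_terms (fun m => ?_)
      ((hasSum_partitionGF (by linarith) {s | s.rank % 7 = k}).sub
      ((hasSum_partitionGF (by linarith) Set.univ).div_const 7))
    have e : (Finset.univ.filter fun p : Nat.Partition m =>
        ZeroFree.sigmaEquiv ⟨m, p⟩ ∈ {s : ZeroFree | s.rank % 7 = k}) =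
        Finset.univ.filter fun p : Nat.Partition m => partitionRank p % 7 = k :=
      Finset.filter_congr fun p _ => Iff.rfl
    rw [e]
    simp only [Set.mem_univ, Finset.filter_true, Finset.card_univ]
    ring
  have hF : HasNoFifthPart fun q =>
      partitionGF {s | s.rank % 7 = k} q - partitionGF Set.univ q / 7 := by
    obtain ⟨g, hg⟩ := (hasNoFifthPart_rankSeries (j := k) (by omega) (by omega)).sub
      (hasNoFifthPart_rankSeries (j := k - 1) (by omega) (by omega))
    exact ⟨g, fun q hq0 hq => by
      rw [← hg q hq0 hq]; exact partitionGF_rank_sub hq0 (by linarith) hk1 hk6⟩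
  have h := coeff_eq_zero_of_fifthPart (by norm_num : (0 : ℝ) < 1 / 3) hs
    (fun q hq0 hq => hF.fifthPart_eq_zero hq0 hq) n
  apply Rat.cast_injective (α := ℂ)
  push_cast
  exact sub_eq_zero.1 h

/-- **Dyson's conjecture mod 7** (Atkin–Swinnerton-Dyer): for every `n ≥ 0` and every
`0 ≤ k ≤ 6`, the number of partitions of `7n + 5` with rank congruent to `k` modulo `7`
equals `p(7n+5) / 7`. -/
theorem rank_equidistribution_mod_seven (n : ℕ) (k : ℤ) (hk0 : 0 ≤ k) (hk6 : k ≤ 6) :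
    ((Finset.univ.filter
        (fun p : Nat.Partition (7 * n + 5) => partitionRank p % 7 = k)).card : ℚ) =
      (Fintype.card (Nat.Partition (7 * n + 5)) : ℚ) / 7 := by
  obtain ⟨k, rfl⟩ := Int.eq_ofNat_of_zero_le hk0
  rcases Nat.eq_zero_or_pos k with rfl | hk
  · have h := Finset.card_eq_sum_card_fiberwise (s := Finset.univ) (t := Finset.range 7)
      (f := fun p : Nat.Partition (7 * n + 5) => (partitionRank p % 7).toNat) fun p _ => by
        simp only [Finset.coe_range, Set.mem_Iio]; omega
    have e : ∀ i : ℕ, (Finset.univ.filter fun p : Nat.Partition (7 * n + 5) =>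
        (partitionRank p % 7).toNat = i) =
        Finset.univ.filter fun p : Nat.Partition (7 * n + 5) => partitionRank p % 7 = i := fun i =>
      Finset.filter_congr fun p _ => by omega
    have h' : (Fintype.card (Nat.Partition (7 * n + 5)) : ℚ) = ∑ i ∈ Finset.range 7,
        ((Finset.univ.filter fun p : Nat.Partition (7 * n + 5) =>
          partitionRank p % 7 = (i : ℕ)).card : ℚ) := by
      rw [← Finset.card_univ, h, Nat.cast_sum]
      simp_rw [e]
    rw [Finset.sum_range_succ', Finset.sum_congr rfl fun i hi =>
      card_rank_of_pos n (k := i + 1) (by omega) (by have := Finset.mem_range.1 hi; omega),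
      Finset.sum_const, Finset.card_range] at h'
    simp only [nsmul_eq_mul] at h'
    push_cast at h' ⊢
    linarith
  · exact card_rank_of_pos n hk (by exact_mod_cast hk6)
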